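/- Let g ≥ 4 and let D be a positive integer divisible by 4. Then the map p₊ : H₂(Sp(2g, Z)) → H₂(Sp(2g, Z/DZ)) induced on second integral homology by the mod D reduction homomorphism p : Sp(2g, Z) → Sp(2g, Z/DZ) is surjective, and its image p₊(H₂(Sp(2g, Z))) has order exactly 2. -/

import Mathlib

noncomputable section

namespace GpH2

open Finsupp

variable (G : Type) [Group G]

/-- Second boundary map of the bar complex: `(g,h) ↦ [h] - [gh] + [g]`. -/
def d2 : ((G × G) →₀ ℤ) →ₗ[ℤ] (G →₀ ℤ) :=
  Finsupp.linearCombination ℤ fun p : G × G =>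
    Finsupp.single p.2 1 - Finsupp.single (p.1 * p.2) 1 + Finsupp.single p.1 1

/-- Third boundary map of the bar complex:
`(g,h,k) ↦ [(h,k)] - [(gh,k)] + [(g,hk)] - [(g,h)]`. -/
def d3 : ((G × G × G) →₀ ℤ) →ₗ[ℤ] ((G × G) →₀ ℤ) :=
  Finsupp.linearCombination ℤ fun t : G × G × G =>
    Finsupp.single (t.2.1, t.2.2) 1 - Finsupp.single (t.1 * t.2.1, t.2.2) 1
      + Finsupp.single (t.1, t.2.1 * t.2.2) 1 - Finsupp.single (t.1, t.2.1) 1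

/-- 2-cycles. -/
def Z2 : Submodule ℤ ((G × G) →₀ ℤ) := LinearMap.ker (d2 G)

/-- 2-boundaries. -/
def B2 : Submodule ℤ ((G × G) →₀ ℤ) := LinearMap.range (d3 G)

/-- The second homology group of `G` with trivial integral coefficients,
defined via the bar resolution as 2-cycles modulo 2-boundaries. -/
abbrev H2 := ↥(Z2 G) ⧸ (B2 G).comap (Z2 G).subtype

variable {G} {H : Type} [Group H]

/-- The map induced on bar 2-chains by a group homomorphism. -/
def C2 (f : G →* H) : ((G × G) →₀ ℤ) →ₗ[ℤ] ((H × H) →₀ ℤ) :=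
  Finsupp.lmapDomain ℤ ℤ (Prod.map f f)

def C1 (f : G →* H) : (G →₀ ℤ) →ₗ[ℤ] (H →₀ ℤ) :=
  Finsupp.lmapDomain ℤ ℤ f

def C3 (f : G →* H) : ((G × G × G) →₀ ℤ) →ₗ[ℤ] ((H × H × H) →₀ ℤ) :=
  Finsupp.lmapDomain ℤ ℤ (Prod.map f (Prod.map f f))

@[simp] theorem C2_single (f : G →* H) (p : G × G) (n : ℤ) :
    C2 f (Finsupp.single p n) = Finsupp.single (f p.1, f p.2) n := by
  simp [C2, Finsupp.mapDomain_single, Prod.map]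

@[simp] theorem C1_single (f : G →* H) (g : G) (n : ℤ) :
    C1 f (Finsupp.single g n) = Finsupp.single (f g) n := by
  simp [C1, Finsupp.mapDomain_single]

@[simp] theorem C3_single (f : G →* H) (t : G × G × G) (n : ℤ) :
    C3 f (Finsupp.single t n) = Finsupp.single (f t.1, f t.2.1, f t.2.2) n := by
  simp [C3, Finsupp.mapDomain_single, Prod.map]

theorem d2_comm (f : G →* H) : (d2 H).comp (C2 f) = (C1 f).comp (d2 G) := by
  refine Finsupp.lhom_ext fun p n => ?_
  simp only [LinearMap.comp_apply, C2_single, d2, Finsupp.linearCombination_single,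
    map_smul, map_sub, map_add, C1_single, map_mul]

theorem d3_comm (f : G →* H) : (d3 H).comp (C3 f) = (C2 f).comp (d3 G) := by
  refine Finsupp.lhom_ext fun t n => ?_
  simp only [LinearMap.comp_apply, C3_single, d3, Finsupp.linearCombination_single,
    map_smul, map_sub, map_add, C2_single, map_mul]

theorem C2_mem_Z2 (f : G →* H) : ∀ x ∈ Z2 G, C2 f x ∈ Z2 H := by
  intro x hx
  have := congrArg (fun φ => φ x) (d2_comm f)
  simp only [LinearMap.comp_apply] at this
  simp only [Z2, LinearMap.mem_ker] at hx ⊢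
  rw [this, hx, map_zero]

/-- The map induced by a group homomorphism on second homology. -/
def H2Map (f : G →* H) : H2 G →ₗ[ℤ] H2 H :=
  Submodule.mapQ _ _ ((C2 f).restrict (C2_mem_Z2 f)) (by
    rintro ⟨x, hxZ⟩ hx
    simp only [Submodule.mem_comap, Submodule.subtype_apply] at hx ⊢
    simp only [LinearMap.restrict_apply]
    obtain ⟨w, hw⟩ := hx
    have := congrArg (fun φ => φ w) (d3_comm f)
    simp only [LinearMap.comp_apply] at this
    exact ⟨C3 f w, by rw [this, hw]⟩)

end GpH2



open Matrix

/-- The symplectic group `Sp(2g, R)`: matrices `M` (of size `2g`) with `Mᵀ * J * M = J`,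
where `J` is the standard symplectic form (see `SymplecticGroup.mem_iff'`). -/
abbrev Sp (g : ℕ) (R : Type) [CommRing R] : Submonoid (Matrix (Fin g ⊕ Fin g) (Fin g ⊕ Fin g) R) :=
  Matrix.symplecticGroup (Fin g) R

namespace SpAux

variable {g : ℕ} {R S : Type} [CommRing R] [CommRing S]

theorem J_map (f : R →+* S) : (Matrix.J (Fin g) R).map f = Matrix.J (Fin g) S := by
  ext i j
  rcases i with i | i <;> rcases j with j | j <;>
    simp [Matrix.J, Matrix.fromBlocks, Matrix.one_apply, apply_ite f]

theorem map_mem (f : R →+* S) {A : Matrix (Fin g ⊕ Fin g) (Fin g ⊕ Fin g) R}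
    (hA : A ∈ Sp g R) : A.map f ∈ Sp g S := by
  rw [SymplecticGroup.mem_iff] at hA ⊢
  rw [← J_map f, ← Matrix.transpose_map, ← Matrix.map_mul, ← Matrix.map_mul, hA]

/-- The homomorphism `Sp(2g, R) → Sp(2g, S)` induced by a ring homomorphism `R → S`
(entrywise application). -/
def SpMap (f : R →+* S) (g : ℕ) : Sp g R →* Sp g S where
  toFun A := ⟨Matrix.map A.1 f, map_mem f A.2⟩
  map_one' := Subtype.ext <| by
    show ((1 : Matrix _ _ R)).map f = (1 : Matrix _ _ S)
    exact Matrix.map_one f (map_zero f) (map_one f)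
  map_mul' A B := Subtype.ext <| by
    show Matrix.map (A.1 * B.1) f = Matrix.map A.1 f * Matrix.map B.1 f
    exact Matrix.map_mul

end SpAux

namespace RankOne

variable {R E : Type*} [CommRing R] [Group E]

/-- The Weyl element attached to a pair of opposite one-parameter families. -/
def w (x y : R → E) (u : Rˣ) : E := x u * y (-(↑u⁻¹ : R)) * x u

/-- The torus element attached to a pair of opposite one-parameter families. -/
def h (x y : R → E) (u : Rˣ) : E := w x y u * w x y (-1)

/-- A pair of opposite one-parameter families satisfying the Steinberg relations of rank one. -/
structure System (x y : R → E) : Prop where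
  x_add : ∀ a b, x (a + b) = x a * x b
  y_add : ∀ a b, y (a + b) = y a * y b
  conj_x : ∀ (u : Rˣ) r, w x y u * x r * (w x y u)⁻¹ = y (-((↑u⁻¹ : R) ^ 2 * r))
  conj_y : ∀ (u : Rˣ) r, w x y u * y r * (w x y u)⁻¹ = x (-((u : R) ^ 2 * r))

namespace System

variable {x y : R → E} (S : System x y)
include S

theorem x_zero : x 0 = 1 := by
  have := S.x_add 0 0
  simpa using this

theorem y_zero : y 0 = 1 := by
  have := S.y_add 0 0
  simpa using this

theorem x_neg (a : R) : x (-a) = (x a)⁻¹ := by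
  rw [eq_inv_iff_mul_eq_one, ← S.x_add, neg_add_cancel, S.x_zero]

theorem y_neg (a : R) : y (-a) = (y a)⁻¹ := by
  rw [eq_inv_iff_mul_eq_one, ← S.y_add, neg_add_cancel, S.y_zero]

theorem w_neg (u : Rˣ) : w x y (-u) = (w x y u)⁻¹ := by
  simp only [w, inv_neg, Units.val_neg, S.x_neg, S.y_neg, _root_.mul_inv_rev, inv_inv]
  group

theorem w_neg_one : w x y (-1) = (w x y 1)⁻¹ := S.w_neg 1

theorem w_eq (u : Rˣ) : w x y u = y (-(↑u⁻¹ : R)) * x u * y (-(↑u⁻¹ : R)) := by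
  have h1 : w x y u * x u * (w x y u)⁻¹ = y (-(↑u⁻¹ : R)) := by
    rw [S.conj_x]; congr 1; rw [sq, mul_assoc, Units.inv_mul, mul_one]
  have h2 : w x y u * y (-(↑u⁻¹ : R)) * (w x y u)⁻¹ = x u := by
    rw [S.conj_y]; congr 1; rw [sq, mul_neg, neg_neg, mul_assoc, Units.mul_inv, mul_one]
  calc w x y u = w x y u * (x u * y (-(↑u⁻¹ : R)) * x u) * (w x y u)⁻¹ := by
        rw [← w, mul_inv_cancel_right]
    _ = (w x y u * x u * (w x y u)⁻¹) * (w x y u * y (-(↑u⁻¹ : R)) * (w x y u)⁻¹) *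
        (w x y u * x u * (w x y u)⁻¹) := by group
    _ = _ := by rw [h1, h2]

theorem w_mul_x (u : Rˣ) (r : R) : w x y u * x r = y (-((↑u⁻¹ : R) ^ 2 * r)) * w x y u := by
  rw [← S.conj_x, inv_mul_cancel_right]

theorem w_mul_y (u : Rˣ) (r : R) : w x y u * y r = x (-((u : R) ^ 2 * r)) * w x y u := by
  rw [← S.conj_y, inv_mul_cancel_right]

theorem h_mul_x (u : Rˣ) (r : R) : h x y u * x r = x ((u : R) ^ 2 * r) * h x y u := by
  rw [h, mul_assoc, S.w_mul_x, ← mul_assoc, S.w_mul_y, mul_assoc]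
  congr 2
  simp

theorem h_mul_y (u : Rˣ) (r : R) : h x y u * y r = y ((↑u⁻¹ : R) ^ 2 * r) * h x y u := by
  rw [h, mul_assoc, S.w_mul_y, ← mul_assoc, S.w_mul_x, mul_assoc]
  congr 2
  simp

theorem h_conj_w (u v : Rˣ) : h x y u * w x y v * (h x y u)⁻¹ = w x y (u ^ 2 * v) := by
  rw [mul_inv_eq_iff_eq_mul]
  conv_lhs => rw [w, ← mul_assoc, ← mul_assoc, S.h_mul_x, mul_assoc (x _), S.h_mul_y,
    mul_assoc, mul_assoc, S.h_mul_x]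
  rw [w]
  simp only [← mul_assoc]
  congr 4
  · simp only [_root_.mul_inv_rev, Units.val_mul, ← inv_pow, Units.val_pow_eq_pow_val]
    ring_nf

theorem w_conj_w (u v : Rˣ) : w x y u * w x y v * (w x y u)⁻¹ = w x y (u ^ 2 * v⁻¹) := by
  rw [mul_inv_eq_iff_eq_mul]
  conv_lhs => rw [show w x y v = x v * y (-(↑v⁻¹ : R)) * x v from rfl, ← mul_assoc, ← mul_assoc,
      S.w_mul_x, mul_assoc (y _), S.w_mul_y,
    mul_assoc, mul_assoc, S.w_mul_x]
  rw [S.w_eq (u ^ 2 * v⁻¹)]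
  have e : -(↑(u ^ 2 * v⁻¹)⁻¹ : R) = -((↑u⁻¹ : R) ^ 2 * v) := by
    simp only [_root_.mul_inv_rev, inv_inv, Units.val_mul, ← inv_pow, Units.val_pow_eq_pow_val]
    ring
  have e' : (↑(u ^ 2 * v⁻¹) : R) = -((u : R) ^ 2 * -(↑v⁻¹ : R)) := by
    push_cast; ring
  rw [e, e']
  simp only [mul_assoc]

theorem h_one : h x y 1 = 1 := by
  rw [h, S.w_neg_one, mul_inv_cancel]

theorem w_eq_h (u : Rˣ) : w x y u = h x y u * w x y 1 := by
  rw [h, S.w_neg_one, inv_mul_cancel_right]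

theorem w_one_conj_h (v : Rˣ) : w x y 1 * h x y v * (w x y 1)⁻¹ = h x y v⁻¹ := by
  have h1 := S.w_conj_w 1 v
  have h2 := S.w_conj_w 1 (-1)
  simp only [one_pow, one_mul, inv_neg, inv_one] at h1 h2
  calc w x y 1 * h x y v * (w x y 1)⁻¹ = (w x y 1 * w x y v * (w x y 1)⁻¹) *
        (w x y 1 * w x y (-1) * (w x y 1)⁻¹) := by rw [h]; group
    _ = _ := by rw [h1, h2, h]

theorem w_inv_mul_w (a b : Rˣ) :
    (w x y b)⁻¹ * w x y a = (h x y b⁻¹)⁻¹ * h x y a⁻¹ := by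
  have h1 := S.w_one_conj_h b⁻¹
  have h2 := S.w_one_conj_h a⁻¹
  rw [inv_inv] at h1 h2
  rw [S.w_eq_h b, S.w_eq_h a, ← h1, ← h2]
  group

theorem h_inv_mul_h_neg (u : Rˣ) : h x y u⁻¹ * h x y (-u) = h x y (-1) := by
  have h1 := S.w_conj_w (-1) (-u)
  have e : ((-1) ^ 2 * (-u)⁻¹ : Rˣ) = -u⁻¹ := by simp [inv_neg]
  rw [e, mul_inv_eq_iff_eq_mul] at h1
  rw [h, h, h, mul_assoc, ← mul_assoc (w x y (-1)), h1, S.w_neg]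
  group

theorem h_conj_h (u v : Rˣ) :
    h x y u * h x y v * (h x y u)⁻¹ = h x y (u ^ 2 * v) * (h x y (u ^ 2))⁻¹ := by
  have h1 := S.h_conj_w u v
  have h2 := S.h_conj_w u 1
  rw [mul_one] at h2
  have h3 : h x y u * w x y (-1) * (h x y u)⁻¹ = (w x y (u ^ 2))⁻¹ := by
    rw [← h2, S.w_neg_one]; group
  calc h x y u * h x y v * (h x y u)⁻¹ = (h x y u * w x y v * (h x y u)⁻¹) *
      (h x y u * w x y (-1) * (h x y u)⁻¹) := by
        rw [show h x y v = w x y v * w x y (-1) from rfl]; group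
    _ = w x y (u ^ 2 * v) * (w x y (u ^ 2))⁻¹ := by rw [h1, h3]
    _ = _ := by rw [S.w_eq_h (u ^ 2 * v), S.w_eq_h (u ^ 2)]; group

theorem commute_h_neg_one (v : Rˣ) : Commute (h x y (-1)) (h x y v) := by
  have := S.h_conj_h (-1) v
  rw [neg_one_sq, one_mul, S.h_one, inv_one, mul_one, mul_inv_eq_iff_eq_mul] at this
  exact this

end System

/-- The defect of a Gauss decomposition of `y t * x a` when `u = 1 + t * a` is a unit. -/
def gauss (x y : R → E) (u : Rˣ) (t a : R) : E :=
  (x (a * ↑u⁻¹))⁻¹ * (y t * x a) * (y (t * ↑u⁻¹))⁻¹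

namespace System

variable {x y : R → E} (S : System x y)
include S

omit S in
theorem y_mul_x (u : Rˣ) (t a : R) :
    y t * x a = x (a * ↑u⁻¹) * gauss x y u t a * y (t * ↑u⁻¹) := by
  rw [gauss]; group

theorem x_unit (a : Rˣ) : x (a : R) = y (↑a⁻¹ : R) * w x y a * y (↑a⁻¹ : R) := by
  rw [S.w_eq, S.y_neg]; group

theorem y_unit (b : Rˣ) : y (↑b⁻¹ : R) = x (b : R) * w x y (-b) * x (b : R) := by
  rw [S.w_neg, w, S.y_neg]; group

theorem gauss_unit_right (u a : Rˣ) (t : R) (hu : (u : R) = 1 + t * a) :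
    gauss x y u t a = (h x y (u * a⁻¹))⁻¹ * h x y a⁻¹ := by
  have hb : (a * u⁻¹)⁻¹ = u * a⁻¹ := by rw [_root_.mul_inv_rev, inv_inv]
  have e1 : t + (↑a⁻¹ : R) = ↑(a * u⁻¹)⁻¹ := by
    rw [hb, Units.val_mul, hu, add_mul, mul_assoc, Units.mul_inv, one_mul, mul_one, add_comm]
  have e2 : x (↑(a * u⁻¹) : R) * w x y a = w x y a * y (-((↑a⁻¹ : R) ^ 2 * ↑(a * u⁻¹))) := by
    have := S.w_mul_x (-a) ↑(a * u⁻¹)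
    rw [S.w_neg, inv_mul_eq_iff_eq_mul] at this
    rw [this, ← mul_assoc, inv_neg]
    have : ((↑(-a⁻¹) : R)) ^ 2 = (↑a⁻¹ : R) ^ 2 := by push_cast; ring
    rw [this]; group
  have e3 : -((↑a⁻¹ : R) ^ 2 * ↑(a * u⁻¹)) + (↑a⁻¹ : R) = t * ↑u⁻¹ := by
    have h1 : (u : R) * ↑u⁻¹ = 1 := Units.mul_inv u
    have h2 : (a : R) * ↑a⁻¹ = 1 := Units.mul_inv a
    rw [hu] at h1
    push_cast
    linear_combination (-(↑a⁻¹ : R)) * h1 + (t * ↑u⁻¹ - (↑a⁻¹ : R) * ↑u⁻¹) * h2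
  have key : y t * x a = x ↑(a * u⁻¹) * ((w x y (a * u⁻¹))⁻¹ * w x y a) * y (t * ↑u⁻¹) := by
    rw [S.x_unit a, ← mul_assoc, ← mul_assoc, ← S.y_add, e1, S.y_unit, ← e3, S.y_add,
      S.w_neg]
    simp only [mul_assoc]
    congr 2
    simp only [← mul_assoc]
    rw [e2]
  rw [gauss, key, S.w_inv_mul_w, hb, Units.val_mul]
  group

theorem gauss_unit_left (u t : Rˣ) (a : R) (hu : (u : R) = 1 + t * a) :
    gauss x y u t a = (h x y t)⁻¹ * h x y (t * u⁻¹) := by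
  have hb : (u * t⁻¹)⁻¹ = t * u⁻¹ := by rw [_root_.mul_inv_rev, inv_inv]
  have e1 : (↑t⁻¹ : R) + a = ↑(u * t⁻¹) := by
    rw [Units.val_mul, hu, add_mul, mul_comm (t : R), mul_assoc, Units.mul_inv, one_mul, mul_one]
  have e2 : w x y (-t⁻¹) * y (↑(t * u⁻¹) : R) =
      x (-((↑t⁻¹ : R) ^ 2 * ↑(t * u⁻¹))) * w x y (-t⁻¹) := by
    rw [S.w_mul_y]
    have : ((↑(-t⁻¹) : R)) ^ 2 = (↑t⁻¹ : R) ^ 2 := by push_cast; ring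
    rw [this]
  have e3 : (↑t⁻¹ : R) + -((↑t⁻¹ : R) ^ 2 * ↑(t * u⁻¹)) = a * ↑u⁻¹ := by
    have h1 : (u : R) * ↑u⁻¹ = 1 := Units.mul_inv u
    have h2 : (t : R) * ↑t⁻¹ = 1 := Units.mul_inv t
    rw [hu] at h1
    push_cast
    linear_combination (-(↑t⁻¹ : R)) * h1 + (a * ↑u⁻¹ - (↑t⁻¹ : R) * ↑u⁻¹) * h2
  have key : y t * x a = x (a * ↑u⁻¹) * ((w x y t⁻¹)⁻¹ * w x y (u * t⁻¹)) * y ↑(t * u⁻¹) := by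
    have h1 := S.y_unit t⁻¹
    rw [inv_inv] at h1
    rw [h1, mul_assoc, ← S.x_add, e1, S.x_unit (u * t⁻¹), hb, ← e3, S.x_add, ← S.w_neg]
    simp only [mul_assoc]
    congr 1
    simp only [← mul_assoc]
    rw [e2]
  rw [gauss, key, S.w_inv_mul_w, hb, inv_inv, Units.val_mul]
  group

theorem gauss_swap (u : Rˣ) (t a : R) :
    gauss x y u a t = (w x y 1 * gauss x y u t a * (w x y 1)⁻¹)⁻¹ := by
  have hx : ∀ r, w x y 1 * x r * (w x y 1)⁻¹ = (y r)⁻¹ := fun r => by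
    rw [S.conj_x, ← S.y_neg]; simp
  have hy : ∀ r, w x y 1 * y r * (w x y 1)⁻¹ = (x r)⁻¹ := fun r => by
    rw [S.conj_y, ← S.x_neg]; simp
  have e : w x y 1 * gauss x y u t a * (w x y 1)⁻¹ =
      (w x y 1 * x (a * ↑u⁻¹) * (w x y 1)⁻¹)⁻¹ *
      ((w x y 1 * y t * (w x y 1)⁻¹) * (w x y 1 * x a * (w x y 1)⁻¹)) *
      (w x y 1 * y (t * ↑u⁻¹) * (w x y 1)⁻¹)⁻¹ := by
    rw [gauss]; group
  rw [e, hx, hy, hx, hy, gauss]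
  group

theorem gauss_add (u₁ u₂ : Rˣ) (t : R) (a₁ : Rˣ) (a₂ : R) (h₁ : (u₁ : R) = 1 + t * a₁)
    (h₂ : (u₂ : R) = 1 + t * ↑u₁⁻¹ * a₂) :
    gauss x y (u₁ * u₂) t (a₁ + a₂) = gauss x y u₁ t a₁ * gauss x y u₂ (t * ↑u₁⁻¹) a₂ := by
  have e0 : y t * x (a₁ + a₂) = x (a₁ * ↑u₁⁻¹) * gauss x y u₁ t a₁ *
      (x (a₂ * ↑u₂⁻¹) * gauss x y u₂ (t * ↑u₁⁻¹) a₂ * y (t * ↑u₁⁻¹ * ↑u₂⁻¹)) := by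
    rw [S.x_add, ← mul_assoc, y_mul_x u₁ t, mul_assoc, y_mul_x u₂ (t * ↑u₁⁻¹)]
  have e1 : gauss x y u₁ t a₁ * x (a₂ * ↑u₂⁻¹) =
      x ((↑u₁⁻¹ : R) ^ 2 * (a₂ * ↑u₂⁻¹)) * gauss x y u₁ t a₁ := by
    rw [S.gauss_unit_right u₁ a₁ t h₁]
    have := S.h_mul_x (u₁ * a₁⁻¹) ((↑u₁⁻¹ : R) ^ 2 * (a₂ * ↑u₂⁻¹))
    rw [mul_assoc, S.h_mul_x, inv_mul_eq_iff_eq_mul]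
    simp only [← mul_assoc] at this ⊢
    rw [this, mul_assoc (x _) (h x y _), mul_inv_cancel, mul_one]
    congr 2
    have h3 : (u₁ : R) * ↑u₁⁻¹ = 1 := Units.mul_inv u₁
    push_cast
    linear_combination (-(a₂ * (↑a₁⁻¹ : R) ^ 2 * ↑u₂⁻¹) * (u₁ * ↑u₁⁻¹ + 1)) * h3
  have e2 : (a₁ : R) * ↑u₁⁻¹ + (↑u₁⁻¹ : R) ^ 2 * (a₂ * ↑u₂⁻¹) = (a₁ + a₂) * ↑(u₁ * u₂)⁻¹ := by
    have h3 : (u₁ : R) * ↑u₁⁻¹ = 1 := Units.mul_inv u₁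
    have h4 : (u₂ : R) * ↑u₂⁻¹ = 1 := Units.mul_inv u₂
    rw [h₁] at h3
    rw [h₂] at h4
    push_cast [_root_.mul_inv_rev]
    linear_combination (a₂ * (↑u₁⁻¹ : R) * ↑u₂⁻¹) * h3 - (a₁ * (↑u₁⁻¹ : R)) * h4
  rw [gauss, e0, ← e2, S.x_add]
  have e3 : y (t * ↑(u₁ * u₂)⁻¹) = y (t * ↑u₁⁻¹ * ↑u₂⁻¹) := by
    congr 1; push_cast [_root_.mul_inv_rev]; ring
  rw [e3]
  generalize x ((↑u₁⁻¹ : R) ^ 2 * (a₂ * ↑u₂⁻¹)) = p at e1 ⊢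
  rw [show ∀ q r s t : E, (q * p)⁻¹ * (q * r * (s * t)) = p⁻¹ * (r * s) * t from
    fun q r s t => by group, ← mul_assoc _ (x (a₂ * _)), e1]
  group

end System

end RankOne

namespace RankOne

/-- Additive abstraction of the torus elements of a rank one system whose torus is commutative. -/
structure Symbol {R A : Type*} [CommRing R] [AddCommGroup A] (H : Rˣ → A) : Prop where
  one : H 1 = 0
  sq_mul : ∀ u v, H (u ^ 2 * v) = H (u ^ 2) + H v
  inv_neg : ∀ u, H u⁻¹ + H (-u) = H (-1)

namespace Symbol

variable {R A : Type*} [CommRing R] [AddCommGroup A] {H : Rˣ → A} (T : Symbol H)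

/-- The cocycle of a symbol. -/
def c (H : Rˣ → A) (u v : Rˣ) : A := H u + H v - H (u * v)

theorem c_comm (u v : Rˣ) : c H u v = c H v u := by
  rw [c, c, mul_comm u v, add_comm (H u)]

theorem c_assoc (u v w : Rˣ) : c H u v + c H (u * v) w = c H u (v * w) + c H v w := by
  simp only [c, mul_assoc]; abel

include T

theorem c_one (v : Rˣ) : c H 1 v = 0 := by simp [c, T.one]

theorem c_sq_mul (u v x : Rˣ) : c H (u ^ 2 * v) x = c H v x := by
  rw [c, c, mul_assoc, T.sq_mul, T.sq_mul]; abel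

theorem c_neg (u : Rˣ) : c H u (-u) = 0 := by
  have h1 := T.inv_neg u
  have h2 := T.sq_mul u u⁻¹
  have h3 := T.sq_mul u (-1)
  have e : u ^ 2 * u⁻¹ = u := by group
  have e' : u * -u = u ^ 2 * -1 := by rw [mul_neg, mul_neg, mul_one, sq]
  rw [e] at h2
  rw [c, e', h3, h2, ← h1]; abel

theorem c_self (u v : Rˣ) : c H u u = c H u (u * v) + c H u v := by
  have h2 := T.sq_mul u v
  rw [sq] at h2
  simp only [c, ← mul_assoc, h2]; abel

theorem c_pow_mul_of_self {θ : Rˣ} (hθ : c H θ θ = 0) (n : ℕ) (x : Rˣ) (hx : c H θ x = 0) :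
    c H θ (θ ^ n * x) = 0 := by
  induction n with
  | zero => simpa using hx
  | succ n ih =>
    have := T.c_self θ (θ ^ n * x)
    rw [hθ, ih, add_zero, ← mul_assoc, ← pow_succ'] at this
    exact this.symm

theorem c_cyclic {θ : Rˣ} (hgen : ∀ u : Rˣ, ∃ n : ℕ, u = θ ^ n) (u v : Rˣ)
    (s : Rˣ) (hs : v = s ^ 2) (hns : ¬ ∃ r, u = r ^ 2)
    (hg : -H u = H (v * u⁻¹) - H v) (a b : Rˣ) : c H a b = 0 := by
  have par : ∀ a : Rˣ, (∃ r, a = r ^ 2) ∨ ∃ r, a = r ^ 2 * θ := fun a => by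
    obtain ⟨n, rfl⟩ := hgen a
    obtain ⟨k, rfl⟩ | ⟨k, rfl⟩ := Nat.even_or_odd n
    · exact Or.inl ⟨θ ^ k, by rw [← pow_mul, mul_two]⟩
    · exact Or.inr ⟨θ ^ k, by rw [← pow_mul, mul_comm k, pow_succ]⟩
  have sqz : ∀ r x : Rˣ, c H (r ^ 2) x = 0 := fun r x => by
    have := T.c_sq_mul r 1 x
    rwa [mul_one, T.c_one] at this
  have huu : c H u u = 0 := by
    have h1 : c H u v = 0 := by rw [c_comm, hs, sqz]
    have h2 := T.sq_mul u (v * u⁻¹)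
    have e : u ^ 2 * (v * u⁻¹) = u * v := by
      rw [mul_comm v, ← mul_assoc, sq, mul_assoc u u, mul_inv_cancel, mul_one]
    rw [e] at h2
    have h3 : H (v * u⁻¹) = H v - H u := by 
      have : H (v * u⁻¹) = -H u + H v := by rw [hg]; abel
      rw [this]; abel
    rw [c, ← sq]
    rw [c, h2, h3] at h1
    rw [← h1]; abel
  have hθ : c H θ θ = 0 := by
    obtain ⟨r, hr⟩ | ⟨r, hr⟩ := par u
    · exact absurd ⟨r, hr⟩ hns
    · rw [hr, T.c_sq_mul, c_comm, T.c_sq_mul] at huu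
      exact huu
  obtain ⟨r, rfl⟩ | ⟨r, rfl⟩ := par a
  · exact sqz _ _
  · rw [T.c_sq_mul]
    obtain ⟨q, rfl⟩ | ⟨q, rfl⟩ := par b
    · rw [c_comm, sqz]
    · rw [c_comm, T.c_sq_mul, hθ]

theorem c_two {a₃ a₅ : Rˣ} (hgen : ∀ u : Rˣ, ∃ n : ℕ, u = a₅ ^ n ∨ u = -a₅ ^ n)
    (h3 : ∃ n : ℕ, a₃ = -a₅ ^ n)
    (hg₁ : -H a₃ + H a₃⁻¹ = H (a₅ * (a₃ ^ 2)⁻¹) + H a₅⁻¹)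
    (hg₂ : -H a₃ - H (a₅ * a₃⁻¹) = H (a₃ * a₅⁻¹) + H a₃⁻¹) :
    c H (-1) (-1) + c H (-1) (-1) = 0 ∧ ∀ a b, c H a b = 0 ∨ c H a b = c H (-1) (-1) := by
  have i3 : H a₃ = H (a₃ ^ 2) + H a₃⁻¹ := by
    rw [← T.sq_mul]; congr 1; group
  have i5 : H a₅ = H (a₅ ^ 2) + H a₅⁻¹ := by
    rw [← T.sq_mul]; congr 1; group
  have i53 : H a₅ = H (a₃ ^ 2) + H (a₅ * (a₃ ^ 2)⁻¹) := by
    rw [← T.sq_mul]; congr 1; rw [mul_comm a₅, mul_inv_cancel_left]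
  have i15 : H (a₃ * a₅) = H (a₃ ^ 2) + H (a₅ * a₃⁻¹) := by
    rw [← T.sq_mul]; congr 1; rw [mul_comm a₅, sq, mul_assoc, mul_inv_cancel_left]
  have i15' : H (a₃ * a₅) = H (a₅ ^ 2) + H (a₃ * a₅⁻¹) := by
    rw [← T.sq_mul]; congr 1; rw [mul_comm _ a₅⁻¹, sq, mul_assoc, mul_inv_cancel_left, mul_comm]
  have i225 : H ((a₃ * a₅) ^ 2) = H (a₃ ^ 2) + H (a₅ ^ 2) := by
    rw [mul_pow, T.sq_mul]
  have h55 : c H a₅ a₅ = 0 := by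
    rw [c, ← sq]
    have e1 : H a₃⁻¹ = H a₃ - H (a₃ ^ 2) := by rw [i3]; abel
    have e2 : H a₅⁻¹ = H a₅ - H (a₅ ^ 2) := by rw [i5]; abel
    have e3 : H (a₅ * (a₃ ^ 2)⁻¹) = H a₅ - H (a₃ ^ 2) := by rw [i53]; abel
    rw [e1, e2, e3] at hg₁
    have := sub_eq_zero.mpr hg₁.symm
    rw [← this]; abel
  have h33 : c H a₃ a₃ + c H (a₃ * a₅) (a₃ * a₅) = 0 := by
    have e1 : H a₃⁻¹ = H a₃ - H (a₃ ^ 2) := by rw [i3]; abel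
    have e2 : H (a₅ * a₃⁻¹) = H (a₃ * a₅) - H (a₃ ^ 2) := by rw [i15]; abel
    have e3 : H (a₃ * a₅⁻¹) = H (a₃ * a₅) - H (a₅ ^ 2) := by rw [i15']; abel
    rw [e1, e2, e3] at hg₂
    have := sub_eq_zero.mpr hg₂.symm
    rw [c, c, ← sq, ← sq, i225, ← this]; abel
  have h5m : c H a₅ (-1) = 0 := by
    have := T.c_self a₅ (-1)
    rw [h55, mul_neg, mul_one, T.c_neg, zero_add] at this
    exact this.symm
  have h5 : ∀ v, c H a₅ v = 0 := fun v => by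
    obtain ⟨n, rfl | rfl⟩ := hgen v
    · have := T.c_pow_mul_of_self h55 n 1 (by rw [c_comm, T.c_one])
      rwa [mul_one] at this
    · have := T.c_pow_mul_of_self h55 n (-1) h5m
      rwa [mul_neg, mul_one] at this
  have h5mul : ∀ x y, c H (a₅ * x) y = c H x y := fun x y => by
    have := c_assoc (H := H) a₅ x y
    rwa [h5, h5, zero_add, zero_add] at this
  have h5pow : ∀ (n : ℕ) (x y), c H (a₅ ^ n * x) y = c H x y := fun n x y => by
    induction n with
    | zero => simp
    | succ n ih => rw [pow_succ', mul_assoc, h5mul, ih]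
  have hp : ∀ n : ℕ, -a₅ ^ n = a₅ ^ n * -1 := fun n => by rw [mul_neg, mul_one]
  have h33' : c H a₃ a₃ = c H (-1) (-1) := by
    obtain ⟨n, hn⟩ := h3
    rw [hn, hp, h5pow, c_comm, h5pow]
  refine ⟨?_, fun a b => ?_⟩
  · rw [mul_comm a₃ a₅, h5mul, c_comm a₃ (a₅ * a₃), h5mul, h33'] at h33
    exact h33
  · obtain ⟨n, rfl | rfl⟩ := hgen a
    · left; rw [← mul_one (a₅ ^ n), h5pow, T.c_one]
    · rw [hp, h5pow, c_comm]
      obtain ⟨m, rfl | rfl⟩ := hgen b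
      · left; rw [← mul_one (a₅ ^ m), h5pow, T.c_one]
      · right; rw [hp, h5pow]

end Symbol

/-- The defect of multiplicativity of the torus elements. -/
def sym {R E : Type*} [CommRing R] [Group E] (x y : R → E) (u v : Rˣ) : E :=
  h x y u * h x y v * (h x y (u * v))⁻¹

namespace System

variable {R E : Type} [CommRing R] [Group E] {x y : R → E} (S : System x y)
include S

theorem h_comm_of_gen (hc : ∀ u v, sym x y u v ∈ Subgroup.center E) (θ : Rˣ)
    (hgen : ∀ u : Rˣ, ∃ n : ℕ, u = θ ^ n ∨ u = -θ ^ n) (u v : Rˣ) :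
    Commute (h x y u) (h x y v) := by
  have hmul : ∀ a b, h x y (a * b) = (sym x y a b)⁻¹ * (h x y a * h x y b) := fun a b => by
    rw [sym]; group
  have hcc : ∀ a b e, Commute (sym x y a b)⁻¹ e := fun a b e =>
    ((Subgroup.mem_center_iff.mp ((Subgroup.center E).inv_mem (hc a b))) e).symm
  have step : ∀ e : E, Commute (h x y θ) e → Commute (h x y (-1)) e → ∀ u, Commute (h x y u) e := by
    intro e h1 h2 u
    have hpow : ∀ n : ℕ, Commute (h x y (θ ^ n)) e := fun n => by
      induction n with
      | zero => rw [pow_zero, S.h_one]; exact Commute.one_left e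
      | succ n ih => rw [pow_succ, hmul]; exact (hcc _ _ _).mul_left (ih.mul_left h1)
    obtain ⟨n, rfl | rfl⟩ := hgen u
    · exact hpow n
    · rw [← mul_one (θ ^ n), ← mul_neg, hmul]
      exact (hcc _ _ _).mul_left ((hpow n).mul_left h2)
  exact step _ ((step _ (Commute.refl _) (S.commute_h_neg_one _) v).symm)
    (S.commute_h_neg_one _) u

/-- The torus elements as a map to a commutative group. -/
theorem exists_symbol (hcomm : ∀ u v, Commute (h x y u) (h x y v)) :
    ∃ (A : Type) (_ : AddCommGroup A) (f : Multiplicative A →* E) (H : Rˣ → A),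
      Function.Injective f ∧ (∀ u, f (Multiplicative.ofAdd (H u)) = h x y u) ∧ Symbol H := by
  have hk : ∀ a ∈ Set.range (h x y), ∀ b ∈ Set.range (h x y), a * b = b * a := by
    rintro _ ⟨u, rfl⟩ _ ⟨v, rfl⟩; exact hcomm u v
  let K := Subgroup.closure (Set.range (h x y))
  let : CommGroup K :=
    { mul_comm := fun a b => (Subgroup.isMulCommutative_closure hk).is_comm.comm a b }
  let H' : Rˣ → K := fun u => ⟨h x y u, Subgroup.subset_closure ⟨u, rfl⟩⟩
  refine ⟨Additive K, inferInstance, 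
    { toFun := fun a => ((Additive.toMul (Multiplicative.toAdd a) : K) : E)
      map_one' := rfl
      map_mul' := fun _ _ => rfl }, fun u => Additive.ofMul (H' u), ?_, ?_, ?_⟩
  · exact fun a b hab => Subtype.ext hab
  · intro u; rfl
  · refine ⟨?_, fun u v => ?_, fun u => ?_⟩
    · change Additive.ofMul (H' 1) = Additive.ofMul 1
      congr 1; exact Subtype.ext S.h_one
    · change Additive.ofMul (H' (u ^ 2 * v)) = Additive.ofMul (H' (u ^ 2) * H' v)
      congr 1; refine Subtype.ext ?_
      have := S.h_conj_h u v
      rw [(hcomm u v).eq, mul_inv_cancel_right, eq_mul_inv_iff_mul_eq] at this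
      change h x y (u ^ 2 * v) = h x y (u ^ 2) * h x y v
      rw [← this, (hcomm _ _).eq]
    · change Additive.ofMul (H' u⁻¹ * H' (-u)) = Additive.ofMul (H' (-1))
      congr 1; exact Subtype.ext (S.h_inv_mul_h_neg u)

end System

end RankOne

namespace RankOne.System

variable {R E : Type} [CommRing R] [Group E] {x y : R → E} (S : System x y)
include S

theorem gauss_rel_one {u v : Rˣ} (huv : (u : R) = 1 + v) :
    (h x y u)⁻¹ = (h x y v)⁻¹ * h x y (v * u⁻¹) := by
  have h1 := S.gauss_unit_right u 1 v (by rw [huv]; simp)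
  have h2 := S.gauss_unit_right u v 1 (by rw [huv]; simp)
  have h3 := S.gauss_swap u 1 v
  rw [Units.val_one] at h1
  rw [h1, h2] at h3
  have h4 := S.w_one_conj_h (u * v⁻¹)
  have h5 := S.w_one_conj_h v⁻¹
  rw [inv_inv] at h5
  rw [show (u * v⁻¹)⁻¹ = v * u⁻¹ by group] at h4
  rw [inv_one, mul_one, S.h_one, mul_one] at h3
  rw [h3, ← h4, ← h5]
  group

theorem gauss_rel_three_five {a₃ a₅ : Rˣ} (h3 : (a₃ : R) = 3) (h5 : (a₅ : R) = 5) :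
    (h x y a₃)⁻¹ * h x y a₃⁻¹ = h x y (a₅ * (a₃ ^ 2)⁻¹) * h x y a₅⁻¹ := by
  have i3 : (3 : R) * ↑a₃⁻¹ = 1 := by rw [← h3, Units.mul_inv]
  have i5 : (5 : R) * ↑a₅⁻¹ = 1 := by rw [← h5, Units.mul_inv]
  have v1 : (a₃ : R) = 1 + 2 * (1 : Rˣ) := by rw [h3]; norm_num
  have v2 : (a₃ : R) = 1 + 2 * ↑a₃⁻¹ * a₃ := by
    rw [mul_assoc, Units.inv_mul, h3]; norm_num
  have v3 : (a₅ : R) = 1 + 4 * (1 : Rˣ) := by rw [h5]; norm_num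
  have v4 : (↑(a₃ ^ 2 * a₅⁻¹) : R) = 1 + 4 * ↑a₅⁻¹ * (1 : Rˣ) := by
    push_cast; rw [h3]; linear_combination i5
  have g1 := S.gauss_add a₃ a₃ 2 1 a₃ v1 v2
  rw [S.gauss_unit_right a₃ 1 2 v1, S.gauss_unit_right a₃ a₃ _ v2] at g1
  have g2 := S.gauss_add a₅ (a₃ ^ 2 * a₅⁻¹) 4 1 (1 : Rˣ) v3 v4
  rw [S.gauss_unit_right a₅ 1 4 v3, S.gauss_unit_right _ 1 _ v4] at g2
  have e1 : a₅ * (a₃ ^ 2 * a₅⁻¹) = a₃ * a₃ := by rw [mul_comm, inv_mul_cancel_right, sq]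
  have e2 : ((1 : Rˣ) : R) + a₃ = 4 := by rw [h3]; norm_num
  have e3 : ((1 : Rˣ) : R) + (1 : Rˣ) = 2 := by norm_num
  rw [e1, e3] at g2
  rw [e2, S.gauss_swap, g2] at g1
  simp only [inv_one, mul_one, mul_inv_cancel, S.h_one, one_mul] at g1
  have h6 := S.w_one_conj_h a₅
  have h7 := S.w_one_conj_h (a₃ ^ 2 * a₅⁻¹)
  rw [show (a₃ ^ 2 * a₅⁻¹)⁻¹ = a₅ * (a₃ ^ 2)⁻¹ by group] at h7
  rw [← g1, ← h6, ← h7]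
  group

theorem gauss_rel_three_five' {a₃ a₅ : Rˣ} (h3 : (a₃ : R) = 3) (h5 : (a₅ : R) = 5) :
    (h x y a₃)⁻¹ * (h x y (a₅ * a₃⁻¹))⁻¹ = h x y (a₃ * a₅⁻¹) * h x y a₃⁻¹ := by
  have i3 : (3 : R) * ↑a₃⁻¹ = 1 := by rw [← h3, Units.mul_inv]
  have v1 : (a₃ : R) = 1 + 2 * (1 : Rˣ) := by rw [h3]; norm_num
  have v4 : (↑(a₅ * a₃⁻¹) : R) = 1 + 2 * ↑a₃⁻¹ * (1 : Rˣ) := by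
    push_cast; rw [h5]; linear_combination i3
  have g2 := S.gauss_add a₃ (a₅ * a₃⁻¹) 2 1 (1 : Rˣ) v1 v4
  rw [S.gauss_unit_right a₃ 1 2 v1, S.gauss_unit_right _ 1 _ v4] at g2
  have e3 : ((1 : Rˣ) : R) + (1 : Rˣ) = 2 := by norm_num
  have g3 := S.gauss_swap (a₃ * (a₅ * a₃⁻¹)) 2 2
  rw [e3] at g2
  rw [g2] at g3
  simp only [inv_one, mul_one, S.h_one] at g3
  have h6 := S.w_one_conj_h a₃
  have h7 := S.w_one_conj_h (a₅ * a₃⁻¹)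
  rw [show (a₅ * a₃⁻¹)⁻¹ = a₃ * a₅⁻¹ by group] at h7
  rw [g3, ← h6, ← h7]
  group

end RankOne.System

namespace ZModUnits

theorem eq_five_pow {k : ℕ} {a₅ : (ZMod (2 ^ (k + 2)))ˣ} (h5 : (a₅ : ZMod (2 ^ (k + 2))) = 5)
    (u : (ZMod (2 ^ (k + 2)))ˣ) :
    (∃ n : ℕ, u = a₅ ^ n ∧
      ZMod.castHom (pow_dvd_pow 2 (Nat.le_add_left 2 k)) (ZMod (2 ^ 2)) u = 1) ∨
    (∃ n : ℕ, u = -a₅ ^ n) := by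
  set φ := ZMod.castHom (pow_dvd_pow 2 (Nat.le_add_left 2 k)) (ZMod (2 ^ 2)) with hφ
  have hφ5 : ∀ n : ℕ, φ ((a₅ ^ n : (ZMod (2 ^ (k + 2)))ˣ) : ZMod (2 ^ (k + 2))) = 1 := fun n => by
    rw [Units.val_pow_eq_pow_val, h5, map_pow, show φ 5 = 1 from by
      rw [show (5 : ZMod (2 ^ (k + 2))) = ((5 : ℕ) : ZMod _) by norm_cast, map_natCast]; decide]
    exact one_pow n
  have hmem : ∀ v : (ZMod (2 ^ (k + 2)))ˣ, v ∈ Subgroup.zpowers a₅ → ∃ n : ℕ, a₅ ^ n = v :=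
    fun v hv => (mem_powers_iff_mem_zpowers).mpr hv
  have hcard : Nat.card (Subgroup.zpowers a₅) = 2 ^ k := by
    rw [Nat.card_zpowers, ← orderOf_units, h5, ZMod.orderOf_five]
  have hidx : (Subgroup.zpowers a₅).index = 2 := by
    have h1 := (Subgroup.zpowers a₅).card_mul_index
    rw [hcard, Nat.card_eq_fintype_card, ZMod.card_units_eq_totient,
      Nat.totient_prime_pow_succ Nat.prime_two (k + 1)] at h1
    have : 2 ^ k * (Subgroup.zpowers a₅).index = 2 ^ k * 2 := by rw [h1]; ring
    exact Nat.eq_of_mul_eq_mul_left (by positivity) this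
  have hneg : (-1 : (ZMod (2 ^ (k + 2)))ˣ) ∉ Subgroup.zpowers a₅ := fun hm => by
    obtain ⟨n, hn⟩ := hmem _ hm
    have := hφ5 n
    rw [hn, Units.val_neg, Units.val_one, map_neg, map_one] at this
    exact absurd this (by decide)
  by_cases hu : u ∈ Subgroup.zpowers a₅
  · obtain ⟨n, rfl⟩ := hmem _ hu
    exact Or.inl ⟨n, rfl, hφ5 n⟩
  · right
    have : -1 * u ∈ Subgroup.zpowers a₅ := by
      rw [Subgroup.mul_mem_iff_of_index_two hidx]; tauto
    obtain ⟨n, hn⟩ := hmem _ this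
    exact ⟨n, by rw [hn]; simp⟩

theorem exists_nonsquare {p k : ℕ} (hp : p.Prime) (hp2 : p ≠ 2) :
    ∃ u v s : (ZMod (p ^ (k + 1)))ˣ, (u : ZMod (p ^ (k + 1))) = 1 + v ∧ v = s ^ 2 ∧
      ¬ ∃ r, u = r ^ 2 := by
  classical
  have : Fact p.Prime := ⟨hp⟩
  let P : ℕ → Prop := fun m => 1 ≤ m ∧
    ¬ ∃ r : (ZMod (p ^ (k + 1)))ˣ, (m : ZMod (p ^ (k + 1))) = r ^ 2
  have hex : ∃ m, P m ∧ m < p := by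
    obtain ⟨a, ha⟩ := FiniteField.exists_nonsquare (F := ZMod p) (by
      rw [ZMod.ringChar_zmod_n]; exact hp2)
    refine ⟨a.val, ⟨?_, ?_⟩, ZMod.val_lt a⟩
    · rw [Nat.one_le_iff_ne_zero, Ne, ZMod.val_eq_zero]
      rintro rfl; exact ha ⟨0, by simp⟩
    · rintro ⟨r, hr⟩
      refine ha ⟨ZMod.castHom (dvd_pow_self p (Nat.succ_ne_zero k)) (ZMod p) r, ?_⟩
      rw [← map_mul, ← sq, ← hr, map_natCast, ZMod.natCast_val, ZMod.cast_id]
  obtain ⟨m, hPm, hmp⟩ := hex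
  have hex' : ∃ m, P m := ⟨m, hPm⟩
  have hle := Nat.find_min' hex' hPm
  obtain ⟨h1, h2⟩ := Nat.find_spec hex'
  have hmin := fun j => Nat.find_min hex' (m := j)
  set m₀ := Nat.find hex'
  have hne : m₀ ≠ 1 := fun h => h2 ⟨1, by rw [h]; simp⟩
  have hpred : ∃ r : (ZMod (p ^ (k + 1)))ˣ, ((m₀ - 1 : ℕ) : ZMod (p ^ (k + 1))) = r ^ 2 := by
    by_contra hcon
    exact hmin (m₀ - 1) (by omega) ⟨by omega, hcon⟩
  obtain ⟨s, hs⟩ := hpred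
  have hcop : Nat.Coprime m₀ (p ^ (k + 1)) :=
    Nat.Coprime.pow_right _ (Nat.coprime_of_lt_prime (by omega) (by omega) hp).symm
  refine ⟨ZMod.unitOfCoprime m₀ hcop, s ^ 2, s, ?_, rfl, ?_⟩
  · rw [ZMod.coe_unitOfCoprime, Units.val_pow_eq_pow_val, ← hs, Nat.cast_sub h1]; simp
  · rintro ⟨r, hr⟩
    exact h2 ⟨r, by rw [← Units.val_pow_eq_pow_val, ← hr, ZMod.coe_unitOfCoprime]⟩

end ZModUnits

namespace RankOne

theorem Symbol.sym_eq {R E A : Type} [CommRing R] [Group E] [AddCommGroup A] {x y : R → E}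
    {f : Multiplicative A →* E} {H : Rˣ → A} (hH : ∀ u, f (Multiplicative.ofAdd (H u)) = h x y u)
    (u v : Rˣ) : sym x y u v = f (Multiplicative.ofAdd (c H u v)) := by
  rw [sym, c, sub_eq_add_neg, ofAdd_add, ofAdd_add, ofAdd_neg, map_mul, map_mul,
    map_inv, hH, hH, hH]

theorem sym_two {k : ℕ} {E : Type} [Group E] {x y : ZMod (2 ^ (k + 2)) → E} (S : System x y)
    (hc : ∀ u v, sym x y u v ∈ Subgroup.center E) :
    ∃ p : E, p * p = 1 ∧ ∀ u v, sym x y u v = 1 ∨ sym x y u v = p := by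
  have unit : ∀ m : ℕ, Odd m → ∃ a : (ZMod (2 ^ (k + 2)))ˣ, (a : ZMod (2 ^ (k + 2))) = m :=
    fun m hm => ⟨ZMod.unitOfCoprime m (Nat.Coprime.pow_right _
      (Nat.coprime_two_right.mpr hm)), ZMod.coe_unitOfCoprime _ _⟩
  obtain ⟨a₃, h3⟩ := unit 3 (by decide)
  obtain ⟨a₅, h5⟩ := unit 5 (by decide)
  push_cast at h3 h5
  have hgen : ∀ u : (ZMod (2 ^ (k + 2)))ˣ, ∃ n : ℕ, u = a₅ ^ n ∨ u = -a₅ ^ n := fun u => by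
    obtain ⟨n, hn, -⟩ | ⟨n, hn⟩ := ZModUnits.eq_five_pow h5 u
    exacts [⟨n, Or.inl hn⟩, ⟨n, Or.inr hn⟩]
  have h35 : ∃ n : ℕ, a₃ = -a₅ ^ n := by
    obtain ⟨n, hn, h⟩ | h := ZModUnits.eq_five_pow h5 a₃
    · rw [h3, show (3 : ZMod (2 ^ (k + 2))) = ((3 : ℕ) : ZMod _) by norm_cast, map_natCast] at h
      exact absurd h (by decide)
    · exact h
  obtain ⟨A, _, f, H, hf, hH, T⟩ := S.exists_symbol (S.h_comm_of_gen hc a₅ hgen)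
  have g1 : -H a₃ + H a₃⁻¹ = H (a₅ * (a₃ ^ 2)⁻¹) + H a₅⁻¹ := by
    apply Multiplicative.ofAdd.injective; apply hf
    simp only [ofAdd_add, ofAdd_neg, map_mul, map_inv, hH]
    exact S.gauss_rel_three_five h3 h5
  have g2 : -H a₃ - H (a₅ * a₃⁻¹) = H (a₃ * a₅⁻¹) + H a₃⁻¹ := by
    apply Multiplicative.ofAdd.injective; apply hf
    simp only [sub_eq_add_neg, ofAdd_add, ofAdd_neg, map_mul, map_inv, hH]
    exact S.gauss_rel_three_five' h3 h5
  obtain ⟨h1, h2⟩ := T.c_two hgen h35 g1 g2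
  refine ⟨sym x y (-1) (-1), ?_, fun u v => ?_⟩
  · rw [Symbol.sym_eq hH, ← map_mul, ← ofAdd_add, h1, ofAdd_zero, map_one]
  · rw [Symbol.sym_eq hH, Symbol.sym_eq hH]
    obtain h | h := h2 u v
    · left; rw [h, ofAdd_zero, map_one]
    · right; rw [h]

theorem sym_odd {p k : ℕ} (hp : p.Prime) (hp2 : p ≠ 2) {E : Type} [Group E]
    {x y : ZMod (p ^ k) → E} (S : System x y)
    (hc : ∀ u v, sym x y u v ∈ Subgroup.center E) (a b : (ZMod (p ^ k))ˣ) :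
    sym x y a b = 1 := by
  obtain _ | k := k
  · have : Subsingleton (ZMod (p ^ 0)) := by rw [pow_zero]; infer_instance
    rw [Subsingleton.elim a 1, Subsingleton.elim b 1, sym, mul_one, S.h_one]; group
  have := ZMod.isCyclic_units_of_prime_pow p hp hp2 (k + 1)
  have : NeZero (p ^ (k + 1)) := ⟨pow_ne_zero _ hp.ne_zero⟩
  obtain ⟨θ, hθ⟩ := IsCyclic.exists_monoid_generator (α := (ZMod (p ^ (k + 1)))ˣ)
  have hgen : ∀ u : (ZMod (p ^ (k + 1)))ˣ, ∃ n : ℕ, u = θ ^ n := fun u => by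
    obtain ⟨n, hn⟩ := hθ u
    exact ⟨n, hn.symm⟩
  obtain ⟨A, _, f, H, hf, hH, T⟩ := S.exists_symbol (S.h_comm_of_gen hc θ fun u =>
    (hgen u).imp fun n hn => Or.inl hn)
  obtain ⟨u, v, s, huv, hs, hns⟩ := ZModUnits.exists_nonsquare (k := k) hp hp2
  have g : -H u = H (v * u⁻¹) - H v := by
    rw [sub_eq_add_neg, add_comm]
    apply Multiplicative.ofAdd.injective; apply hf
    simp only [ofAdd_add, ofAdd_neg, map_mul, map_inv, hH]
    exact S.gauss_rel_one huv
  rw [Symbol.sym_eq hH, T.c_cyclic hgen u v s hs hns g, ofAdd_zero, map_one]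

end RankOne

namespace Symp

set_option linter.unusedSimpArgs false

open scoped commutatorElement

/-- Indices of the standard symplectic basis. -/
abbrev Ix (g : ℕ) := Fin g ⊕ Fin g

/-- The index of the basis vector paired with the given one. -/
def op {g : ℕ} (i : Ix g) : Ix g := Sum.swap i

/-- The absolute value of an index. -/
def ab {g : ℕ} (i : Ix g) : Fin g := Sum.elim id id i

/-- The value of the symplectic form on the pair `e i`, `e (op i)`. -/
def sg {g : ℕ} {R : Type*} [CommRing R] (i : Ix g) : R := Sum.elim (fun _ => 1) (fun _ => -1) i

section index

variable {g : ℕ} {R : Type*} [CommRing R]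

@[simp] theorem op_op (i : Ix g) : op (op i) = i := Sum.swap_swap i

@[simp] theorem op_inl (a : Fin g) : op (Sum.inl a : Ix g) = Sum.inr a := rfl

@[simp] theorem op_inr (a : Fin g) : op (Sum.inr a : Ix g) = Sum.inl a := rfl

@[simp] theorem ab_inl (a : Fin g) : ab (Sum.inl a : Ix g) = a := rfl

@[simp] theorem ab_inr (a : Fin g) : ab (Sum.inr a : Ix g) = a := rfl

@[simp] theorem ab_op (i : Ix g) : ab (op i) = ab i := by cases i <;> rfl

@[simp] theorem sg_inl (a : Fin g) : sg (Sum.inl a : Ix g) = (1 : R) := rfl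

@[simp] theorem sg_inr (a : Fin g) : sg (Sum.inr a : Ix g) = (-1 : R) := rfl

@[simp] theorem sg_op (i : Ix g) : sg (op i) = (-sg i : R) := by cases i <;> simp

@[simp] theorem sg_mul_self (i : Ix g) : sg i * sg i = (1 : R) := by cases i <;> simp

@[simp] theorem sg_sq (i : Ix g) : sg i ^ 2 = (1 : R) := by cases i <;> simp

@[simp] theorem op_ne (i : Ix g) : op i ≠ i := by cases i <;> simp

@[simp] theorem ne_op (i : Ix g) : i ≠ op i := (op_ne i).symm

@[simp] theorem op_inj {i j : Ix g} : op i = op j ↔ i = j :=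
  ⟨fun h => by rw [← op_op i, h, op_op], fun h => by rw [h]⟩

theorem op_eq_iff {i j : Ix g} : op i = j ↔ i = op j :=
  ⟨fun h => by rw [← h, op_op], fun h => by rw [h, op_op]⟩

theorem ab_eq_iff {i j : Ix g} : ab i = ab j ↔ i = j ∨ j = op i := by
  cases i <;> cases j <;> simp [eq_comm]

theorem ne_of_ab {i j : Ix g} (h : ab i ≠ ab j) : i ≠ j := fun e => h (by rw [e])

theorem ne_op_of_ab {i j : Ix g} (h : ab i ≠ ab j) : j ≠ op i := fun e => h (by rw [e, ab_op])

/-- A pair of indices carrying a root subgroup. -/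
def Root (i j : Ix g) : Prop := j ≠ op i

theorem Root.symm {i j : Ix g} (h : Root i j) : Root j i := fun e => h (by rw [e, op_op])

theorem Root.cases {i j : Ix g} (h : Root i j) : i = j ∨ ab i ≠ ab j := by
  by_cases h' : ab i = ab j
  · exact Or.inl ((ab_eq_iff.mp h').resolve_right h)
  · exact Or.inr h'

theorem root_self (i : Ix g) : Root i i := ne_op i

theorem root_of_ab {i j : Ix g} (h : ab i ≠ ab j) : Root i j := ne_op_of_ab h

theorem Root.op {i j : Ix g} (h : Root i j) : Root (op i) (op j) := fun e => h (op_inj.mp e)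

theorem exists_far (hg : 4 ≤ g) (a b c : Fin g) : ∃ m : Ix g, ab m ≠ a ∧ ab m ≠ b ∧ ab m ≠ c := by
  have : ∃ m : Fin g, m ∉ ({a, b, c} : Finset (Fin g)) := by
    by_contra! h
    have h1 : (Finset.univ : Finset (Fin g)) ⊆ {a, b, c} := fun m _ => h m
    have h2 := Finset.card_le_card h1
    rw [Finset.card_univ, Fintype.card_fin] at h2
    have := Finset.card_le_three (a := a) (b := b) (c := c)
    omega
  obtain ⟨m, hm⟩ := this
  simp only [Finset.mem_insert, Finset.mem_singleton, not_or] at hm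
  exact ⟨Sum.inl m, hm⟩

end index

section form

variable {g : ℕ} {R : Type} [CommRing R]

/-- The standard symplectic form. -/
def om : (Ix g → R) →ₗ[R] (Ix g → R) →ₗ[R] R :=
  LinearMap.mk₂ R (fun u v => ∑ i, sg i * u i * v (op i))
    (fun u u' v => by rw [← Finset.sum_add_distrib]; congr; ext; simp; ring)
    (fun c u v => by rw [smul_eq_mul, Finset.mul_sum]; congr; ext; simp; ring)
    (fun u v v' => by rw [← Finset.sum_add_distrib]; congr; ext; simp; ring)
    (fun c u v => by rw [smul_eq_mul, Finset.mul_sum]; congr; ext; simp; ring)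

theorem om_apply (u v : Ix g → R) : om u v = ∑ i, sg i * u i * v (op i) := rfl

theorem om_eq_J (u v : Ix g → R) : om u v = - (u ⬝ᵥ (J (Fin g) R *ᵥ v)) := by
  rw [om_apply, J, Fintype.sum_sum_type, dotProduct, Fintype.sum_sum_type]
  simp [fromBlocks_mulVec, neg_mulVec]
  ring

theorem om_swap (u v : Ix g → R) : om u v = - om v u := by
  rw [om_apply, om_apply, Fintype.sum_sum_type, Fintype.sum_sum_type]
  simp [mul_comm]

@[simp] theorem om_self (u : Ix g → R) : om u u = 0 := by
  rw [om_apply, Fintype.sum_sum_type]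
  simp [mul_comm]

/-- Standard basis vectors. -/
def e (i : Ix g) : Ix g → R := Pi.single i 1

@[simp] theorem e_apply_self (i : Ix g) : (e i : Ix g → R) i = 1 := by simp [e]

theorem e_apply (i j : Ix g) : (e i : Ix g → R) j = if j = i then 1 else 0 := by
  simp [e, Pi.single_apply]

theorem om_e_left (i : Ix g) (v : Ix g → R) : om (e i) v = sg i * v (op i) := by
  rw [om_apply, Finset.sum_eq_single i]
  · simp
  · intro b _ hb; simp [e_apply, hb]
  · simp

theorem om_e_right (v : Ix g → R) (i : Ix g) : om v (e i) = -(sg i * v (op i)) := by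
  rw [om_swap, om_e_left]

theorem om_e_e_op (i : Ix g) : om (e i) (e (op i)) = (sg i : R) := by
  rw [om_e_left, e_apply_self, mul_one]

theorem om_e_op_e (i : Ix g) : om (e (op i)) (e i) = (-sg i : R) := by
  rw [om_swap, om_e_e_op]

theorem om_e_e {i j : Ix g} (h : Root i j) : om (e i) (e j) = (0 : R) := by
  rw [om_e_left, e_apply, if_neg (fun h' => h h'.symm), mul_zero]

/-- The natural action on vectors. -/
def act (q : Sp g R) (v : Ix g → R) : Ix g → R := q.1 *ᵥ v

@[simp] theorem act_one (v : Ix g → R) : act 1 v = v := one_mulVec v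

@[simp] theorem act_mul (q q' : Sp g R) (v : Ix g → R) : act (q * q') v = act q (act q' v) :=
  (mulVec_mulVec v q.1 q'.1).symm

@[simp] theorem act_add (q : Sp g R) (v w : Ix g → R) : act q (v + w) = act q v + act q w :=
  mulVec_add _ _ _

@[simp] theorem act_smul (q : Sp g R) (c : R) (v : Ix g → R) : act q (c • v) = c • act q v :=
  mulVec_smul _ _ _

@[simp] theorem act_zero (q : Sp g R) : act q 0 = 0 := mulVec_zero _

@[simp] theorem act_inv_act (q : Sp g R) (v : Ix g → R) : act q⁻¹ (act q v) = v := by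
  rw [← act_mul, inv_mul_cancel, act_one]

@[simp] theorem act_act_inv (q : Sp g R) (v : Ix g → R) : act q (act q⁻¹ v) = v := by
  rw [← act_mul, mul_inv_cancel, act_one]

theorem act_e_apply (q : Sp g R) (i j : Ix g) : act q (e j) i = q.1 i j := by
  rw [act, e, mulVec_single_one]; rfl

theorem ext_e {q q' : Sp g R} (h : ∀ i, act q (e i) = act q' (e i)) : q = q' := by
  refine Subtype.ext (Matrix.ext fun i j => ?_)
  rw [← act_e_apply, ← act_e_apply, h]

theorem ext_act {q q' : Sp g R} (h : ∀ v, act q v = act q' v) : q = q' := ext_e fun _ => h _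

@[simp] theorem om_act (q : Sp g R) (u v : Ix g → R) : om (act q u) (act q v) = om u v := by
  have h := (SymplecticGroup.mem_iff'.mp q.2)
  rw [om_eq_J, om_eq_J, act, act]
  conv_rhs => rw [← h, ← mulVec_mulVec, ← mulVec_mulVec, dotProduct_mulVec u, vecMul_transpose]

theorem om_act_left (q : Sp g R) (u v : Ix g → R) : om (act q u) v = om u (act q⁻¹ v) := by
  rw [← om_act q u, act_act_inv]

theorem mem_of_om {A : Matrix (Ix g) (Ix g) R} (h : ∀ u v, om (A *ᵥ u) (A *ᵥ v) = om u v) :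
    A ∈ Sp g R := by
  rw [SymplecticGroup.mem_iff']
  refine Matrix.ext fun i j => ?_
  have := h (e i) (e j)
  rw [om_eq_J, om_eq_J, neg_inj, ← vecMul_transpose, ← dotProduct_mulVec, mulVec_mulVec,
    mulVec_mulVec] at this
  simpa [e, Matrix.mul_assoc] using this

theorem vec_eq_sum (v : Ix g → R) : v = ∑ i, v i • e i := by
  ext j
  simp [e_apply, Finset.sum_apply]

/-- Matrix of the unipotent isometry attached to a pair of orthogonal vectors. -/
def XMat (u v : Ix g → R) (a : R) : Matrix (Ix g) (Ix g) R :=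
  LinearMap.toMatrix' (LinearMap.id + (om v).smulRight u + (om u).smulRight v +
    a • (om u).smulRight u)

theorem XMat_mulVec (u v : Ix g → R) (a : R) (w : Ix g → R) :
    XMat u v a *ᵥ w = w + om v w • u + om u w • v + (a * om u w) • u := by
  rw [XMat, LinearMap.toMatrix'_mulVec]
  simp [smul_smul]

open Classical in
/-- The unipotent isometry attached to a pair of orthogonal vectors. -/
def X (u v : Ix g → R) (a : R) : Sp g R :=
  if h : om u v = 0 then ⟨XMat u v a, mem_of_om fun w w' => by
    have h' : om v u = 0 := by rw [om_swap, h, neg_zero]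
    simp only [XMat_mulVec, map_add, map_smul, LinearMap.add_apply, LinearMap.smul_apply,
      om_self, h, h', smul_eq_mul, om_swap w u, om_swap w v]
    ring⟩ else 1

theorem act_X {u v : Ix g → R} (h : om u v = 0) (a : R) (w : Ix g → R) :
    act (X u v a) w = w + om v w • u + om u w • v + (a * om u w) • u := by
  rw [X, dif_pos h, act, XMat_mulVec]

theorem X_mul {u v v' : Ix g → R} (h : om u v = 0) (h' : om u v' = 0) (a b : R) :
    X u v a * X u v' b = X u (v + v') (a + b + om v v') := by
  have h'' : om u (v + v') = 0 := by rw [map_add, h, h', add_zero]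
  refine ext_act fun w => ?_
  have e1 : om v u = 0 := by rw [om_swap, h, neg_zero]
  rw [act_mul, act_X h', act_X h, act_X h'']
  simp only [map_add, map_smul, LinearMap.add_apply, om_self, h', e1, smul_eq_mul]
  module

theorem X_conj (q : Sp g R) {u v : Ix g → R} (h : om u v = 0) (a : R) :
    q * X u v a * q⁻¹ = X (act q u) (act q v) a := by
  refine ext_act fun w => ?_
  rw [act_mul, act_mul, act_X h, act_X (by rw [om_act, h])]
  simp only [act_add, act_smul, om_act_left, act_act_inv]

theorem X_zero (u : Ix g → R) : X u 0 0 = 1 := by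
  refine ext_act fun w => ?_
  rw [act_X (by simp)]; simp

/-- The elementary symplectic matrices. -/
def rt (i j : Ix g) (r : R) : Sp g R := if i = j then X (e i) 0 r else X (e i) (r • e j) 0

theorem rt_self (i : Ix g) (r : R) : rt i i r = X (e i) 0 r := by rw [rt, if_pos rfl]

theorem act_rt_self (i : Ix g) (r : R) (w : Ix g → R) :
    act (rt i i r) w = w + (r * om (e i) w) • e i := by
  rw [rt_self, act_X (by simp)]; simp

theorem rt_short {i j : Ix g} (h : ab i ≠ ab j) (r : R) : rt i j r = X (e i) (r • e j) 0 := by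
  rw [rt, if_neg (ne_of_ab h)]

theorem act_rt_short {i j : Ix g} (h : ab i ≠ ab j) (r : R) (w : Ix g → R) :
    act (rt i j r) w = w + (r * om (e j) w) • e i + (r * om (e i) w) • e j := by
  rw [rt_short h, act_X (by rw [map_smul, om_e_e (root_of_ab h), smul_zero])]
  simp only [map_smul, LinearMap.smul_apply, smul_eq_mul]
  module

end form

/-- The Steinberg relations of type `C` for a family of elements indexed by the roots. -/
structure Stb {g : ℕ} {R E : Type} [CommRing R] [Group E] (x : Ix g → Ix g → R → E) : Prop where
  symm : ∀ {i j} r, ab i ≠ ab j → x i j r = x j i r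
  add : ∀ {i j} r s, Root i j → x i j (r + s) = x i j r * x i j s
  comm : ∀ {i j k l} r s, Root i j → Root k l → Root i k → Root i l → Root j k → Root j l →
    Commute (x i j r) (x k l s)
  r3 : ∀ {i j k} r s, ab i ≠ ab j → ab j ≠ ab k → ab i ≠ ab k →
    ⁅x i j r, x (op j) k s⁆ = x i k (sg j * r * s)
  r5 : ∀ {i j} r s, ab i ≠ ab j →
    ⁅x i j r, x (op j) (op j) s⁆ = x i (op j) (sg j * r * s) * x i i (r ^ 2 * s)
  r4 : ∀ {i j} r s, ab i ≠ ab j → ⁅x i j r, x i (op j) s⁆ = x i i (2 * sg j * r * s)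

variable {g : ℕ} {R : Type} [CommRing R]

theorem comm_eq_of_mul_eq {G : Type*} [Group G] {a b c : G} (h : a * b = c * (b * a)) :
    ⁅a, b⁆ = c := by
  rw [commutatorElement_def, h]; group

theorem act_rt_root {i j : Ix g} (h : Root i j) (r : R) :
    ∃ s t : R, ∀ w, act (rt i j r) w = w + (s * om (e j) w) • e i + (t * om (e i) w) • e j := by
  obtain rfl | h' := h.cases
  · exact ⟨r, 0, fun w => by rw [act_rt_self]; simp⟩
  · exact ⟨r, r, fun w => by rw [act_rt_short h']⟩

theorem stb_rt : Stb (rt : Ix g → Ix g → R → Sp g R) where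
  symm {i j} r h := ext_act fun w => by
    rw [act_rt_short h, act_rt_short h.symm]; module
  add {i j} r s h := by
    refine ext_act fun w => ?_
    rw [act_mul]
    obtain rfl | h' := h.cases
    · simp only [act_rt_self, map_add, map_smul, om_self, smul_eq_mul]; module
    · simp only [act_rt_short h', map_add, map_smul, om_self, smul_eq_mul, om_e_e h,
        om_e_e h.symm]; module
  comm {i j k l} r s h h' h1 h2 h3 h4 := by
    obtain ⟨a, b, hab⟩ := act_rt_root h r
    obtain ⟨c, d, hcd⟩ := act_rt_root h' s
    refine ext_act fun w => ?_
    rw [act_mul, act_mul, hab, hcd, hab, hcd]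
    simp only [map_add, map_smul, smul_eq_mul, om_e_e h1, om_e_e h2, om_e_e h3, om_e_e h4,
      om_e_e h1.symm, om_e_e h2.symm, om_e_e h3.symm, om_e_e h4.symm]
    module
  r3 {i j k} r s h1 h2 h3 := by
    refine comm_eq_of_mul_eq (ext_act fun w => ?_)
    have h2' : ab (op j) ≠ ab k := by simpa using h2
    have h1' : ab i ≠ ab (op j) := by simpa using h1
    simp only [act_mul, act_rt_short h1, act_rt_short h2', act_rt_short h3, map_add, map_smul,
      smul_eq_mul, om_self, om_e_e_op, om_e_op_e, om_e_e (root_of_ab h1),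
      om_e_e (root_of_ab h1).symm, om_e_e (root_of_ab h2), om_e_e (root_of_ab h2).symm,
      om_e_e (root_of_ab h3), om_e_e (root_of_ab h3).symm, om_e_e (root_of_ab h1'),
      om_e_e (root_of_ab h1').symm, om_e_e (root_of_ab h2'), om_e_e (root_of_ab h2').symm]
    have := sg_mul_self (R := R) j
    module
  r5 {i j} r s h1 := by
    refine comm_eq_of_mul_eq (ext_act fun w => ?_)
    have h1' : ab i ≠ ab (op j) := by simpa using h1
    simp only [act_mul, act_rt_short h1, act_rt_short h1', act_rt_self, map_add, map_smul,
      smul_eq_mul, om_self, om_e_e_op, om_e_op_e, om_e_e (root_of_ab h1),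
      om_e_e (root_of_ab h1).symm, om_e_e (root_of_ab h1'), om_e_e (root_of_ab h1').symm]
    have := sg_mul_self (R := R) j
    match_scalars <;> first | ring1 | linear_combination (r ^ 2 * s * om (e i) w) * this
  r4 {i j} r s h1 := by
    refine comm_eq_of_mul_eq (ext_act fun w => ?_)
    have h1' : ab i ≠ ab (op j) := by simpa using h1
    simp only [act_mul, act_rt_short h1, act_rt_short h1', act_rt_self, map_add, map_smul,
      smul_eq_mul, om_self, om_e_e_op, om_e_op_e, om_e_e (root_of_ab h1),
      om_e_e (root_of_ab h1).symm, om_e_e (root_of_ab h1'), om_e_e (root_of_ab h1').symm]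
    module

end Symp

namespace Symp

open scoped commutatorElement

section central

variable {E Q : Type*} [Group E] [Group Q] {π : E →* Q}

/-- The kernel of a homomorphism is central. -/
def CentralKer (π : E →* Q) : Prop := ∀ z, π z = 1 → ∀ a, Commute z a

variable (hc : CentralKer π)
include hc

theorem CentralKer.exists_eq {a a' : E} (h : π a = π a') :
    ∃ z, (∀ b, Commute z b) ∧ a' = z * a := by
  refine ⟨a' * a⁻¹, hc _ ?_, by group⟩
  rw [map_mul, map_inv, h, mul_inv_cancel]

theorem CentralKer.conj_congr {a a' b : E} (h : π a = π a') : a * b * a⁻¹ = a' * b * a'⁻¹ := by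
  obtain ⟨z, hz, rfl⟩ := hc.exists_eq h
  have h1 := hz (a * b * a⁻¹)
  calc a * b * a⁻¹ = (a * b * a⁻¹) * z * z⁻¹ := by group
    _ = z * (a * b * a⁻¹) * z⁻¹ := by rw [h1.eq]
    _ = _ := by group

theorem CentralKer.commute_congr {a a' b : E} (h : π a = π a') (hab : Commute a b) :
    Commute a' b := by
  obtain ⟨z, hz, rfl⟩ := hc.exists_eq h
  exact (hz b).mul_left hab

theorem CentralKer.comm_congr {a a' b b' : E} (h : π a = π a') (h' : π b = π b') :
    ⁅a, b⁆ = ⁅a', b'⁆ := by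
  have h1 : ⁅a, b⁆ = ⁅a', b⁆ := by
    rw [commutatorElement_def, commutatorElement_def, hc.conj_congr h]
  have h2 : ⁅b, a'⁆ = ⁅b', a'⁆ := by
    rw [commutatorElement_def, commutatorElement_def, hc.conj_congr h']
  rw [h1, ← commutatorElement_inv, h2, commutatorElement_inv]

theorem CentralKer.commute_commutator {e a b : E} (h : Commute (π e) (π a))
    (h' : Commute (π e) (π b)) : Commute e ⁅a, b⁆ := by
  have h1 : π (e * a * e⁻¹) = π a := by
    rw [map_mul, map_mul, map_inv, h.eq, mul_inv_cancel_right]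
  have h2 : π (e * b * e⁻¹) = π b := by
    rw [map_mul, map_mul, map_inv, h'.eq, mul_inv_cancel_right]
  have h3 := hc.comm_congr h1 h2
  have h4 : e * ⁅a, b⁆ * e⁻¹ = ⁅a, b⁆ :=
    calc e * ⁅a, b⁆ * e⁻¹ = ⁅e * a * e⁻¹, e * b * e⁻¹⁆ := by
          simp only [commutatorElement_def]; group
      _ = _ := h3
  exact mul_inv_eq_iff_eq_mul.mp h4

omit hc in
theorem commutator_hall {a b c : E} (h1 : Commute a c) (h2 : Commute ⁅a, b⁆ ⁅b, c⁆)
    (h3 : Commute ⁅b, c⁆ ⁅⁅a, b⁆, c⁆) : ⁅⁅a, b⁆, c⁆ = ⁅a, ⁅b, c⁆⁆ := by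
  have e1 : a * ⁅b, c⁆ * a⁻¹ = ⁅⁅a, b⁆ * b, c⁆ := by
    have hc' : a * c⁻¹ = c⁻¹ * a := (h1.inv_right).eq
    have hc'' : a⁻¹ * c⁻¹ = c⁻¹ * a⁻¹ := (h1.inv_left.inv_right).eq
    have hcc : a * c * a⁻¹ = c := by rw [h1.eq, mul_inv_cancel_right]
    calc a * ⁅b, c⁆ * a⁻¹ = (a * b * a⁻¹) * (a * c * a⁻¹) * (a * b * a⁻¹)⁻¹ * (a * c * a⁻¹)⁻¹ := by
          rw [commutatorElement_def]; group
      _ = _ := by rw [hcc, commutatorElement_def, commutatorElement_def]; group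
  have e2 : ⁅⁅a, b⁆ * b, c⁆ = ⁅b, c⁆ * ⁅⁅a, b⁆, c⁆ := by
    calc ⁅⁅a, b⁆ * b, c⁆ = (⁅a, b⁆ * ⁅b, c⁆ * ⁅a, b⁆⁻¹) * ⁅⁅a, b⁆, c⁆ := by
          simp only [commutatorElement_def]; group
      _ = _ := by rw [h2.eq, mul_inv_cancel_right]
  rw [commutatorElement_def a ⁅b, c⁆, e1, e2, h3.eq, mul_inv_cancel_right]

omit hc in
theorem commutator_mul_left (a a' b : E) : ⁅a * a', b⁆ = a * ⁅a', b⁆ * a⁻¹ * ⁅a, b⁆ := by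
  simp only [commutatorElement_def]; group

omit hc in
theorem commutator_mul_right (a b b' : E) : ⁅a, b * b'⁆ = ⁅a, b⁆ * (b * ⁅a, b'⁆ * b⁻¹) := by
  simp only [commutatorElement_def]; group

omit hc in
theorem conj_of_commute {a b : E} (h : Commute a b) : a * b * a⁻¹ = b := by
  rw [h.eq, mul_inv_cancel_right]

end central

/-- Monomial elements of the symplectic group. -/
structure Mono {g : ℕ} {R : Type} [CommRing R] (q : Sp g R) (σ : Ix g → Ix g) (c : Ix g → R) :
    Prop where
  act : ∀ i, act q (e i) = c i • e (σ i)
  op : ∀ i, σ (op i) = op (σ i)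
  inj : Function.Injective σ

section mono

variable {g : ℕ} {R : Type} [CommRing R] {q : Sp g R} {σ : Ix g → Ix g} {c : Ix g → R}

theorem Mono.sg_eq (M : Mono q σ c) (i : Ix g) : sg (σ i) * (c i * c (Symp.op i)) = sg i := by
  have := om_act q (e i) (e (Symp.op i))
  rw [M.act, M.act, M.op, om_e_e_op] at this
  simp only [map_smul, LinearMap.smul_apply, om_e_e_op, smul_eq_mul] at this
  linear_combination this

theorem Mono.root (M : Mono q σ c) {i j : Ix g} (h : Root i j) : Root (σ i) (σ j) := fun h' =>
  h (M.inj (by rw [h', M.op]))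

theorem Mono.far (M : Mono q σ c) {i j : Ix g} (h : ab i ≠ ab j) : ab (σ i) ≠ ab (σ j) := by
  obtain h' | h' := (M.root (root_of_ab h)).cases
  · exact absurd (M.inj h') (ne_of_ab h)
  · exact h'

theorem Mono.conj (M : Mono q σ c) {i j : Ix g} (h : Root i j) (r : R) :
    q * rt i j r * q⁻¹ = rt (σ i) (σ j) (c i * c j * r) := by
  obtain rfl | h' := h.cases
  · rw [rt_self, X_conj _ (by simp), act_zero, M.act, rt_self]
    refine ext_act fun w => ?_
    rw [act_X (by simp), act_X (by simp)]
    simp only [map_smul, LinearMap.smul_apply, smul_eq_mul, map_zero, LinearMap.zero_apply]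
    module
  · have h2 := om_e_e (R := R) (root_of_ab (M.far h'))
    rw [rt_short h', X_conj _ (by rw [map_smul, om_e_e h, smul_zero]), act_smul, M.act, M.act,
      rt_short (M.far h')]
    refine ext_act fun w => ?_
    rw [act_X (by simp [h2]), act_X (by simp [h2])]
    simp only [map_smul, LinearMap.smul_apply, smul_eq_mul]
    module

end mono

section lifting

variable {g : ℕ} {R E : Type} [CommRing R] [Group E] {π : E →* Sp g R}

theorem rt_r3 {i j k : Ix g} (r s : R) (h1 : ab i ≠ ab j) (h2 : ab j ≠ ab k) (h3 : ab i ≠ ab k)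
    {a b : E} (ha : π a = rt i j r) (hb : π b = rt (op j) k s) :
    π ⁅a, b⁆ = rt i k (sg j * r * s) := by
  rw [map_commutatorElement, ha, hb, stb_rt.r3 r s h1 h2 h3]

theorem rt_r5 {i j : Ix g} (r s : R) (h : ab i ≠ ab j)
    {a b : E} (ha : π a = rt i j r) (hb : π b = rt (op j) (op j) s) :
    π ⁅a, b⁆ = rt i (op j) (sg j * r * s) * rt i i (r ^ 2 * s) := by
  rw [map_commutatorElement, ha, hb, stb_rt.r5 r s h]

theorem rt_r4 {i j : Ix g} (r s : R) (h : ab i ≠ ab j)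
    {a b : E} (ha : π a = rt i j r) (hb : π b = rt i (op j) s) :
    π ⁅a, b⁆ = rt i i (2 * sg j * r * s) := by
  rw [map_commutatorElement, ha, hb, stb_rt.r4 r s h]

/-- Elements over two given root elements commute. -/
def CommOver (π : E →* Sp g R) (i j k l : Ix g) : Prop :=
  ∀ r s a b, π a = rt i j r → π b = rt k l s → Commute a b

theorem CommOver.symm {i j k l : Ix g} (h : CommOver π i j k l) : CommOver π k l i j :=
  fun r s a b ha hb => (h s r b a hb ha).symm

variable (hg : 4 ≤ g) (hπ : Function.Surjective π) (hc : CentralKer π)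
include hπ hc

theorem commOver_of_exists {i j k l m : Ix g} (hij : Root i j) (hkl : ab k ≠ ab l) (h1 : Root i k)
    (h2 : Root i l) (h3 : Root j k) (h4 : Root j l) (m1 : ab m ≠ ab i) (m2 : ab m ≠ ab j)
    (m3 : ab m ≠ ab k) (m4 : ab m ≠ ab l) : CommOver π i j k l := by
  intro r s a b ha hb
  obtain ⟨u, hu⟩ := hπ (rt k m (sg m))
  obtain ⟨v, hv⟩ := hπ (rt (op m) l s)
  have h5 := rt_r3 _ _ m3.symm m4 hkl hu hv
  rw [sg_mul_self, one_mul, ← hb] at h5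
  refine (hc.commute_congr h5 (Commute.symm ?_)).symm
  have m4' : ab (op m) ≠ ab l := by simpa using m4
  have m1' : ab i ≠ ab (op m) := by simpa using m1.symm
  have m2' : ab j ≠ ab (op m) := by simpa using m2.symm
  refine hc.commute_commutator ?_ ?_
  · rw [ha, hu]
    exact stb_rt.comm _ _ hij (root_of_ab m3.symm) h1 (root_of_ab m1.symm) h3 (root_of_ab m2.symm)
  · rw [ha, hv]
    exact stb_rt.comm _ _ hij (root_of_ab m4') (root_of_ab m1') h2 (root_of_ab m2') h4

theorem commOver_short_of_long {i j k l : Ix g} (hij : Root i j) (hkl : ab k ≠ ab l)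
    (h1 : Root i k) (h2 : Root i l) (h3 : Root j k) (h4 : Root j l) (h5 : Root i (op l))
    (h6 : Root j (op l)) (hk : CommOver π i j k k) : CommOver π i j k l := by
  intro r s a b ha hb
  obtain ⟨u, hu⟩ := hπ (rt k (op l) (-sg l))
  obtain ⟨v, hv⟩ := hπ (rt l l s)
  obtain ⟨w, hw⟩ := hπ (rt k k s)
  have hkl' : ab k ≠ ab (op l) := by simpa using hkl
  have h7 := rt_r5 (j := op l) (-sg l) s hkl' hu (by simpa using hv)
  have e1 : (sg (op l) * -sg l * s : R) = s := by
    rw [sg_op]; linear_combination s * sg_mul_self (R := R) l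
  have e2 : ((-sg l) ^ 2 * s : R) = s := by
    linear_combination s * sg_mul_self (R := R) l
  rw [e1, e2, op_op, ← hb, ← hw, ← map_mul] at h7
  have h8 : Commute a ⁅u, v⁆ := by
    refine hc.commute_commutator ?_ ?_
    · rw [ha, hu]; exact stb_rt.comm _ _ hij (root_of_ab hkl') h1 h5 h3 h6
    · rw [ha, hv]; exact stb_rt.comm _ _ hij (root_self l) h2 h2 h4 h4
  have h9 := (hc.commute_congr h7 h8.symm).symm
  have h10 := h9.mul_right (hk r s a w ha hw).inv_right
  rwa [mul_inv_cancel_right] at h10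

theorem commOver_long_of_short {i j k l : Ix g} (hij : Root i j) (hkl : ab k ≠ ab l)
    (h1 : Root i k) (h2 : Root i l) (h3 : Root j k) (h4 : Root j l) (h5 : Root i (op l))
    (h6 : Root j (op l)) (hk : CommOver π i j k l) : CommOver π i j k k := by
  intro r s a b ha hb
  obtain ⟨u, hu⟩ := hπ (rt k (op l) (-sg l))
  obtain ⟨v, hv⟩ := hπ (rt l l s)
  obtain ⟨w, hw⟩ := hπ (rt k l s)
  have hkl' : ab k ≠ ab (op l) := by simpa using hkl
  have h7 := rt_r5 (j := op l) (-sg l) s hkl' hu (by simpa using hv)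
  have e1 : (sg (op l) * -sg l * s : R) = s := by
    rw [sg_op]; linear_combination s * sg_mul_self (R := R) l
  have e2 : ((-sg l) ^ 2 * s : R) = s := by
    linear_combination s * sg_mul_self (R := R) l
  rw [e1, e2, op_op, ← hb, ← hw, ← map_mul] at h7
  have h8 : Commute a ⁅u, v⁆ := by
    refine hc.commute_commutator ?_ ?_
    · rw [ha, hu]; exact stb_rt.comm _ _ hij (root_of_ab hkl') h1 h5 h3 h6
    · rw [ha, hv]; exact stb_rt.comm _ _ hij (root_self l) h2 h2 h4 h4
  have h9 := (hc.commute_congr h7 h8.symm).symm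
  have h10 := (hk r s a w ha hw).inv_right.mul_right h9
  rwa [inv_mul_cancel_left] at h10

include hg

theorem commOver_any_short {i k l : Ix g} (hkl : ab k ≠ ab l)
    (h1 : Root i k) (h2 : Root i l) : CommOver π i i k l := by
  obtain ⟨m, hm1, hm2, hm3⟩ := exists_far hg (ab i) (ab k) (ab l)
  exact commOver_of_exists hπ hc (root_self i) hkl h1 h2 h1 h2 hm1 hm1 hm2 hm3

/-- Elements over root elements with no interaction commute. -/
theorem commOver {i j k l : Ix g} (hij : Root i j) (hkl : Root k l) (h1 : Root i k)
    (h2 : Root i l) (h3 : Root j k) (h4 : Root j l) : CommOver π i j k l := by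
  obtain rfl | hij' := hij.cases
  · obtain rfl | hkl' := hkl.cases
    · obtain ⟨l, hl1, hl2, -⟩ := exists_far hg (ab i) (ab k) (ab k)
      have hil : Root i l := root_of_ab hl1.symm
      have hil' : Root i (op l) := root_of_ab (by simpa using hl1.symm)
      exact commOver_long_of_short hπ hc hij hl2.symm h1 hil h1 hil hil' hil'
        (commOver_any_short hg hπ hc hl2.symm h1 hil)
    · exact commOver_any_short hg hπ hc hkl' h1 h2
  · obtain rfl | hkl' := hkl.cases
    · exact (commOver_any_short hg hπ hc hij' h1.symm h3.symm).symm
    · by_cases hm : ∃ m : Ix g, ab m ≠ ab i ∧ ab m ≠ ab j ∧ ab m ≠ ab k ∧ ab m ≠ ab l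
      · obtain ⟨m, m1, m2, m3, m4⟩ := hm
        exact commOver_of_exists hπ hc hij hkl' h1 h2 h3 h4 m1 m2 m3 m4
      · have hne : ∀ a b c : Fin g, ∃ m : Ix g, ab m ≠ a ∧ ab m ≠ b ∧ ab m ≠ c :=
          fun a b c => exists_far hg a b c
        have hil : ab i ≠ ab l := fun h => by
          obtain ⟨m, m1, m2, m3⟩ := hne (ab i) (ab j) (ab k)
          exact hm ⟨m, m1, m2, m3, h ▸ m1⟩
        have hjl : ab j ≠ ab l := fun h => by
          obtain ⟨m, m1, m2, m3⟩ := hne (ab i) (ab j) (ab k)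
          exact hm ⟨m, m1, m2, m3, h ▸ m2⟩
        exact commOver_short_of_long hπ hc hij hkl' h1 h2 h3 h4
          (root_of_ab (by simpa using hil)) (root_of_ab (by simpa using hjl))
          (commOver_any_short hg hπ hc hij' h1.symm h3.symm).symm

end lifting

end Symp

namespace Symp

open scoped commutatorElement

/-- A lift of the elementary symplectic matrices along `π` satisfying the Steinberg relations and
equivariant under monomial elements. -/
structure Lift {g : ℕ} {R E : Type} [CommRing R] [Group E] (π : E →* Sp g R)
    (x : Ix g → Ix g → R → E) : Prop extends Stb x where
  proj : ∀ {i j} r, Root i j → π (x i j r) = rt i j r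
  equiv : ∀ {q σ c i j} r, Mono (π q) σ c → Root i j →
    q * x i j r * q⁻¹ = x (σ i) (σ j) (c i * c j * r)

variable {g : ℕ} {R E : Type} [CommRing R] [Group E] {π : E →* Sp g R}

section short

variable (hg : 4 ≤ g) (hπ : Function.Surjective π) (hc : CentralKer π)

/-- A chosen preimage of a root element. -/
def preim (i j : Ix g) (r : R) : E := Function.surjInv hπ (rt i j r)

theorem preim_proj (i j : Ix g) (r : R) : π (preim hπ i j r) = rt i j r :=
  Function.surjInv_eq hπ _

/-- The lift of a short root element obtained as a commutator. -/
def shortLift (i j : Ix g) (r : R) : E :=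
  ⁅preim hπ i (exists_far hg (ab i) (ab j) (ab j)).choose
      (sg (exists_far hg (ab i) (ab j) (ab j)).choose),
    preim hπ (op (exists_far hg (ab i) (ab j) (ab j)).choose) j r⁆

include hg hπ hc

theorem comm_short_congr {i j k l : Ix g} (h1 : ab i ≠ ab k) (h2 : ab k ≠ ab j) (h3 : ab i ≠ ab j)
    (h4 : ab i ≠ ab l) (h5 : ab l ≠ ab j) (h6 : ab k ≠ ab l) {a b c d : E} {r s t : R}
    (ha : π a = rt i k (sg k * (r * t))) (hb : π b = rt (op k) j s)
    (hc' : π c = rt i l (sg l * r)) (hd : π d = rt (op l) j (t * s)) : ⁅a, b⁆ = ⁅c, d⁆ := by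
  obtain ⟨m, hm⟩ := hπ (rt (op l) k (sg k * t))
  have e1 : π ⁅c, m⁆ = π a := by
    rw [rt_r3 _ _ h4 h6.symm h1 hc' hm, ha]
    congr 1; linear_combination sg k * r * t * sg_mul_self (R := R) l
  have e2 : π ⁅m, b⁆ = π d := by
    rw [rt_r3 _ _ (by simpa using h6.symm) h2 (by simpa using h5) hm hb, hd]
    congr 1; linear_combination t * s * sg_mul_self (R := R) k
  have e3 : π ⁅⁅c, m⁆, b⁆ = rt i j (r * t * s) := by
    rw [hc.comm_congr e1 rfl, rt_r3 _ _ h1 h2 h3 ha hb]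
    congr 1; linear_combination r * t * s * sg_mul_self (R := R) k
  rw [← hc.comm_congr e1 rfl, ← hc.comm_congr rfl e2]
  refine commutator_hall ?_ ?_ ?_
  · exact commOver hg hπ hc (root_of_ab h4) (root_of_ab (by simpa using h2))
      (root_of_ab (by simpa using h1)) (root_of_ab h3) (root_of_ab (by simpa using h6.symm))
      (root_of_ab h5) _ _ _ _ hc' hb
  · exact commOver hg hπ hc (root_of_ab h1) (root_of_ab (by simpa using h5))
      (root_of_ab (by simpa using h4)) (root_of_ab h3) (root_of_ab (by simpa using h6))
      (root_of_ab h2) _ _ _ _ (e1.trans ha) (e2.trans hd)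
  · exact commOver hg hπ hc (root_of_ab (by simpa using h5)) (root_of_ab h3)
      (root_of_ab (by simpa using h4.symm)) (root_of_ab (by simpa using h5)) (root_of_ab h3.symm)
      (root_self j) _ _ _ _ (e2.trans hd) e3

theorem comm_short_indep {i j k l : Ix g} (h1 : ab i ≠ ab k) (h2 : ab k ≠ ab j) (h3 : ab i ≠ ab j)
    (h4 : ab i ≠ ab l) (h5 : ab l ≠ ab j) {a b c d : E} {r s u : R}
    (ha : π a = rt i k r) (hb : π b = rt (op k) j s)
    (hc' : π c = rt i l (sg l)) (hd : π d = rt (op l) j u) (h : sg k * r * s = u) :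
    ⁅a, b⁆ = ⁅c, d⁆ := by
  subst h
  have hr : sg k * (1 * (sg k * r)) = r := by linear_combination r * sg_mul_self (R := R) k
  by_cases h6 : ab k = ab l
  · obtain ⟨m, hm1, hm2, hm3⟩ := exists_far hg (ab i) (ab j) (ab k)
    obtain ⟨p, hp⟩ := hπ (rt i m (sg m * 1))
    obtain ⟨q, hq⟩ := hπ (rt (op m) j (sg k * r * s))
    rw [comm_short_congr hg hπ hc h1 h2 h3 hm1.symm hm2 hm3.symm (r := 1) (t := sg k * r)
      (by rw [ha, hr]) hb hp hq]
    exact comm_short_congr hg hπ hc hm1.symm hm2 h3 h4 h5 (h6 ▸ hm3) (r := 1) (t := 1)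
      (by rw [hp]; simp) hq (by rw [hc', mul_one]) (by rw [hd, one_mul])
  · exact comm_short_congr hg hπ hc h1 h2 h3 h4 h5 h6 (r := 1) (t := sg k * r)
      (by rw [ha, hr]) hb (by rw [hc', mul_one]) hd

theorem comm_eq_shortLift {i j k : Ix g} {r s : R} (h1 : ab i ≠ ab k) (h2 : ab k ≠ ab j)
    (h3 : ab i ≠ ab j) {a b : E} (ha : π a = rt i k r) (hb : π b = rt (op k) j s) :
    ⁅a, b⁆ = shortLift hg hπ i j (sg k * r * s) := by
  have hs := (exists_far hg (ab i) (ab j) (ab j)).choose_spec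
  exact comm_short_indep hg hπ hc h1 h2 h3 hs.1.symm hs.2.1 ha hb (preim_proj hπ _ _ _)
    (preim_proj hπ _ _ _) rfl

omit hc in
theorem shortLift_proj {i j : Ix g} (h : ab i ≠ ab j) (r : R) :
    π (shortLift hg hπ i j r) = rt i j r := by
  have hs := (exists_far hg (ab i) (ab j) (ab j)).choose_spec
  rw [shortLift, rt_r3 _ _ hs.1.symm hs.2.1 h (preim_proj hπ _ _ _) (preim_proj hπ _ _ _),
    sg_mul_self, one_mul]

theorem shortLift_add {i j : Ix g} (h : ab i ≠ ab j) (r s : R) :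
    shortLift hg hπ i j (r + s) = shortLift hg hπ i j r * shortLift hg hπ i j s := by
  obtain ⟨k, h1, h2, -⟩ := exists_far hg (ab i) (ab j) (ab j)
  have e : ∀ t : R, sg k * sg k * t = t := fun t => by rw [sg_mul_self, one_mul]
  have ha := preim_proj hπ i k (sg k)
  have hb := preim_proj hπ (op k) j
  have key := comm_eq_shortLift hg hπ hc h1.symm h2 h ha
    (b := preim hπ (op k) j r * preim hπ (op k) j s)
    (s := r + s) (by rw [map_mul, hb, hb, stb_rt.add _ _ (root_of_ab (by simpa using h2))])
  rw [e, commutator_mul_right, comm_eq_shortLift hg hπ hc h1.symm h2 h ha (hb r),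
    comm_eq_shortLift hg hπ hc h1.symm h2 h ha (hb s), e, e] at key
  rw [← key, conj_of_commute]
  exact commOver hg hπ hc (root_of_ab (by simpa using h2)) (root_of_ab h)
      (root_of_ab (by simpa using h1)) (root_of_ab (by simpa using h2)) (root_of_ab h.symm)
      (root_self j) _ _ _ _ (hb r) (shortLift_proj hg hπ h s)

theorem shortLift_zero {i j : Ix g} (h : ab i ≠ ab j) : shortLift hg hπ i j (0 : R) = 1 := by
  have := shortLift_add hg hπ hc h 0 0
  rwa [add_zero, left_eq_mul] at this

theorem shortLift_symm {i j : Ix g} (h : ab i ≠ ab j) (r : R) :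
    shortLift hg hπ i j r = shortLift hg hπ j i r := by
  obtain ⟨k, h1, h2, -⟩ := exists_far hg (ab i) (ab j) (ab j)
  have ha := preim_proj hπ i k (sg k)
  have hb := preim_proj hπ (op k) j r
  have e1 := comm_eq_shortLift hg hπ hc h1.symm h2 h ha hb
  rw [sg_mul_self, one_mul] at e1
  have e2 := comm_eq_shortLift hg hπ hc (i := j) (k := op k) (j := i) (by simpa using h2.symm)
    (by simpa using h1) h.symm (hb.trans (stb_rt.symm _ (by simpa using h2)))
    (by rw [op_op]; exact ha.trans (stb_rt.symm _ h1.symm))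
  have e3 : (sg (op k) * r * sg k : R) = -r := by
    rw [sg_op]; linear_combination -r * sg_mul_self (R := R) k
  rw [e3, ← commutatorElement_inv, e1] at e2
  have e4 := shortLift_add hg hπ hc h.symm (-r) r
  rw [neg_add_cancel, shortLift_zero hg hπ hc h.symm, ← e2] at e4
  rw [inv_mul_eq_one.mp e4.symm]

end short

section long

variable (hg : 4 ≤ g) (hπ : Function.Surjective π) (hc : CentralKer π)

/-- The long part of the commutator of a short and a long root element. -/
def longPart (i j : Ix g) (r s : R) : E :=
  (shortLift hg hπ i (op j) (sg j * r * s))⁻¹ * ⁅preim hπ i j r, preim hπ (op j) (op j) s⁆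

include hg hπ hc

theorem comm_eq_longPart {i j : Ix g} {r s : R} {a b : E} (ha : π a = rt i j r)
    (hb : π b = rt (op j) (op j) s) :
    ⁅a, b⁆ = shortLift hg hπ i (op j) (sg j * r * s) * longPart hg hπ i j r s := by
  rw [longPart, mul_inv_cancel_left]
  exact hc.comm_congr (ha.trans (preim_proj hπ _ _ _).symm) (hb.trans (preim_proj hπ _ _ _).symm)

omit hc in
theorem longPart_proj {i j : Ix g} (h : ab i ≠ ab j) (r s : R) :
    π (longPart hg hπ i j r s) = rt i i (r ^ 2 * s) := by
  have h' : ab i ≠ ab (op j) := by simpa using h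
  rw [longPart, map_mul, map_inv, shortLift_proj hg hπ h', rt_r5 _ _ h (preim_proj hπ _ _ _)
    (preim_proj hπ _ _ _), inv_mul_cancel_left]

theorem shortLift_commute_long {i j : Ix g} (h : ab i ≠ ab j) {r s : R} {b : E}
    (hb : π b = rt i i s) : Commute (shortLift hg hπ i j r) b :=
  commOver hg hπ hc (root_of_ab h) (root_self i) (root_self i) (root_self i) (root_of_ab h.symm)
    (root_of_ab h.symm) _ _ _ _ (shortLift_proj hg hπ h r) hb

theorem longPart_add_right {i j : Ix g} (h : ab i ≠ ab j) (r s s' : R) :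
    longPart hg hπ i j r (s + s') = longPart hg hπ i j r s * longPart hg hπ i j r s' := by
  have h' : ab i ≠ ab (op j) := by simpa using h
  have ha := preim_proj hπ i j r
  have hb := preim_proj hπ (op j) (op j)
  have key := comm_eq_longPart hg hπ hc ha
    (b := preim hπ (op j) (op j) s * preim hπ (op j) (op j) s')
    (s := s + s') (by rw [map_mul, hb, hb, stb_rt.add _ _ (root_self _)])
  have hl := longPart_proj hg hπ h r
  have hcm : Commute (preim hπ (op j) (op j) s) (shortLift hg hπ i (op j) (sg j * r * s')) :=
    commOver hg hπ hc (root_self _) (root_of_ab h') (root_of_ab h'.symm) (root_self _)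
      (root_of_ab h'.symm) (root_self _) _ _ _ _ (hb s) (shortLift_proj hg hπ h' _)
  have hcm' : Commute (preim hπ (op j) (op j) s) (longPart hg hπ i j r s') :=
    commOver hg hπ hc (root_self _) (root_self _) (root_of_ab h'.symm) (root_of_ab h'.symm)
      (root_of_ab h'.symm) (root_of_ab h'.symm) _ _ _ _ (hb s) (hl s')
  rw [commutator_mul_right, comm_eq_longPart hg hπ hc ha (hb s),
    comm_eq_longPart hg hπ hc ha (hb s'), conj_of_commute (hcm.mul_right hcm'), mul_add,
    shortLift_add hg hπ hc h'] at key
  have h5 := shortLift_commute_long hg hπ hc h' (r := sg j * r * s') (hl s)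
  rw [h5.symm.mul_mul_mul_comm, mul_right_inj] at key
  exact key.symm

theorem longPart_add_left {i j : Ix g} (h : ab i ≠ ab j) (r r' s : R) {a b : E}
    (ha : π a = rt i j r) (hb : π b = rt i (op j) (sg j * r' * s)) :
    longPart hg hπ i j (r + r') s =
      ⁅a, b⁆ * (longPart hg hπ i j r s * longPart hg hπ i j r' s) := by
  have h' : ab i ≠ ab (op j) := by simpa using h
  have hs := shortLift_proj hg hπ h'
  have hl := longPart_proj hg hπ h
  have hp := preim_proj hπ (op j) (op j) s
  have key := comm_eq_longPart hg hπ hc (a := a * preim hπ i j r') (r := r + r') (s := s)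
    (by rw [map_mul, ha, preim_proj, stb_rt.add _ _ (root_of_ab h)]) hp
  have hm := rt_r4 _ _ h ha (hs (sg j * r' * s))
  have hal : Commute a (longPart hg hπ i j r' s) :=
    commOver hg hπ hc (root_of_ab h) (root_self i) (root_self i) (root_self i) (root_of_ab h.symm)
      (root_of_ab h.symm) _ _ _ _ ha (hl _ _)
  rw [hc.comm_congr rfl (hb.trans (hs _).symm)]
  set c' := shortLift hg hπ i (op j) (sg j * r' * s)
  set c := shortLift hg hπ i (op j) (sg j * r * s)
  have hcc : c * c' = shortLift hg hπ i (op j) (sg j * (r + r') * s) := by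
    rw [← shortLift_add hg hπ hc h']; congr 1; ring
  have hcc' : c' * c = shortLift hg hπ i (op j) (sg j * (r + r') * s) := by
    rw [← shortLift_add hg hπ hc h']; congr 1; ring
  rw [commutator_mul_left, comm_eq_longPart hg hπ hc (preim_proj hπ i j r') hp,
    comm_eq_longPart hg hπ hc ha hp, ← hcc'] at key
  have h1 := shortLift_commute_long hg hπ hc h' (r := sg j * r * s) (hl r' s)
  have h2 := shortLift_commute_long hg hπ hc h' (r := sg j * (r + r') * s) hm
  rw [← hcc'] at h2
  have h3 : Commute (longPart hg hπ i j r' s) (longPart hg hπ i j r s) :=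
    commOver hg hπ hc (root_self i) (root_self i) (root_self i) (root_self i) (root_self i)
      (root_self i) _ _ _ _ (hl r' s) (hl r s)
  have e1 : a * (c' * longPart hg hπ i j r' s) * a⁻¹ =
      ⁅a, c'⁆ * (c' * longPart hg hπ i j r' s) := by
    calc a * (c' * longPart hg hπ i j r' s) * a⁻¹
        = (a * c' * a⁻¹) * (a * longPart hg hπ i j r' s * a⁻¹) := by group
      _ = _ := by rw [conj_of_commute hal, commutatorElement_def]; group
  rw [e1, show shortLift hg hπ i (op j) (sg j * r * s) = c from rfl] at key
  rw [show shortLift hg hπ i (op j) (sg j * r * s) = c from rfl] at h1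
  refine mul_left_cancel (a := c' * c) (key.symm.trans ?_)
  calc ⁅a, c'⁆ * (c' * longPart hg hπ i j r' s) * (c * longPart hg hπ i j r s)
      = ⁅a, c'⁆ * c' * (longPart hg hπ i j r' s * c) * longPart hg hπ i j r s := by group
    _ = ⁅a, c'⁆ * (c' * c) * (longPart hg hπ i j r' s * longPart hg hπ i j r s) := by
        rw [← h1.eq]; group
    _ = _ := by rw [← h2.eq, h3.eq]; group

theorem longPart_congr {i j k : Ix g} (hij : ab i ≠ ab j) (hik : ab i ≠ ab k) (hjk : ab j ≠ ab k)
    (r t s : R) : longPart hg hπ i j r (t ^ 2 * s) = longPart hg hπ i k (sg j * r * t) s := by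
  have hij' : ab i ≠ ab (op j) := by simpa using hij
  have hik' : ab i ≠ ab (op k) := by simpa using hik
  have hjk' : ab (op j) ≠ ab (op k) := by simpa using hjk
  have hjk1 : ab (op j) ≠ ab k := by simpa using hjk
  have hkj1 : ab k ≠ ab (op j) := by simpa using hjk.symm
  have hA := preim_proj hπ i j r
  have hB := preim_proj hπ (op j) k t
  have hC := preim_proj hπ (op k) (op k) s
  have hs := @shortLift_proj _ _ _ _ _ _ hg hπ
  have hl := @longPart_proj _ _ _ _ _ _ hg hπ
  generalize preim hπ i j r = A at *
  generalize preim hπ (op j) k t = B at *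
  generalize preim hπ (op k) (op k) s = C at *
  have hP := rt_r3 _ _ hij hjk hik hA hB
  have hBC := comm_eq_longPart hg hπ hc hB hC
  have hU := hs (r := sg k * t * s) hjk'
  have hV := hl hjk1 t s
  set U := shortLift hg hπ (op j) (op k) (sg k * t * s)
  set V := longPart hg hπ (op j) k t s
  have hAC : Commute A C := commOver hg hπ hc (root_of_ab hij) (root_self _) (root_of_ab hik')
    (root_of_ab hik') (root_of_ab (by simpa using hjk)) (root_of_ab (by simpa using hjk))
      _ _ _ _ hA hC
  have hPV : Commute ⁅A, B⁆ V := commOver hg hπ hc (root_of_ab hik) (root_self _) (root_of_ab hij')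
    (root_of_ab hij') (root_of_ab hkj1) (root_of_ab hkj1) _ _ _ _ hP hV
  have hD : B * C * B⁻¹ = U * (V * C) := by
    rw [← mul_assoc, ← hBC, commutatorElement_def]; group
  have e1 : ⁅A, U * (V * C)⁆ = ⁅⁅A, B⁆, U * (V * C)⁆ := by
    rw [← hD]
    calc ⁅A, B * C * B⁻¹⁆
        = A * B * A⁻¹ * (A * C * A⁻¹) * (A * B * A⁻¹)⁻¹ * (B * C * B⁻¹)⁻¹ := by
          simp only [commutatorElement_def]; group
      _ = _ := by rw [conj_of_commute hAC]; simp only [commutatorElement_def]; group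
  have hAV := comm_eq_longPart hg hπ hc hA hV
  have hPC := comm_eq_longPart hg hπ hc hP hC
  have hAU := comm_eq_shortLift hg hπ hc hij (by simpa using hjk) hik' hA hU
  have hPU := comm_eq_shortLift hg hπ hc hik hkj1 hij' hP (hU.trans (stb_rt.symm _ hjk'))
  have hUi : ∀ p, Commute U (shortLift hg hπ i (op j) p) := fun p =>
    commOver hg hπ hc (root_of_ab hjk') (root_of_ab hij') (root_of_ab hij'.symm) (root_self _)
      (root_of_ab hik'.symm) (root_of_ab hjk'.symm) _ _ _ _ hU (hs hij' _)
  have hUk : ∀ p, Commute U (shortLift hg hπ i (op k) p) := fun p =>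
    commOver hg hπ hc (root_of_ab hjk') (root_of_ab hik') (root_of_ab hij'.symm) (root_of_ab hjk')
      (root_of_ab hik'.symm) (root_self _) _ _ _ _ hU (hs hik' _)
  have hVk : ∀ p, Commute V (shortLift hg hπ i (op k) p) := fun p =>
    commOver hg hπ hc (root_self _) (root_of_ab hik') (root_of_ab hij'.symm) (root_of_ab hjk')
      (root_of_ab hij'.symm) (root_of_ab hjk') _ _ _ _ hV (hs hik' _)
  have hUl : ∀ p b, π b = rt i i p → Commute U b := fun p b hb =>
    commOver hg hπ hc (root_of_ab hjk') (root_self i) (root_of_ab hij'.symm) (root_of_ab hij'.symm)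
      (root_of_ab hik'.symm) (root_of_ab hik'.symm) _ _ _ _ hU hb
  have hVl : ∀ p b, π b = rt i i p → Commute V b := fun p b hb =>
    commOver hg hπ hc (root_self _) (root_self i) (root_of_ab hij'.symm) (root_of_ab hij'.symm)
      (root_of_ab hij'.symm) (root_of_ab hij'.symm) _ _ _ _ hV hb
  have hcm : ∀ p p', Commute (shortLift hg hπ i (op j) p) (shortLift hg hπ i (op k) p') :=
    fun p p' => commOver hg hπ hc (root_of_ab hij') (root_of_ab hik') (root_self i)
      (root_of_ab hik') (root_of_ab hij'.symm) (root_of_ab hjk') _ _ _ _ (hs hij' _) (hs hik' _)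
  rw [commutator_mul_right A U, commutator_mul_right A V,
    commutatorElement_eq_one_iff_commute.mpr hAC,
    mul_one, mul_inv_cancel, mul_one, commutator_mul_right _ U, commutator_mul_right _ V,
    commutatorElement_eq_one_iff_commute.mpr hPV, one_mul, hAV, hPC, hAU, hPU,
    conj_of_commute ((hUi _).mul_right (hUl _ _ (hl hij _ _))),
    conj_of_commute ((hVk _).mul_right (hVl _ _ (hl hik _ _))),
    conj_of_commute ((hUk _).mul_right (hUl _ _ (hl hik _ _)))] at e1
  have r1 : sg k * (sg j * r * t) * (sg k * t * s) = sg j * r * (t ^ 2 * s) := by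
    linear_combination sg j * r * t ^ 2 * s * sg_mul_self (R := R) k
  have r2 : sg k * (sg j * r * t) * s = sg j * r * (sg k * t * s) := by ring
  rw [r1, r2] at e1
  exact mul_left_cancel (mul_left_cancel (e1.trans ((hcm _ _).left_comm _)))

theorem longPart_indep {i j k : Ix g} (hij : ab i ≠ ab j) (hik : ab i ≠ ab k) (r s : R) :
    longPart hg hπ i j r s = longPart hg hπ i k (sg k) (r ^ 2 * s) := by
  have key : ∀ {j k : Ix g}, ab i ≠ ab j → ab i ≠ ab k → ab j ≠ ab k → ∀ r s : R,
      longPart hg hπ i j r s = longPart hg hπ i k (sg k) (r ^ 2 * s) :=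
      fun {j k} hij hik hjk r s => by
    have h1 := longPart_congr hg hπ hc hik hij hjk.symm (sg k) (sg j * (sg j * r)) s
    have h2 := longPart_congr hg hπ hc hik hij hjk.symm (sg k) r s
    rw [h2]; congr 1; linear_combination -r * sg_mul_self (R := R) k
  by_cases hjk : ab j = ab k
  · obtain ⟨m, h1, h2, -⟩ := exists_far hg (ab i) (ab j) (ab j)
    rw [key hij h1.symm h2.symm, key h1.symm hik (hjk ▸ h2), sg_sq, one_mul]
  · exact key hij hik hjk r s

end long

section lift

variable (hg : 4 ≤ g) (hπ : Function.Surjective π) (hc : CentralKer π)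

/-- The Steinberg lift of the root elements. -/
def rootLift (i j : Ix g) (r : R) : E :=
  if i = j then longPart hg hπ i (exists_far hg (ab i) (ab i) (ab i)).choose
    (sg (exists_far hg (ab i) (ab i) (ab i)).choose) r else shortLift hg hπ i j r

include hc

omit hc in
theorem rootLift_short {i j : Ix g} (h : ab i ≠ ab j) (r : R) :
    rootLift hg hπ i j r = shortLift hg hπ i j r := by
  rw [rootLift, if_neg (ne_of_ab h)]

theorem longPart_eq_rootLift {i j : Ix g} (h : ab i ≠ ab j) (r s : R) :
    longPart hg hπ i j r s = rootLift hg hπ i i (r ^ 2 * s) := by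
  rw [rootLift, if_pos rfl]
  exact longPart_indep hg hπ hc h (exists_far hg (ab i) (ab i) (ab i)).choose_spec.1.symm r s

omit hc in
theorem rootLift_proj {i j : Ix g} (h : Root i j) (r : R) :
    π (rootLift hg hπ i j r) = rt i j r := by
  obtain rfl | h' := h.cases
  · have := (exists_far hg (ab i) (ab i) (ab i)).choose_spec.1.symm
    rw [rootLift, if_pos rfl, longPart_proj hg hπ this, sg_sq, one_mul]
  · rw [rootLift_short hg hπ h', shortLift_proj hg hπ h']

theorem rootLift_add {i j : Ix g} (h : Root i j) (r s : R) :
    rootLift hg hπ i j (r + s) = rootLift hg hπ i j r * rootLift hg hπ i j s := by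
  obtain rfl | h' := h.cases
  · have := (exists_far hg (ab i) (ab i) (ab i)).choose_spec.1.symm
    simp only [rootLift, if_true]
    exact longPart_add_right hg hπ hc this _ _ _
  · simp only [rootLift_short hg hπ h', shortLift_add hg hπ hc h']

theorem comm_eq_rootLift {i j : Ix g} (h : ab i ≠ ab j) {r s : R} {a b : E} (ha : π a = rt i j r)
    (hb : π b = rt (op j) (op j) s) :
    ⁅a, b⁆ = rootLift hg hπ i (op j) (sg j * r * s) * rootLift hg hπ i i (r ^ 2 * s) := by
  rw [comm_eq_longPart hg hπ hc ha hb, longPart_eq_rootLift hg hπ hc h,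
    rootLift_short hg hπ (i := i) (j := op j) (by simpa using h)]

theorem rootLift_equiv_short {i j : Ix g} (h : ab i ≠ ab j) {q : E} {σ : Ix g → Ix g} {c : Ix g → R}
    (M : Mono (π q) σ c) (r : R) :
    q * rootLift hg hπ i j r * q⁻¹ = rootLift hg hπ (σ i) (σ j) (c i * c j * r) := by
  obtain ⟨k, h1, h2, -⟩ := exists_far hg (ab i) (ab j) (ab j)
  have ha := preim_proj hπ i k (sg k)
  have hb := preim_proj hπ (op k) j r
  have e1 := comm_eq_shortLift hg hπ hc h1.symm h2 h ha hb
  rw [sg_mul_self, one_mul] at e1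
  rw [rootLift_short hg hπ h, rootLift_short hg hπ (M.far h), ← e1]
  have e2 : q * ⁅preim hπ i k (sg k), preim hπ (op k) j r⁆ * q⁻¹ =
      ⁅q * preim hπ i k (sg k) * q⁻¹, q * preim hπ (op k) j r * q⁻¹⁆ := by
    simp only [commutatorElement_def]; group
  have ha' : π (q * preim hπ i k (sg k) * q⁻¹) = rt (σ i) (σ k) (c i * c k * sg k) := by
    rw [map_mul, map_mul, map_inv, ha, M.conj (root_of_ab h1.symm)]
  have hb' : π (q * preim hπ (op k) j r * q⁻¹) = rt (op (σ k)) (σ j) (c (op k) * c j * r) := by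
    rw [map_mul, map_mul, map_inv, hb, M.conj (root_of_ab (by simpa using h2)), M.op]
  rw [e2, comm_eq_shortLift hg hπ hc (M.far h1.symm) (M.far h2) (M.far h) ha' hb']
  congr 1
  linear_combination c i * sg k * c j * r * M.sg_eq k + c i * c j * r * sg_mul_self (R := R) k

theorem rootLift_equiv_long (i : Ix g) {q : E} {σ : Ix g → Ix g} {c : Ix g → R}
    (M : Mono (π q) σ c) (r : R) :
    q * rootLift hg hπ i i r * q⁻¹ = rootLift hg hπ (σ i) (σ i) (c i * c i * r) := by
  obtain ⟨k, h1, -, -⟩ := exists_far hg (ab i) (ab i) (ab i)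
  have ha := preim_proj hπ i k 1
  have hb := preim_proj hπ (op k) (op k) r
  have e1 := comm_eq_rootLift hg hπ hc h1.symm ha hb
  rw [mul_one, one_pow, one_mul] at e1
  have ha' : π (q * preim hπ i k 1 * q⁻¹) = rt (σ i) (σ k) (c i * c k * 1) := by
    rw [map_mul, map_mul, map_inv, ha, M.conj (root_of_ab h1.symm)]
  have hb' : π (q * preim hπ (op k) (op k) r * q⁻¹) =
      rt (op (σ k)) (op (σ k)) (c (op k) * c (op k) * r) := by
    rw [map_mul, map_mul, map_inv, hb, M.conj (root_self _), M.op]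
  have e2 : q * ⁅preim hπ i k 1, preim hπ (op k) (op k) r⁆ * q⁻¹ =
      ⁅q * preim hπ i k 1 * q⁻¹, q * preim hπ (op k) (op k) r * q⁻¹⁆ := by
    simp only [commutatorElement_def]; group
  rw [comm_eq_rootLift hg hπ hc (M.far h1.symm) ha' hb', e1] at e2
  have e3 := rootLift_equiv_short hg hπ hc (i := i) (j := op k) (by simpa using h1.symm) M
    (sg k * r)
  rw [M.op] at e3
  have s0 := M.sg_eq k
  have r1 : sg (σ k) * (c i * c k * 1) * (c (op k) * c (op k) * r) =
      c i * c (op k) * (sg k * r) := by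
    linear_combination c i * c (op k) * r * s0
  have r2 : (c i * c k * 1) ^ 2 * (c (op k) * c (op k) * r) = c i * c i * r := by
    linear_combination c i ^ 2 * r * ((sg (σ k) * (c k * c (op k)) + sg k) * s0 +
      sg_mul_self (R := R) k - (c k * c (op k)) ^ 2 * sg_mul_self (R := R) (σ k))
  rw [r1, r2] at e2
  have e4 : q * (rootLift hg hπ i (op k) (sg k * r) * rootLift hg hπ i i r) * q⁻¹ =
      (q * rootLift hg hπ i (op k) (sg k * r) * q⁻¹) * (q * rootLift hg hπ i i r * q⁻¹) := by group
  rw [e4, e3, mul_right_inj] at e2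
  exact e2

theorem rootLift_lift : Lift π (rootLift hg hπ) where
  symm r h := by rw [rootLift_short hg hπ h, rootLift_short hg hπ h.symm,
    shortLift_symm hg hπ hc h]
  add r s h := rootLift_add hg hπ hc h r s
  comm r s h h' h1 h2 h3 h4 := commOver hg hπ hc h h' h1 h2 h3 h4 _ _ _ _
    (rootLift_proj hg hπ h r) (rootLift_proj hg hπ h' s)
  r3 {i j k} r s h1 h2 h3 := by
    have h2' : ab (op j) ≠ ab k := by simpa using h2
    rw [comm_eq_shortLift hg hπ hc h1 h2 h3 (rootLift_proj hg hπ (root_of_ab h1) r)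
      (rootLift_proj hg hπ (root_of_ab h2') s), rootLift_short hg hπ h3]
  r5 {i j} r s h := comm_eq_rootLift hg hπ hc h (rootLift_proj hg hπ (root_of_ab h) r)
    (rootLift_proj hg hπ (root_self _) s)
  r4 {i j} r s h := by
    have h' : ab i ≠ ab (op j) := by simpa using h
    have := longPart_add_left hg hπ hc h r (sg j * s) 1 (rootLift_proj hg hπ (root_of_ab h) r)
      (b := rootLift hg hπ i (op j) s) (by
        rw [rootLift_proj hg hπ (root_of_ab h')]
        congr 1; linear_combination -s * sg_mul_self (R := R) j)
    simp only [longPart_eq_rootLift hg hπ hc h] at this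
    rw [← rootLift_add hg hπ hc (root_self i)] at this
    rw [eq_comm, ← eq_mul_inv_iff_mul_eq] at this
    rw [this, mul_inv_eq_iff_eq_mul, ← rootLift_add hg hπ hc (root_self i)]
    congr 1
    ring
  proj r h := rootLift_proj hg hπ h r
  equiv r M h := by
    obtain rfl | h' := h.cases
    · exact rootLift_equiv_long hg hπ hc _ M r
    · exact rootLift_equiv_short hg hπ hc h' M r

end lift

end Symp

namespace RankOne

namespace System

variable {R E : Type*} [CommRing R] [IsLocalRing R] [Group E] {x y : R → E}

theorem gauss_mem (S : System x y) {H : Subgroup E} (hH : ∀ u, h x y u ∈ H) (u : Rˣ) (t a : R)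
    (hu : (u : R) = 1 + t * a) : gauss x y u t a ∈ H := by
  have key : ∀ (u a : Rˣ) (t : R), (u : R) = 1 + t * a → gauss x y u t a ∈ H := fun u a t hu => by
    rw [S.gauss_unit_right u a t hu]
    exact H.mul_mem (H.inv_mem (hH _)) (hH _)
  by_cases ha : IsUnit a
  · obtain ⟨a, rfl⟩ := ha
    exact key u a t hu
  by_cases ht : IsUnit t
  · obtain ⟨t, rfl⟩ := ht
    rw [S.gauss_unit_left u t a hu]
    exact H.mul_mem (H.inv_mem (hH _)) (hH _)
  have unit_add : ∀ s : R, IsUnit (1 + t * s) := fun s => by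
    have := (IsLocalRing.isUnit_or_isUnit_one_sub_self (-(t * s)))
    rw [sub_neg_eq_add, IsUnit.neg_iff] at this
    exact this.resolve_left fun h => ht (isUnit_of_mul_isUnit_left h)
  obtain ⟨a₂, ha₂⟩ := (IsLocalRing.isUnit_or_isUnit_one_sub_self a).resolve_left ha
  obtain ⟨u₁, hu₁⟩ := unit_add 1
  obtain ⟨u₂, hu₂⟩ := unit_add (↑u₁⁻¹ * (-(a₂ : R)))
  have e : u = u₁ * u₂ := by
    ext
    have := u₁.mul_inv
    rw [Units.val_mul, hu, hu₂]
    linear_combination (t * a₂) * this - hu₁ + t * ha₂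
  have e' : a = ((1 : Rˣ) : R) + ((-a₂ : Rˣ) : R) := by
    rw [Units.val_neg, Units.val_one]; linear_combination ha₂
  rw [e, e', S.gauss_add u₁ u₂ t 1 _ (by rw [hu₁, Units.val_one])
    (by rw [hu₂, Units.val_neg]; ring)]
  exact H.mul_mem (key _ _ _ (by rw [hu₁, Units.val_one]))
    (key _ _ _ (by rw [hu₂, Units.val_neg]; ring))

theorem exists_y_mul_x (S : System x y) {H : Subgroup E} (hH : ∀ u, h x y u ∈ H) {t a : R}
    (hu : IsUnit (1 + t * a)) : ∃ p q, ∃ k ∈ H, y t * x a = x p * k * y q := by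
  obtain ⟨u, hu⟩ := hu
  exact ⟨_, _, _, S.gauss_mem hH u t a hu, y_mul_x u t a⟩

/-- Rank one case of the decomposition of a Chevalley group over a local ring. -/
theorem exists_yxy (S : System x y) {H : Subgroup E} (hH : ∀ u, h x y u ∈ H)
    (hx : ∀ k ∈ H, ∀ r, ∃ s, k * x r * k⁻¹ = x s)
    (hy : ∀ k ∈ H, ∀ r, ∃ s, k * y r * k⁻¹ = y s) (t a b : R) :
    ∃ p q r, ∃ k ∈ H, y t * x a * y b = x p * k * y q * x r := by
  by_cases hu : IsUnit (1 + t * a)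
  · obtain ⟨p, q, k, hk, e⟩ := S.exists_y_mul_x hH hu
    exact ⟨p, q + b, 0, k, hk, by rw [e, S.x_zero, mul_one, S.y_add, mul_assoc _ (y q)]⟩
  · have ha : IsUnit a := by
      have := IsLocalRing.isUnit_or_isUnit_one_sub_self (1 + t * a)
      rw [show 1 - (1 + t * a) = -t * a by ring] at this
      exact isUnit_of_mul_isUnit_right (this.resolve_left hu)
    obtain ⟨a, rfl⟩ := ha
    set s := t + (↑a⁻¹ : R) with hs
    have hs' : ¬ IsUnit s := fun h => hu <| by
      have e : 1 + t * a = s * a := by rw [hs, add_mul, Units.inv_mul]; ring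
      rw [e]; exact h.mul a.isUnit
    have hu' : IsUnit (1 + (-(↑a⁻¹ + b)) * ((a : R) ^ 2 * s)) := by
      have := IsLocalRing.isUnit_or_isUnit_one_sub_self ((↑a⁻¹ + b) * ((a : R) ^ 2 * s))
      rw [neg_mul, ← sub_eq_add_neg]
      exact this.resolve_left fun h => hs'
        (isUnit_of_mul_isUnit_right (isUnit_of_mul_isUnit_right h))
    obtain ⟨p, q, k, hk, e⟩ := S.exists_y_mul_x hH hu'
    have e1 : x (-((a : R) ^ 2 * s)) * y (↑a⁻¹ + b) = y (-q) * k⁻¹ * x (-p) := by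
      rw [S.x_neg, S.x_neg, S.y_neg, ← _root_.inv_inj, _root_.mul_inv_rev, ← S.y_neg,
        inv_inv, e]
      group
    have e2 : y t * x a = y s * w x y a * y (↑a⁻¹ : R) := by
      rw [S.w_eq, hs, S.y_add, S.y_neg]; group
    have e3 : y s * w x y a = w x y a * x (-((a : R) ^ 2 * s)) := by
      rw [S.w_mul_x]; congr 2
      linear_combination (-s * (a * ↑a⁻¹ + 1)) * a.mul_inv
    obtain ⟨r, hr⟩ := hx k hk (a : R)
    obtain ⟨q', hq'⟩ := hy k hk (-(↑a⁻¹ : R))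
    refine ⟨-((a : R) ^ 2 * -q) + a, q', r + -p, k⁻¹, H.inv_mem hk, ?_⟩
    calc y t * x a * y b = (y s * w x y a) * (y (↑a⁻¹ : R) * y b) := by rw [e2]; group
      _ = w x y a * (x (-((a : R) ^ 2 * s)) * y (↑a⁻¹ + b)) := by rw [e3, S.y_add]; group
      _ = (w x y a * y (-q)) * (k⁻¹ * x (-p)) := by rw [e1]; group
      _ = x (-((a : R) ^ 2 * -q)) * (x a * y (-(↑a⁻¹ : R)) * x a) * (k⁻¹ * x (-p)) := by
        rw [S.w_mul_y, w]
      _ = x (-((a : R) ^ 2 * -q)) * x a * k⁻¹ * (k * y (-(↑a⁻¹ : R)) * k⁻¹) *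
          (k * x a * k⁻¹) * x (-p) := by group
      _ = _ := by rw [hr, hq', S.x_add, S.x_add]; group

end System

end RankOne

namespace Symp

set_option linter.unusedSimpArgs false

open RankOne

variable {g : ℕ} {R : Type} [CommRing R]

section mono

variable {E : Type} [Group E]

/-- The family of root elements opposite to `x i j`. -/
def opp (x : Ix g → Ix g → R → E) (i j : Ix g) (r : R) : E := x (op i) (op j) (-(sg i * sg j * r))

/-- The permutation attached to the reflection in a root. -/
def reflPerm (i j k : Ix g) : Ix g :=
  if k = i then op j else if k = op j then i else if k = j then op i else if k = op i then j else k

/-- The coefficients of the monomial matrix attached to the reflection in a root. -/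
def reflCoeff (i j : Ix g) (u : Rˣ) (k : Ix g) : R :=
  if k = i then -(↑u⁻¹ * sg j) else if k = op j then sg j * u else if k = j then -(↑u⁻¹ * sg i)
    else if k = op i then sg i * u else 1

theorem reflPerm_left (i j : Ix g) : reflPerm i j i = op j := if_pos rfl

theorem reflPerm_right {i j : Ix g} (h : Root i j) : reflPerm i j j = op i := by
  obtain rfl | h' := h.cases
  · exact if_pos rfl
  · rw [reflPerm, if_neg (ne_of_ab h').symm, if_neg (ne_op j), if_pos rfl]

theorem reflPerm_op_right {i j : Ix g} (h : Root i j) : reflPerm i j (op j) = i := by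
  rw [reflPerm, if_neg, if_pos rfl]
  exact fun h' => h.symm h'.symm

theorem reflPerm_op_left {i j : Ix g} (h : Root i j) : reflPerm i j (op i) = j := by
  obtain rfl | h' := h.cases
  · rw [reflPerm_op_right h]
  · rw [reflPerm, if_neg (op_ne i), if_neg (by rw [op_inj]; exact ne_of_ab h'), if_neg (Ne.symm h),
      if_pos rfl]

theorem reflPerm_of_ne {i j k : Ix g} (h1 : ab k ≠ ab i) (h2 : ab k ≠ ab j) :
    reflPerm i j k = k := by
  rw [reflPerm, if_neg (ne_of_ab h1), if_neg, if_neg (ne_of_ab h2), if_neg]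
  · rintro rfl; simp at h1
  · rintro rfl; simp at h2

theorem reflCoeff_left (i j : Ix g) (u : Rˣ) : reflCoeff i j u i = -(↑u⁻¹ * sg j) := if_pos rfl

theorem reflCoeff_right {i j : Ix g} (h : Root i j) (u : Rˣ) :
    reflCoeff i j u j = -(↑u⁻¹ * sg i) := by
  obtain rfl | h' := h.cases
  · exact if_pos rfl
  · rw [reflCoeff, if_neg (ne_of_ab h').symm, if_neg (ne_op j), if_pos rfl]

theorem reflCoeff_op_right {i j : Ix g} (h : Root i j) (u : Rˣ) :
    reflCoeff i j u (op j) = sg j * u := by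
  rw [reflCoeff, if_neg, if_pos rfl]
  exact fun h' => h.symm h'.symm

theorem reflCoeff_op_left {i j : Ix g} (h : Root i j) (u : Rˣ) :
    reflCoeff i j u (op i) = sg i * u := by
  obtain rfl | h' := h.cases
  · rw [reflCoeff_op_right h]
  · rw [reflCoeff, if_neg (op_ne i), if_neg (by rw [op_inj]; exact ne_of_ab h'),
      if_neg (Ne.symm h),
      if_pos rfl]

theorem reflCoeff_of_ne {i j k : Ix g} (h1 : ab k ≠ ab i) (h2 : ab k ≠ ab j) (u : Rˣ) :
    reflCoeff i j u k = 1 := by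
  rw [reflCoeff, if_neg (ne_of_ab h1), if_neg, if_neg (ne_of_ab h2), if_neg]
  · rintro rfl; simp at h1
  · rintro rfl; simp at h2

theorem refl_cases (i j k : Ix g) :
    k = i ∨ k = op j ∨ k = j ∨ k = op i ∨ (ab k ≠ ab i ∧ ab k ≠ ab j) := by
  by_cases h1 : ab k = ab i
  · obtain rfl | rfl := ab_eq_iff.mp h1.symm <;> simp
  · by_cases h2 : ab k = ab j
    · obtain rfl | rfl := ab_eq_iff.mp h2.symm <;> simp
    · simp [h1, h2]

theorem reflPerm_op {i j : Ix g} (h : Root i j) (k : Ix g) :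
    reflPerm i j (op k) = op (reflPerm i j k) := by
  obtain rfl | rfl | rfl | rfl | ⟨h1, h2⟩ := refl_cases i j k
  · rw [reflPerm_op_left h, reflPerm_left, op_op]
  · rw [reflPerm_op_right h, op_op, reflPerm_right h]
  · rw [reflPerm_op_right h, reflPerm_right h, op_op]
  · rw [reflPerm_op_left h, op_op, reflPerm_left]
  · rw [reflPerm_of_ne h1 h2, reflPerm_of_ne (by simpa using h1) (by simpa using h2)]

theorem reflPerm_reflPerm {i j : Ix g} (h : Root i j) (k : Ix g) :
    reflPerm i j (reflPerm i j k) = k := by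
  obtain rfl | rfl | rfl | rfl | ⟨h1, h2⟩ := refl_cases i j k
  · rw [reflPerm_left, reflPerm_op_right h]
  · rw [reflPerm_op_right h, reflPerm_left]
  · rw [reflPerm_right h, reflPerm_op_left h]
  · rw [reflPerm_op_left h, reflPerm_right h]
  · rw [reflPerm_of_ne h1 h2, reflPerm_of_ne h1 h2]

theorem mono_w {i j : Ix g} (h : Root i j) (u : Rˣ) :
    Mono (w (rt i j) (opp rt i j) u : Sp g R) (reflPerm i j) (reflCoeff i j u) where
  op := reflPerm_op h
  inj := Function.LeftInverse.injective (reflPerm_reflPerm h)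
  act k := by
    have huu : (u : R) * ↑u⁻¹ = 1 := u.mul_inv
    have hi : (sg i * sg i : R) = 1 := sg_mul_self i
    have hj : (sg j * sg j : R) = 1 := sg_mul_self j
    obtain rfl | h' := h.cases
    · by_cases hk : ab i = ab k
      · obtain rfl | rfl := ab_eq_iff.mp hk
        · rw [reflPerm_left, reflCoeff_left]
          simp only [w, opp, act_mul, act_rt_self, map_add, map_smul, smul_eq_mul, om_self,
            om_e_e_op, om_e_op_e, op_op]
          match_scalars <;> grind
        · rw [reflPerm_op_right h, reflCoeff_op_right h]
          simp only [w, opp, act_mul, act_rt_self, map_add, map_smul, smul_eq_mul, om_self,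
            om_e_e_op, om_e_op_e, op_op]
          match_scalars <;> grind
      · have h1 : Root i k := root_of_ab hk
        have h2 : Root (op i) k := root_of_ab (by simpa using hk)
        rw [reflPerm_of_ne (Ne.symm hk) (Ne.symm hk), reflCoeff_of_ne (Ne.symm hk) (Ne.symm hk)]
        simp only [w, opp, act_mul, act_rt_self, map_add, map_smul, smul_eq_mul, om_e_e h1,
          om_e_e h2]
        module
    · have h1 := om_e_e (R := R) (root_of_ab h')
      have h2 := om_e_e (R := R) (root_of_ab h').symm
      have ho : ab (op i) ≠ ab (op j) := by simpa using h'
      have h3 := om_e_e (R := R) (root_of_ab ho)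
      have h4 := om_e_e (R := R) (root_of_ab ho).symm
      have ho' : ab i ≠ ab (op j) := by simpa using h'
      have h5 := om_e_e (R := R) (root_of_ab ho')
      have h6 := om_e_e (R := R) (root_of_ab ho').symm
      have ho'' : ab (op i) ≠ ab j := by simpa using h'
      have h7 := om_e_e (R := R) (root_of_ab ho'')
      have h8 := om_e_e (R := R) (root_of_ab ho'').symm
      obtain rfl | rfl | rfl | rfl | ⟨hk, hk'⟩ := refl_cases i j k
      · rw [reflPerm_left, reflCoeff_left]
        simp only [w, opp, act_mul, act_rt_short h', act_rt_short ho, map_add, map_smul,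
          smul_eq_mul, om_self, om_e_e_op, om_e_op_e, h1, h2, h3, h4, h5, h6, h7, h8]
        match_scalars <;> grind
      · rw [reflPerm_op_right h, reflCoeff_op_right h]
        simp only [w, opp, act_mul, act_rt_short h', act_rt_short ho, map_add, map_smul,
          smul_eq_mul, om_self, om_e_e_op, om_e_op_e, h1, h2, h3, h4, h5, h6, h7, h8]
        match_scalars <;> grind
      · rw [reflPerm_right h, reflCoeff_right h]
        simp only [w, opp, act_mul, act_rt_short h', act_rt_short ho, map_add, map_smul,
          smul_eq_mul, om_self, om_e_e_op, om_e_op_e, h1, h2, h3, h4, h5, h6, h7, h8]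
        match_scalars <;> grind
      · rw [reflPerm_op_left h, reflCoeff_op_left h]
        simp only [w, opp, act_mul, act_rt_short h', act_rt_short ho, map_add, map_smul,
          smul_eq_mul, om_self, om_e_e_op, om_e_op_e, h1, h2, h3, h4, h5, h6, h7, h8]
        match_scalars <;> grind
      · have k1 := om_e_e (R := R) (root_of_ab hk.symm)
        have k2 := om_e_e (R := R) (root_of_ab hk'.symm)
        have k3 := om_e_e (R := R) (i := op i) (j := k) (root_of_ab (by simpa using hk.symm))
        have k4 := om_e_e (R := R) (i := op j) (j := k) (root_of_ab (by simpa using hk'.symm))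
        rw [reflPerm_of_ne hk hk', reflCoeff_of_ne hk hk']
        simp only [w, opp, act_mul, act_rt_short h', act_rt_short ho, map_add, map_smul,
          smul_eq_mul, k1, k2, k3, k4]
        module

end mono

end Symp

namespace RankOne

variable {R E : Type*} [CommRing R] [Group E] {x y x' y' : R → E} {q : E}

theorem conj_w (hx : ∀ r, q * x r * q⁻¹ = x' r) (hy : ∀ r, q * y r * q⁻¹ = y' r) (u : Rˣ) :
    q * w x y u * q⁻¹ = w x' y' u := by
  rw [w, w, ← hx, ← hy]; group

theorem conj_h (hx : ∀ r, q * x r * q⁻¹ = x' r) (hy : ∀ r, q * y r * q⁻¹ = y' r) (u : Rˣ) :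
    q * h x y u * q⁻¹ = h x' y' u := by
  rw [h, h, ← conj_w hx hy, ← conj_w hx hy]; group

end RankOne

namespace Symp

open RankOne

variable {g : ℕ} {R E : Type} [CommRing R] [Group E] {π : E →* Sp g R}

theorem Mono.mul {q q' : Sp g R} {σ σ' : Ix g → Ix g} {c c' : Ix g → R} (M : Mono q σ c)
    (M' : Mono q' σ' c') : Mono (q * q') (σ ∘ σ') (fun i => c' i * c (σ' i)) where
  act i := by rw [act_mul, M'.act, act_smul, M.act, smul_smul]; rfl
  op i := by rw [Function.comp, M'.op, M.op]; rfl
  inj := M.inj.comp M'.inj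

theorem Mono.unique {q q' : Sp g R} {σ : Ix g → Ix g} {c : Ix g → R} (M : Mono q σ c)
    (M' : Mono q' σ c) : q = q' := ext_e fun i => by rw [M.act, M'.act]

theorem mono_one : Mono (1 : Sp g R) id (fun _ => 1) :=
  ⟨fun i => by simp, fun _ => rfl, Function.injective_id⟩

/-- The coefficients of the diagonal matrix attached to an index and a unit. -/
def torusCoeff (i : Ix g) (u : Rˣ) (k : Ix g) : R :=
  if k = i then u else if k = op i then ↑u⁻¹ else 1

theorem torusCoeff_self (i : Ix g) (u : Rˣ) : torusCoeff i u i = u := if_pos rfl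

theorem torusCoeff_op (i : Ix g) (u : Rˣ) : torusCoeff i u (op i) = ↑u⁻¹ := by
  rw [torusCoeff, if_neg (op_ne i), if_pos rfl]

theorem torusCoeff_of_ne {i k : Ix g} (h : ab k ≠ ab i) (u : Rˣ) : torusCoeff i u k = 1 := by
  rw [torusCoeff, if_neg (ne_of_ab h), if_neg]
  rintro rfl; simp at h

/-- The torus element attached to an index. -/
def hel (x : Ix g → Ix g → R → E) (i : Ix g) (u : Rˣ) : E := h (x i i) (opp x i i) u

theorem mono_hel_rt (i : Ix g) (u : Rˣ) :
    Mono (hel rt i u : Sp g R) id (torusCoeff i u) := by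
  have M := (mono_w (root_self i) u).mul (mono_w (root_self i) (-1))
  have h1 : reflPerm i i ∘ reflPerm i i = id := funext fun k => reflPerm_reflPerm (root_self i) k
  have h2 : (fun k => reflCoeff i i (-1) k * reflCoeff i i u (reflPerm i i k) : Ix g → R) =
      torusCoeff i u := by
    funext k
    have e1 : (sg i * sg i : R) = 1 := sg_mul_self i
    obtain rfl | rfl | rfl | rfl | ⟨hk, hk'⟩ := refl_cases i i k
    · rw [reflPerm_left, reflCoeff_left, reflCoeff_op_right (root_self k), torusCoeff_self]
      simp only [inv_neg, inv_one, Units.val_neg, Units.val_one]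
      linear_combination u * e1
    · rw [reflPerm_op_right (root_self i), reflCoeff_left, reflCoeff_op_right (root_self i),
        torusCoeff_op]
      simp only [Units.val_neg, Units.val_one]
      linear_combination ↑u⁻¹ * e1
    · rw [reflPerm_left, reflCoeff_left, reflCoeff_op_right (root_self k), torusCoeff_self]
      simp only [inv_neg, inv_one, Units.val_neg, Units.val_one]
      linear_combination u * e1
    · rw [reflPerm_op_right (root_self i), reflCoeff_left, reflCoeff_op_right (root_self i),
        torusCoeff_op]
      simp only [Units.val_neg, Units.val_one]
      linear_combination ↑u⁻¹ * e1
    · rw [reflPerm_of_ne hk hk', reflCoeff_of_ne hk hk', reflCoeff_of_ne hk hk',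
        torusCoeff_of_ne hk, one_mul]
  rw [h1, h2] at M
  exact M

section lift

variable {x : Ix g → Ix g → R → E} (L : Lift π x)
include L

theorem Lift.symm' {i j : Ix g} (h : Root i j) (r : R) : x i j r = x j i r := by
  obtain rfl | h' := h.cases
  · rfl
  · exact L.symm r h'

theorem Lift.proj_opp {i j : Ix g} (h : Root i j) (r : R) : π (opp x i j r) = opp rt i j r :=
  L.proj _ h.op

theorem Lift.proj_w {i j : Ix g} (h : Root i j) (u : Rˣ) :
    π (w (x i j) (opp x i j) u) = w (rt i j) (opp rt i j) u := by
  simp only [w, map_mul, L.proj _ h, L.proj_opp h]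

theorem Lift.mono_w {i j : Ix g} (h : Root i j) (u : Rˣ) :
    Mono (π (w (x i j) (opp x i j) u)) (reflPerm i j) (reflCoeff i j u) := by
  rw [L.proj_w h]; exact Symp.mono_w h u

theorem Lift.system {i j : Ix g} (h : Root i j) : System (x i j) (opp x i j) where
  x_add a b := L.add a b h
  y_add a b := by rw [opp, opp, opp, ← L.add _ _ h.op]; congr 1; ring
  conj_x u r := by
    rw [L.equiv r (L.mono_w h u) h, reflPerm_left, reflPerm_right h, reflCoeff_left,
      reflCoeff_right h, L.symm' h.op.symm, opp]
    congr 1; ring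
  conj_y u r := by
    rw [opp, L.equiv _ (L.mono_w h u) h.op, reflPerm_op_left h, reflPerm_op_right h,
      reflCoeff_op_left h, reflCoeff_op_right h, L.symm' h.symm]
    congr 1
    have hi : (sg i * sg i : R) = 1 := sg_mul_self i
    have hj : (sg j * sg j : R) = 1 := sg_mul_self j
    linear_combination (-u ^ 2 * r * sg j * sg j) * hi - u ^ 2 * r * hj

theorem Lift.mono_hel (i : Ix g) (u : Rˣ) : Mono (π (hel x i u)) id (torusCoeff i u) := by
  have : π (hel x i u) = hel rt i u := by
    simp only [hel, h, map_mul, L.proj_w (root_self i)]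
  rw [this]; exact mono_hel_rt i u

theorem Lift.conj_hel {q : E} {σ : Ix g → Ix g} {c : Ix g → R} (M : Mono (π q) σ c) {i : Ix g}
    (h1 : c i * c i = 1) (h2 : c (op i) * c (op i) = 1) (u : Rˣ) :
    q * hel x i u * q⁻¹ = hel x (σ i) u := by
  refine conj_h (fun r => ?_) (fun r => ?_) u
  · rw [L.equiv r M (root_self i), h1, one_mul]
  · rw [opp, L.equiv _ M (root_self (op i)), h2, one_mul, M.op, opp, sg_mul_self, sg_mul_self]

theorem Lift.hel_op (i : Ix g) (u : Rˣ) : hel x (op i) u = hel x i u⁻¹ := by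
  have S := L.system (root_self i)
  have key : ∀ v, w (x (op i) (op i)) (opp x (op i) (op i)) v = w (x i i) (opp x i i) v⁻¹ := by
    intro v
    rw [S.w_eq, w]
    simp [opp]
  rw [hel, hel, h, h, key, key, inv_neg, inv_one]

theorem Lift.h_short {i j : Ix g} (hij : ab i ≠ ab j) (v : Rˣ) :
    h (x i j) (opp x i j) v = hel x i v * (hel x j v⁻¹)⁻¹ := by
  have hr := root_of_ab hij
  have S := L.system hr
  have e1 : w (x i j) (opp x i j) v =
      hel x i v * w (x i j) (opp x i j) 1 * (hel x i v)⁻¹ := by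
    have a1 : ∀ r, hel x i v * x i j r * (hel x i v)⁻¹ = x i j (v * r) := fun r => by
      rw [L.equiv r (L.mono_hel i v) hr, torusCoeff_self, torusCoeff_of_ne hij.symm, mul_one]; rfl
    have a2 : ∀ r, hel x i v * opp x i j r * (hel x i v)⁻¹ = opp x i j (↑v⁻¹ * r) := fun r => by
      rw [opp, L.equiv _ (L.mono_hel i v) hr.op, torusCoeff_op,
        torusCoeff_of_ne (by simpa using hij.symm), mul_one, opp]
      simp only [id]
      congr 1; ring
    rw [conj_w a1 a2]
    simp only [w, Units.val_one, inv_one, mul_one, mul_neg]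
  have e2 := L.conj_hel (L.mono_w hr 1) (i := i)
    (by rw [reflCoeff_left, inv_one, Units.val_one]; simp)
    (by rw [reflCoeff_op_left hr, Units.val_one]; simp) v
  rw [reflPerm_left, L.hel_op] at e2
  rw [← e2, h, e1, S.w_neg_one]
  group

theorem Lift.commute_hel {i j : Ix g} (hij : ab i ≠ ab j) (u v : Rˣ) :
    Commute (hel x i u) (hel x j v) := by
  have := L.conj_hel (L.mono_hel i u) (i := j)
    (by rw [torusCoeff_of_ne hij.symm, one_mul])
    (by rw [torusCoeff_of_ne (by simpa using hij.symm), one_mul]) v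
  rwa [mul_inv_eq_iff_eq_mul] at this

theorem Lift.map_hel_mul (i : Ix g) (u v : Rˣ) :
    π (hel x i (u * v)) = π (hel x i u) * π (hel x i v) := by
  have M := (L.mono_hel i u).mul (L.mono_hel i v)
  refine Mono.unique (L.mono_hel i (u * v)) ?_
  have e1 : torusCoeff i (u * v) =
      (fun k => torusCoeff i v k * torusCoeff i u (id k) : Ix g → R) := by
    funext k
    simp only [torusCoeff, id]
    split_ifs <;> simp [mul_comm]
  rw [e1]
  exact M

theorem Lift.map_sym (i : Ix g) (u v : Rˣ) : π (sym (x i i) (opp x i i) u v) = 1 := by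
  rw [sym, map_mul, map_mul, map_inv]
  have := L.map_hel_mul i u v
  simp only [hel] at this
  rw [this, mul_inv_cancel]

theorem Lift.sym_eq (hc : CentralKer π) {i j : Ix g} (hij : ab i ≠ ab j) (u v : Rˣ) :
    sym (x i i) (opp x i i) u v = sym (x j j) (opp x j j) u v := by
  have hij' : ab i ≠ ab (op j) := by simpa using hij
  have hr := root_of_ab hij'
  have e2 := L.conj_hel (L.mono_w hr 1) (i := i)
    (by rw [reflCoeff_left, inv_one, Units.val_one]; simp)
    (by rw [reflCoeff_op_left hr, Units.val_one]; simp)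
  rw [reflPerm_left, op_op] at e2
  simp only [hel] at e2
  rw [← conj_of_commute (hc _ (L.map_sym i u v) (w (x i (op j)) (opp x i (op j)) 1)).symm]
  simp only [sym]
  rw [← e2, ← e2, ← e2]
  group

end lift

end Symp

namespace Symp

open RankOne
open scoped commutatorElement

variable {g : ℕ} {R E : Type} [CommRing R] [Group E] {π : E →* Sp g R}

/-- The subgroup generated by the root elements whose weight is at least `c`. -/
def unip (x : Ix g → Ix g → R → E) (φ : Ix g → ℤ) (c : ℤ) : Subgroup E :=
  Subgroup.closure {z | ∃ k l r, Root k l ∧ c ≤ φ k + φ l ∧ z = x k l r}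

omit [CommRing R] in
theorem mem_unip {x : Ix g → Ix g → R → E} {φ : Ix g → ℤ} {c : ℤ} {k l : Ix g} (h : Root k l)
    (hc : c ≤ φ k + φ l) (r : R) : x k l r ∈ unip x φ c :=
  Subgroup.subset_closure ⟨k, l, r, h, hc, rfl⟩

omit [CommRing R] in
theorem unip_le {x : Ix g → Ix g → R → E} {φ : Ix g → ℤ} {c : ℤ} {N : Subgroup E}
    (h : ∀ k l r, Root k l → c ≤ φ k + φ l → x k l r ∈ N) : unip x φ c ≤ N := by
  rw [unip, Subgroup.closure_le]
  rintro _ ⟨k, l, r, h1, h2, rfl⟩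
  exact h k l r h1 h2

section generic

/-- Factorization of a group generated by a normalized subgroup and a one-parameter family. -/
theorem exists_factor {S : Set E} {U : Subgroup E} {x : R → E}
    (hadd : ∀ a b, x (a + b) = x a * x b) (hU : ∀ a, ∀ u ∈ U, x a * u * (x a)⁻¹ ∈ U)
    (hS : ∀ s ∈ S, s ∈ U ∨ ∃ a, s = x a) {z : E} (hz : z ∈ Subgroup.closure S) :
    ∃ u ∈ U, ∃ a, z = u * x a := by
  have h0 : x 0 = 1 := by simpa using hadd 0 0
  have hneg : ∀ a, x (-a) = (x a)⁻¹ := fun a => by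
    rw [eq_inv_iff_mul_eq_one, ← hadd, neg_add_cancel, h0]
  induction hz using Subgroup.closure_induction with
  | mem s hs =>
    obtain h | ⟨a, rfl⟩ := hS s hs
    · exact ⟨s, h, 0, by rw [h0, mul_one]⟩
    · exact ⟨1, U.one_mem, a, by rw [one_mul]⟩
  | one => exact ⟨1, U.one_mem, 0, by rw [h0, mul_one]⟩
  | mul z z' _ _ h h' =>
    obtain ⟨u, hu, a, rfl⟩ := h
    obtain ⟨v, hv, b, rfl⟩ := h'
    exact ⟨_, U.mul_mem hu (hU a v hv), a + b, by rw [hadd]; group⟩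
  | inv z _ h =>
    obtain ⟨u, hu, a, rfl⟩ := h
    exact ⟨_, hU (-a) _ (U.inv_mem hu), -a, by rw [hneg]; group⟩

end generic

theorem Mono.inv {q : Sp g R} {c : Ix g → R} (M : Mono q id c) :
    Mono q⁻¹ id (fun i => c (Symp.op i)) where
  act i := by
    have h1 := M.sg_eq i
    have h2 : c (Symp.op i) * c i = 1 := by
      have e1 : (sg i * sg i : R) = 1 := sg_mul_self i
      simp only [id] at h1
      linear_combination sg i * h1 + (1 - c i * c (Symp.op i)) * e1
    have h3 := M.act i
    calc Symp.act q⁻¹ (e i) = Symp.act q⁻¹ ((c (Symp.op i) * c i) • e i) := by rw [h2, one_smul]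
      _ = c (Symp.op i) • Symp.act q⁻¹ (Symp.act q (e i)) := by
        rw [h3, ← act_smul, smul_smul]; rfl
      _ = _ := by rw [act_inv_act]; rfl
  op _ := rfl
  inj := Function.injective_id

/-- The elements over diagonal matrices. -/
def torus (π : E →* Sp g R) : Subgroup E where
  carrier := {q | ∃ c, Mono (π q) id c}
  one_mem' := ⟨_, by rw [map_one]; exact mono_one⟩
  mul_mem' := by
    rintro a b ⟨c, hc⟩ ⟨d, hd⟩
    exact ⟨_, by rw [map_mul]; exact hc.mul hd⟩
  inv_mem' := by
    rintro a ⟨c, hc⟩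
    exact ⟨_, by rw [map_inv]; exact hc.inv⟩

/-- The group generated by the torus elements. -/
def tor (x : Ix g → Ix g → R → E) : Subgroup E :=
  Subgroup.closure {z | ∃ i u, z = hel x i u}

theorem hel_mem_tor {x : Ix g → Ix g → R → E} (i : Ix g) (u : Rˣ) : hel x i u ∈ tor x :=
  Subgroup.subset_closure ⟨i, u, rfl⟩

section lift

variable {x : Ix g → Ix g → R → E} (L : Lift π x)
include L

theorem Lift.tor_le : tor x ≤ torus π := by
  rw [tor, Subgroup.closure_le]
  rintro _ ⟨i, u, rfl⟩
  exact ⟨_, L.mono_hel i u⟩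

theorem Lift.tor_conj {q : E} (hq : q ∈ tor x) {k l : Ix g} (h : Root k l) (r : R) :
    ∃ s, q * x k l r * q⁻¹ = x k l s := by
  obtain ⟨c, hc⟩ := L.tor_le hq
  exact ⟨_, L.equiv r hc h⟩

theorem Lift.tor_conj_unip {q : E} (hq : q ∈ tor x) {φ : Ix g → ℤ} {c : ℤ} {z : E}
    (hz : z ∈ unip x φ c) : q * z * q⁻¹ ∈ unip x φ c := by
  have : unip x φ c ≤ (unip x φ c).comap (MulAut.conj q).toMonoidHom :=
    unip_le fun k l r h1 h2 => by
    obtain ⟨s, hs⟩ := L.tor_conj hq h1 r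
    rw [Subgroup.mem_comap]
    change q * x k l r * q⁻¹ ∈ _
    rw [hs]; exact mem_unip h1 h2 s
  exact this hz

theorem Lift.h_mem_tor {i j : Ix g} (h : Root i j) (u : Rˣ) :
    RankOne.h (x i j) (opp x i j) u ∈ tor x := by
  obtain rfl | h' := h.cases
  · exact hel_mem_tor i u
  · rw [L.h_short h']
    exact mul_mem (hel_mem_tor i u) (inv_mem (hel_mem_tor j _))

variable {φ : Ix g → ℤ} (hφ : ∀ i, φ (op i) = -φ i)
include hφ

theorem Lift.comm_op_mem {c : ℤ} (hc : 1 ≤ c) {i j l : Ix g} (h : Root i j) (h' : Root (op j) l)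
    (r s : R) (h1 : 0 ≤ φ i + φ j) (h2 : c ≤ φ (op j) + φ l) :
    ⁅x i j r, x (op j) l s⁆ ∈ unip x φ c := by
  have hj := hφ j
  have hli : l ≠ op i := by
    rintro rfl
    have := hφ i
    omega
  obtain rfl | hij := h.cases
  · have hli' : ab l ≠ ab (op i) := by
      intro e
      rw [ab_op] at e
      obtain e | e := ab_eq_iff.mp e.symm
      · exact h' (by rw [op_op, e])
      · exact hli e
    have := L.r5 (i := l) (j := op i) s r hli'
    rw [op_op] at this
    rw [← commutatorElement_inv, L.symm' h', this]
    refine inv_mem (mul_mem (mem_unip ?_ ?_ _) (mem_unip (root_self _) ?_ _))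
    · exact root_of_ab (by simpa using hli')
    · omega
    · omega
  by_cases hlj : l = op j
  · subst hlj
    rw [L.r5 r s hij]
    refine mul_mem (mem_unip (root_of_ab (by simpa using hij)) ?_ _) (mem_unip (root_self _) ?_ _)
    · omega
    · omega
  have hjl : ab j ≠ ab l := by
    intro e
    obtain rfl | rfl := ab_eq_iff.mp e
    · exact h' (op_op j).symm
    · exact hlj rfl
  by_cases hil : l = i
  · subst hil
    rw [L.symm' h', L.r4 r s hij]
    exact mem_unip (root_self _) (by omega) _
  have hil' : ab i ≠ ab l := by
    intro e
    obtain rfl | rfl := ab_eq_iff.mp e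
    · exact hil rfl
    · exact hli rfl
  rw [L.r3 r s hij hjl hil']
  exact mem_unip (root_of_ab hil') (by omega) _

theorem Lift.comm_mem {c : ℤ} (hc : 1 ≤ c) {i j k l : Ix g} (h : Root i j) (h' : Root k l)
    (r s : R) (h1 : 0 ≤ φ i + φ j) (h2 : c ≤ φ k + φ l) :
    ⁅x i j r, x k l s⁆ ∈ unip x φ c := by
  by_cases e1 : k = op j
  · subst e1; exact L.comm_op_mem hφ hc h h' r s h1 h2
  by_cases e2 : k = op i
  · subst e2
    rw [L.symm' h]
    exact L.comm_op_mem hφ hc h.symm h' r s (by omega) h2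
  by_cases e3 : l = op j
  · subst e3
    rw [L.symm' h']
    exact L.comm_op_mem hφ hc h h'.symm r s h1 (by omega)
  by_cases e4 : l = op i
  · subst e4
    rw [L.symm' h', L.symm' h]
    exact L.comm_op_mem hφ hc h.symm h'.symm r s (by omega) (by omega)
  rw [(commutatorElement_eq_one_iff_commute).mpr (L.comm r s h h' e2 e4 e1 e3)]
  exact one_mem _

theorem Lift.conj_unip {c : ℤ} (hc : 1 ≤ c) {i j : Ix g} (h : Root i j) (r : R)
    (h1 : 0 ≤ φ i + φ j) {z : E} (hz : z ∈ unip x φ c) :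
    x i j r * z * (x i j r)⁻¹ ∈ unip x φ c := by
  have : unip x φ c ≤ (unip x φ c).comap (MulAut.conj (x i j r)).toMonoidHom :=
    unip_le fun k l s h2 h3 => by
      rw [Subgroup.mem_comap]
      change x i j r * x k l s * (x i j r)⁻¹ ∈ _
      have e : x i j r * x k l s * (x i j r)⁻¹ = ⁅x i j r, x k l s⁆ * x k l s := by
        rw [commutatorElement_def]; group
      rw [e]
      exact mul_mem (L.comm_mem hφ hc h h2 r s h1 h3) (mem_unip h2 h3 s)
  exact this hz

/-- Splitting off one root subgroup from a unipotent group. -/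
theorem Lift.unip_factor {φ' : Ix g → ℤ} {c c' : ℤ} (hc : 1 ≤ c) {i j : Ix g} (h : Root i j)
    (h1 : 0 ≤ φ i + φ j)
    (h2 : ∀ k l, Root k l → c' ≤ φ' k + φ' l → (k = i ∧ l = j) ∨ (k = j ∧ l = i) ∨ c ≤ φ k + φ l)
    {z : E} (hz : z ∈ unip x φ' c') : ∃ u ∈ unip x φ c, ∃ a, z = u * x i j a := by
  refine exists_factor (fun a b => L.add a b h) (fun a u hu => L.conj_unip hφ hc h a h1 hu) ?_ hz
  rintro _ ⟨k, l, r, h3, h4, rfl⟩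
  obtain ⟨rfl, rfl⟩ | ⟨rfl, rfl⟩ | h5 := h2 k l h3 h4
  · exact Or.inr ⟨r, rfl⟩
  · exact Or.inr ⟨r, L.symm' h3 r⟩
  · exact Or.inl (mem_unip h3 h5 r)

end lift

end Symp

namespace RankOne

variable {R E : Type*} [CommRing R] [IsLocalRing R] [Group E] {x y : R → E}

/-- Absorbing a simple negative root element in a product decomposition. -/
theorem System.gauss_step (S : System x y) {U V U' V' H : Subgroup E} (hU : U' ≤ U)
    (hxU : ∀ a, x a ∈ U) (hfU : ∀ u ∈ U, ∃ u' ∈ U', ∃ a, u = u' * x a) (hV : V' ≤ V)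
    (hyV : ∀ a, y a ∈ V) (hfV : ∀ u ∈ V, ∃ u' ∈ V', ∃ a, u = u' * y a)
    (hyU : ∀ a, ∀ u ∈ U', y a * u * (y a)⁻¹ ∈ U') (hxV : ∀ a, ∀ u ∈ V', x a * u * (x a)⁻¹ ∈ V')
    (hyV' : ∀ a, ∀ u ∈ V', y a * u * (y a)⁻¹ ∈ V') (hH : ∀ u, h x y u ∈ H)
    (hHx : ∀ k ∈ H, ∀ r, ∃ s, k * x r * k⁻¹ = x s) (hHy : ∀ k ∈ H, ∀ r, ∃ s, k * y r * k⁻¹ = y s)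
    (hHV : ∀ k ∈ H, ∀ u ∈ V', k * u * k⁻¹ ∈ V') (t : R)
    {z : E} (hz : ∃ u ∈ U, ∃ k ∈ H, ∃ v ∈ V, ∃ u' ∈ U, z = u * k * v * u') :
    ∃ u ∈ U, ∃ k ∈ H, ∃ v ∈ V, ∃ u' ∈ U, y t * z = u * k * v * u' := by
  obtain ⟨_, hu, k, hk, _, hv, u1, hu1, rfl⟩ := hz
  obtain ⟨u, hum, a, rfl⟩ := hfU _ hu
  obtain ⟨v, hvm, b, rfl⟩ := hfV _ hv
  obtain ⟨t', ht'⟩ := hHy _ (H.inv_mem hk) t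
  obtain ⟨a', ha'⟩ := hHx _ (H.inv_mem hk) a
  obtain ⟨p, q, r, k1, hk1, e⟩ := S.exists_yxy hH hHx hHy t' a' b
  obtain ⟨p', hp'⟩ := hHx k hk p
  have m1 := hyV' t' _ (hxV a' v hvm)
  have m2 := hHV _ (H.inv_mem hk1) _ (hxV (-p) _ m1)
  refine ⟨_, U.mul_mem (hU (hyU t u hum)) (hxU p'), k * k1, H.mul_mem hk hk1, _,
    V.mul_mem (hV m2) (hyV q), x r * u1, U.mul_mem (hxU r) hu1, ?_⟩
  rw [S.x_neg, ← hp']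
  have e' : k * (y t' * x a') = y t * x a * k := by rw [← ht', ← ha']; group
  calc y t * (u * x a * k * (v * y b) * u1)
      = (y t * u * (y t)⁻¹) * (y t * x a * k) * v * (y b) * u1 := by group
    _ = (y t * u * (y t)⁻¹) * k * (y t' * x a' * v * (x a')⁻¹ * (y t')⁻¹) *
        (y t' * x a' * y b) * u1 := by rw [← e']; group
    _ = _ := by rw [e]; group

end RankOne

namespace Symp

open RankOne

variable {g : ℕ} {R E : Type} [CommRing R] [Group E] {π : E →* Sp g R}

/-- A generic height function on indices. -/
def hgt (i : Ix g) : ℤ := Sum.elim (fun b => 5 ^ b.val) (fun b => -5 ^ b.val) i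

theorem hgt_op (i : Ix g) : hgt (op i) = -hgt i := by cases i <;> simp [hgt]

/-- The pair `i j` is a simple root, and `φ` vanishes on no other positive root. -/
structure Simple (i j : Ix g) (φ : Ix g → ℤ) : Prop where
  root : Root i j
  odd : ∀ k, φ (op k) = -φ k
  zero : φ i + φ j = 0
  pos : 1 ≤ hgt i + hgt j
  of_pos : ∀ k l, Root k l → 1 ≤ hgt k + hgt l →
    (k = i ∧ l = j) ∨ (k = j ∧ l = i) ∨ 1 ≤ φ k + φ l

theorem hgt_ne_zero {k l : Ix g} (h : Root k l) : hgt k + hgt l ≠ 0 := by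
  have key : ∀ a b : Fin g, a ≠ b → (5 : ℤ) ^ a.val ≠ 5 ^ b.val := fun a b hab h =>
    hab (Fin.ext (pow_right_injective₀ (by norm_num) (by norm_num) h))
  have p : ∀ a : Fin g, (0 : ℤ) < 5 ^ a.val := fun a => by positivity
  rcases k with a | a <;> rcases l with b | b <;> simp only [hgt, Sum.elim_inl, Sum.elim_inr]
  · have := p a; have := p b; omega
  · have := key a b (fun e => h (by rw [e]; rfl)); omega
  · have := key a b (fun e => h (by rw [e]; rfl)); omega
  · have := p a; have := p b; omega

/-- Functionals vanishing on exactly one simple root. -/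
def wall (m : Fin g) (i : Ix g) : ℤ :=
  Sum.elim (fun b => b.val + if b < m then 1 else 0) (fun b => -(b.val + if b < m then 1 else 0)) i

theorem wall_op (m : Fin g) (i : Ix g) : wall m (op i) = -wall m i := by cases i <;> simp [wall]

theorem hgt_lt {a b : Fin g} : (5 : ℤ) ^ a.val < 5 ^ b.val ↔ a < b := by
  rw [pow_lt_pow_iff_right₀ (by norm_num), Fin.lt_def]

theorem simple_long (m : Fin g) (hm : m.val = 0) : Simple (.inl m) (.inl m) (wall m) where
  root := root_self _
  odd := wall_op m
  zero := by simp [wall, hm]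
  pos := by simp [hgt, hm]
  of_pos k l hr h := by
    rcases k with a | a <;> rcases l with b | b <;> simp only [hgt, wall, Sum.elim_inl,
      Sum.elim_inr, Sum.inl.injEq, Fin.ext_iff, Fin.lt_def, hm, not_lt_zero, if_false] at h ⊢
    · omega
    · have := (hgt_lt (a := b) (b := a)).mp (by omega)
      rw [Fin.lt_def] at this; omega
    · have := (hgt_lt (a := a) (b := b)).mp (by omega)
      rw [Fin.lt_def] at this; omega
    · have p : ∀ a : Fin g, (0 : ℤ) < 5 ^ a.val := fun a => by positivity
      have := p a; have := p b; omega

theorem simple_short (m n : Fin g) (hm : m.val = n.val + 1) :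
    Simple (.inl m) (.inr n) (wall m) where
  root := fun h => by simp at h; rw [h] at hm; omega
  odd := wall_op m
  zero := by
    have : ¬ m.val < m.val := lt_irrefl _
    have h' : n.val < m.val := by omega
    simp only [wall, Sum.elim_inl, Sum.elim_inr, Fin.lt_def, if_neg this, if_pos h']
    omega
  pos := by
    have := (hgt_lt (a := n) (b := m)).mpr (by rw [Fin.lt_def]; omega)
    simp only [hgt, Sum.elim_inl, Sum.elim_inr]; omega
  of_pos k l hr h := by
    rcases k with a | a <;> rcases l with b | b <;> simp only [hgt, wall, Sum.elim_inl,
      Sum.elim_inr, Sum.inl.injEq, Sum.inr.injEq, Fin.ext_iff, Fin.lt_def, hm] at h ⊢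
    · split_ifs <;> omega
    · have := (hgt_lt (a := b) (b := a)).mp (by omega)
      rw [Fin.lt_def] at this
      split_ifs <;> omega
    · have := (hgt_lt (a := a) (b := b)).mp (by omega)
      rw [Fin.lt_def] at this
      split_ifs <;> omega
    · have p : ∀ a : Fin g, (0 : ℤ) < 5 ^ a.val := fun a => by positivity
      have := p a; have := p b; omega

theorem Simple.pos_of {i j : Ix g} {φ : Ix g → ℤ} (h : Simple i j φ) {k l : Ix g} (hr : Root k l)
    (hk : 1 ≤ φ k + φ l) : 1 ≤ hgt k + hgt l := by
  by_contra hn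
  have h0 := hgt_ne_zero hr
  have h1 := h.of_pos (op k) (op l) hr.op (by rw [hgt_op, hgt_op]; omega)
  have h2 := h.zero
  have e1 := h.odd k
  have e2 := h.odd l
  obtain ⟨h3, h4⟩ | ⟨h3, h4⟩ | h3 := h1
  · rw [h3] at e1; rw [h4] at e2; omega
  · rw [h3] at e1; rw [h4] at e2; omega
  · omega

/-- Products of unipotent, torus, opposite unipotent and unipotent elements. -/
def BigCell (x : Ix g → Ix g → R → E) (z : E) : Prop :=
  ∃ u ∈ unip x hgt 1, ∃ k ∈ tor x, ∃ v ∈ unip x (fun i => -hgt i) 1, ∃ u' ∈ unip x hgt 1,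
    z = u * k * v * u'

section lift

variable [IsLocalRing R] {x : Ix g → Ix g → R → E} (L : Lift π x)
include L

theorem Lift.bigCell_step {i j : Ix g} {φ : Ix g → ℤ} (hs : Simple i j φ) {z : E}
    (hz : BigCell x z) (t : R) : BigCell x (opp x i j t * z) := by
  have hodd' : ∀ k : Ix g, (fun i => -φ i) (op k) = -(fun i => -φ i) k := fun k => by
    simp only [hs.odd]
  have hzero := hs.zero
  have e1 := hs.odd i
  have e2 := hs.odd j
  have hpos := hs.pos
  have e3 := hgt_op i
  have e4 := hgt_op j
  refine (L.system hs.root).gauss_step (U' := unip x φ 1) (V' := unip x (fun i => -φ i) 1)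
    (H := tor x) ?_ ?_ ?_ ?_ ?_ ?_ ?_ ?_ ?_ ?_ ?_ ?_ ?_ t hz
  · exact unip_le fun k l r h h' => mem_unip h (hs.pos_of h h') r
  · exact fun a => mem_unip hs.root hs.pos a
  · exact fun u hu => L.unip_factor hs.odd le_rfl hs.root (by omega) hs.of_pos hu
  · refine unip_le fun k l r h h' => mem_unip h ?_ r
    have := hs.pos_of h.op (by rw [hs.odd, hs.odd]; omega)
    rw [hgt_op, hgt_op] at this; omega
  · exact fun a => mem_unip hs.root.op (by omega) _
  · intro u hu
    have := L.unip_factor (φ := fun i => -φ i) hodd' le_rfl hs.root.op (by omega)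
      (fun k l h h' => ?_) hu
    · obtain ⟨u', hu', a, rfl⟩ := this
      refine ⟨u', hu', -(sg i * sg j * a), ?_⟩
      rw [opp]
      congr 2
      linear_combination (-a * sg j * sg j) * sg_mul_self (R := R) i - a * sg_mul_self (R := R) j
    · have := hs.of_pos _ _ h.op (by rw [hgt_op, hgt_op]; omega)
      rw [hs.odd, hs.odd] at this
      simp only [op_eq_iff] at this
      exact this.imp_right (Or.imp_right fun h => by omega)
  · exact fun a u hu => L.conj_unip hs.odd le_rfl hs.root.op _ (by omega) hu
  · exact fun a u hu => L.conj_unip (φ := fun i => -φ i) hodd' le_rfl hs.root a (by omega) hu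
  · exact fun a u hu => L.conj_unip (φ := fun i => -φ i) hodd' le_rfl hs.root.op _ (by omega) hu
  · exact L.h_mem_tor hs.root
  · exact fun k hk r => L.tor_conj hk hs.root r
  · intro k hk r
    obtain ⟨s, hs'⟩ := L.tor_conj hk hs.root.op (-(sg i * sg j * r))
    refine ⟨-(sg i * sg j * s), ?_⟩
    rw [opp, hs', opp]
    congr 1
    linear_combination (-s * sg j * sg j) * sg_mul_self (R := R) i - s * sg_mul_self (R := R) j
  · exact fun k hk u hu => L.tor_conj_unip hk hu

end lift

end Symp

namespace Symp

open RankOne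
open scoped commutatorElement

variable {g : ℕ} {R E : Type} [CommRing R] [Group E] {π : E →* Sp g R}
  {x : Ix g → Ix g → R → E}

theorem commutator_mem {N : Subgroup E} {a b : E} (ha : a ∈ N) (hb : b ∈ N) : ⁅a, b⁆ ∈ N := by
  rw [commutatorElement_def]
  exact mul_mem (mul_mem (mul_mem ha hb) (inv_mem ha)) (inv_mem hb)

section lift

variable (L : Lift π x)
include L

omit L in
theorem opp_simple_mem {N : Subgroup E} {i j : Ix g} (h : ∀ t, opp x i j t ∈ N) (r : R) :
    x (op i) (op j) r ∈ N := by
  have := h (-(sg i * sg j * r))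
  rw [opp] at this
  convert this using 2
  linear_combination (-r * sg j * sg j) * sg_mul_self (R := R) i - r * sg_mul_self (R := R) j

/-- The positive and the negative simple root elements generate all root elements. -/
theorem Lift.root_mem {N : Subgroup E} (hU : unip x hgt 1 ≤ N)
    (hS : ∀ i j φ, Simple i j φ → ∀ t, opp x i j t ∈ N) {k l : Ix g} (r : R) (h : Root k l) :
    x k l r ∈ N := by
  have hlt : ∀ (d : ℕ) (a b : Fin g) (r : R), b.val = a.val + 1 + d →
      x (.inl a) (.inr b) r ∈ N := by
    intro d
    induction d with
    | zero =>
      intro a b r hab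
      have := opp_simple_mem (hS _ _ _ (simple_short b a hab)) r
      rwa [L.symm' (simple_short b a hab).root.op] at this
    | succ d ih =>
      intro a b r hab
      have hb' := b.isLt
      obtain ⟨c, hc⟩ : ∃ c : Fin g, c.val = a.val + 1 + d := ⟨⟨a.val + 1 + d, by omega⟩, rfl⟩
      have h1 := ih a c (-r) hc
      have h2 : x (.inl c) (.inr b) 1 ∈ N := by
        have := opp_simple_mem (hS _ _ _ (simple_short b c (by omega))) 1
        rwa [L.symm' (simple_short b c (by omega)).root.op] at this
      have h3 := L.r3 (i := .inl a) (j := .inr c) (k := .inr b) (-r) 1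
        (by simp [Fin.ext_iff]; omega) (by simp [Fin.ext_iff]; omega)
        (by simp [Fin.ext_iff]; omega)
      have h4 := commutator_mem h1 h2
      rw [op_inr] at h3
      rw [h3] at h4
      simpa using h4
  have hpp : ∀ (a b : Fin g) (r : R), x (.inl a) (.inl b) r ∈ N := fun a b r =>
    hU (mem_unip (by simp [Root]) (by
      have p : ∀ a : Fin g, (0 : ℤ) < 5 ^ a.val := fun a => by positivity
      have := p a; have := p b
      simp only [hgt, Sum.elim_inl]; omega) r)
  have hpm : ∀ (a b : Fin g) (r : R), a ≠ b → x (.inl a) (.inr b) r ∈ N := by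
    intro a b r hab
    obtain h' | h' := lt_or_gt_of_ne hab
    · rw [Fin.lt_def] at h'
      exact hlt (b.val - a.val - 1) a b r (by omega)
    · refine hU (mem_unip (fun e => hab ?_) ?_ r)
      · simpa [eq_comm] using e
      · have := (hgt_lt (a := b) (b := a)).mpr h'
        simp only [hgt, Sum.elim_inl, Sum.elim_inr]; omega
  have hmp : ∀ (a b : Fin g) (r : R), a ≠ b → x (.inr a) (.inl b) r ∈ N := fun a b r hab => by
    rw [L.symm _ (by simpa using hab)]; exact hpm b a r hab.symm
  obtain ⟨o, ho⟩ : ∃ o : Fin g, o.val = 0 := by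
    have := (ab k).isLt
    exact ⟨⟨0, by omega⟩, rfl⟩
  have h0 : ∀ r : R, x (.inr o) (.inr o) r ∈ N := fun r =>
    opp_simple_mem (hS _ _ _ (simple_long o ho)) r
  have hw : w (x (.inl o) (.inl o)) (opp x (.inl o) (.inl o)) 1 ∈ N :=
    mul_mem (mul_mem (hpp o o _) (h0 _)) (hpp o o _)
  have hmo : ∀ (a : Fin g) (r : R), a ≠ o → x (.inr a) (.inr o) r ∈ N := by
    intro a r ha
    have hr : Root (.inr a : Ix g) (.inl o) := root_of_ab (by simpa using ha)
    have := L.equiv (-r) (L.mono_w (root_self (.inl o)) 1) hr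
    rw [reflPerm_of_ne (by simpa using ha) (by simpa using ha), reflPerm_left,
      reflCoeff_of_ne (by simpa using ha) (by simpa using ha), reflCoeff_left] at this
    have h4 := mul_mem (mul_mem hw (hmp a o (-r) ha)) (inv_mem hw)
    rw [this] at h4
    simpa using h4
  have hmm : ∀ (a b : Fin g) (r : R), a ≠ b → x (.inr a) (.inr b) r ∈ N := by
    intro a b r hab
    by_cases hb : b = o
    · subst hb; exact hmo a r hab
    by_cases ha : a = o
    · subst ha; rw [L.symm _ (by simpa using hab)]; exact hmo b r hab.symm
    have h3 := L.r3 (i := .inr a) (j := .inl o) (k := .inr b) r 1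
      (by simpa using ha) (by simpa [eq_comm] using hb) (by simpa using hab)
    have h4 := commutator_mem (hmp a o r ha) (b := x (.inr o) (.inr b) 1)
      (by rw [L.symm _ (by simpa [eq_comm] using hb)]; exact hmo b 1 hb)
    rw [op_inl] at h3
    rw [h3] at h4
    simpa using h4
  have hml : ∀ (a : Fin g) (r : R), x (.inr a) (.inr a) r ∈ N := by
    intro a r
    by_cases ha : a = o
    · subst ha; exact h0 r
    have h3 := L.r5 (i := .inr a) (j := .inl o) 1 r (by simpa using ha)
    have h4 := commutator_mem (hmp a o 1 ha) (h0 r)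
    rw [op_inl] at h3
    rw [h3] at h4
    have h5 := (N.mul_mem_cancel_left (hmo a _ ha)).mp h4
    simpa using h5
  rcases k with a | a <;> rcases l with b | b
  · exact hpp a b r
  · exact hpm a b r fun e => h (by rw [e]; rfl)
  · exact hmp a b r fun e => h (by rw [e]; rfl)
  · by_cases hab : a = b
    · subst hab; exact hml a r
    · exact hmm a b r hab

variable [IsLocalRing R]

/-- The big cell decomposition. -/
theorem Lift.bigCell (hE : ∀ N : Subgroup E, (∀ k l r, Root k l → x k l r ∈ N) → N = ⊤) (z : E) :
    BigCell x z := by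
  let N : Subgroup E :=
    { carrier := {q | ∀ z, (BigCell x z → BigCell x (q * z)) ∧ (BigCell x z → BigCell x (q⁻¹ * z))}
      one_mem' := fun z => by simp
      mul_mem' := fun {a b} ha hb z => ⟨fun hz => by
        rw [mul_assoc]; exact (ha _).1 ((hb _).1 hz), fun hz => by
        rw [_root_.mul_inv_rev, mul_assoc]; exact (hb _).2 ((ha _).2 hz)⟩
      inv_mem' := fun {a} ha z => ⟨(ha z).2, by rw [inv_inv]; exact (ha z).1⟩ }
  have h1 : BigCell x (1 : E) :=
    ⟨1, one_mem _, 1, one_mem _, 1, one_mem _, 1, one_mem _, by simp⟩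
  have hN : N = ⊤ := hE N fun k l r h => L.root_mem (N := N) (fun u hu z =>
    ⟨fun ⟨u1, hu1, k, hk, v, hv, u2, hu2, e⟩ => ⟨u * u1, mul_mem hu hu1, k, hk, v, hv, u2, hu2,
      by rw [e]; group⟩, fun ⟨u1, hu1, k, hk, v, hv, u2, hu2, e⟩ => ⟨u⁻¹ * u1,
      mul_mem (inv_mem hu) hu1, k, hk, v, hv, u2, hu2, by rw [e]; group⟩⟩)
    (fun i j φ hs t z => ⟨fun hz => L.bigCell_step hs hz t, fun hz => by
      rw [← (L.system hs.root).y_neg]; exact L.bigCell_step hs hz (-t)⟩) r h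
  have := ((hN ▸ Subgroup.mem_top z : z ∈ N) 1).1 h1
  rwa [mul_one] at this

end lift

end Symp

namespace Symp

open RankOne

variable {g : ℕ} {R E : Type} [CommRing R] [Group E] {π : E →* Sp g R}
  {x : Ix g → Ix g → R → E}

/-- Unitriangularity with respect to a height function. -/
def Tri (φ : Ix g → ℤ) (c : ℤ) (q : Sp g R) : Prop :=
  ∀ (t : ℤ) (v : Ix g → R), (∀ k, φ k < t → v k = 0) → ∀ k, φ k < t + c → act q v k = v k

theorem Tri.mul {φ : Ix g → ℤ} {c : ℤ} (hc : 0 ≤ c) {q q' : Sp g R} (h : Tri φ c q)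
    (h' : Tri φ c q') : Tri φ c (q * q') := fun t v hv k hk => by
  rw [act_mul, h t _ (fun m hm => by rw [h' t v hv m (by omega), hv m hm]) k hk, h' t v hv k hk]

theorem tri_rt {φ : Ix g → ℤ} (hφ : ∀ i, φ (op i) = -φ i) {c : ℤ} {i j : Ix g} (h : Root i j)
    (hc : c ≤ φ i + φ j) (r : R) : Tri φ c (rt i j r) := fun t v hv k hk => by
  obtain ⟨a, b, hab⟩ := act_rt_root h r
  have e1 := hφ i
  have e2 := hφ j
  rw [hab, om_e_left, om_e_left]
  simp only [Pi.add_apply, Pi.smul_apply, smul_eq_mul, e_apply]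
  have h1 : k = i → v (op j) = 0 := by rintro rfl; exact hv _ (by omega)
  have h2 : k = j → v (op i) = 0 := by rintro rfl; exact hv _ (by omega)
  split_ifs with h3 h4 h4
  · rw [h1 h3, h2 h4]; ring
  · rw [h1 h3]; ring
  · rw [h2 h4]; ring
  · ring

theorem Lift.tri_unip (L : Lift π x) {φ : Ix g → ℤ} (hφ : ∀ i, φ (op i) = -φ i) {c : ℤ}
    (hc : 0 ≤ c) {z : E} (hz : z ∈ unip x φ c) : Tri φ c (π z) := by
  refine Subgroup.closure_induction_left (p := fun z _ => Tri φ c (π z)) ?_ ?_ ?_ hz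
  · rw [map_one]; exact fun t v _ k _ => by rw [act_one]
  · rintro _ ⟨k, l, r, h1, h2, rfl⟩ y _ hy
    rw [map_mul, L.proj r h1]
    exact (tri_rt hφ h1 h2 r).mul hc hy
  · rintro _ ⟨k, l, r, h1, h2, rfl⟩ y _ hy
    have : (x k l r)⁻¹ = x k l (-r) := ((L.system h1).x_neg r).symm
    rw [map_mul, this, L.proj _ h1]
    exact (tri_rt hφ h1 h2 _).mul hc hy

theorem Tri.act_e {φ : Ix g → ℤ} {c : ℤ} {q : Sp g R} (h : Tri φ c q) {k m : Ix g}
    (hk : φ k < φ m + c) : act q (e m) k = (e m : Ix g → R) k :=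
  h (φ m) (e m) (fun k hk => by rw [e_apply, if_neg]; rintro rfl; omega) k hk

/-- Distinct pairs of indices have distinct weights. -/
def Generic (φ : Ix g → ℤ) : Prop := ∀ k l k' l', Root k l → Root k' l' →
  φ k + φ l = φ k' + φ l' → (k = k' ∧ l = l') ∨ (k = l' ∧ l = k')

section lift

variable (L : Lift π x) {φ : Ix g → ℤ} (hφ : ∀ i, φ (op i) = -φ i) (hgen : Generic φ)
include L hφ hgen

theorem Lift.mem_unip_succ {c : ℤ} (hc : 1 ≤ c) {z : E} (hz : z ∈ unip x φ c) (h1 : π z = 1) :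
    z ∈ unip x φ (c + 1) := by
  by_cases he : ∃ k l, Root k l ∧ φ k + φ l = c
  · obtain ⟨k, l, hr, he⟩ := he
    obtain ⟨u, hu, a, rfl⟩ := L.unip_factor (c := c + 1) hφ (by omega) hr (by omega)
      (fun k' l' h h' => by
        by_cases h'' : c + 1 ≤ φ k' + φ l'
        · exact Or.inr (Or.inr h'')
        · have := hgen _ _ _ _ h hr (by omega)
          rw [← or_assoc]
          exact Or.inl this) hz
    have T := L.tri_unip hφ (by omega) hu
    have el := hφ l
    have key : act (rt k l a) (e (op l)) = e (op l) + (a * sg l) • e k := by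
      obtain rfl | h' := hr.cases
      · rw [act_rt_self, om_e_e_op]
      · rw [act_rt_short h', om_e_e_op, om_e_e (root_of_ab (by simpa using h'))]; simp
    have h2 : act (π (u * x k l a)) (e (op l)) k = (e (op l) : Ix g → R) k := by rw [h1, act_one]
    have hne : k ≠ op l := fun e => hr.symm e
    rw [map_mul, L.proj _ hr, act_mul, key, act_add, act_smul, Pi.add_apply, Pi.smul_apply,
      T.act_e (by omega), T.act_e (by omega), e_apply_self, e_apply, if_neg hne] at h2
    have h3 : a = 0 := by
      have := sg_mul_self (R := R) l
      simp only [zero_add, smul_eq_mul, mul_one] at h2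
      linear_combination sg l * h2 - a * this
    rw [h3, (L.system hr).x_zero, mul_one]
    exact hu
  · push Not at he
    exact unip_le (N := unip x φ (c + 1)) (fun k l r h h' => mem_unip h (by
      have := he k l h; omega) r) hz

theorem Lift.unip_injective {z : E} (hz : z ∈ unip x φ 1) (h1 : π z = 1) : z = 1 := by
  have key : ∀ d : ℕ, z ∈ unip x φ (1 + d) := by
    intro d
    induction d with
    | zero => simpa using hz
    | succ d ih =>
      have := L.mem_unip_succ hφ hgen (by omega) ih h1
      rwa [add_assoc] at this
  obtain ⟨B, hB⟩ := (Set.finite_range (fun p : Ix g × Ix g => φ p.1 + φ p.2)).bddAbove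
  have := unip_le (N := ⊥) (fun k l r _ h' => by
    have := hB ⟨(k, l), rfl⟩
    simp only at this
    omega) (key B.toNat)
  simpa using this

end lift

section digits

theorem digits_eq_zero : ∀ (n : ℕ) (d : Fin n → ℤ), (∀ i, |d i| ≤ 4) →
    ∑ i, d i * 5 ^ i.val = 0 → ∀ i, d i = 0
  | 0, _, _, _ => fun i => i.elim0
  | n + 1, d, hd, h => by
    rw [Fin.sum_univ_succ] at h
    simp only [Fin.val_zero, pow_zero, mul_one, Fin.val_succ, pow_succ] at h
    simp only [← mul_assoc] at h
    rw [← Finset.sum_mul] at h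
    have h0 := abs_le.mp (hd 0)
    have h1 : d 0 = 0 := by omega
    have ih := digits_eq_zero n (fun i => d i.succ) (fun i => hd _) (by omega)
    exact Fin.cases h1 ih

/-- The coordinates of an index. -/
def eps (k : Ix g) (b : Fin g) : ℤ := if ab k = b then sg k else 0

theorem hgt_eq_sum (k : Ix g) : hgt k = ∑ b, eps k b * 5 ^ b.val := by
  simp only [eps, ite_mul, zero_mul, Finset.sum_ite_eq, Finset.mem_univ, if_true]
  cases k <;> simp [hgt]

theorem sg_int (k : Ix g) : (sg k : ℤ) = 1 ∨ (sg k : ℤ) = -1 := by cases k <;> simp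

theorem abs_eps_le (k : Ix g) (b : Fin g) : |eps k b| ≤ 1 := by
  rw [eps]; split_ifs
  · obtain h | h := sg_int k <;> simp [h]
  · simp

theorem eps_self (k : Ix g) : eps k (ab k) = sg k := if_pos rfl

theorem eps_of_ne {k m : Ix g} (h : m ≠ k) : eps m (ab k) = 0 ∨ eps m (ab k) = -sg k := by
  rw [eps]; split_ifs with h'
  · obtain rfl | rfl := ab_eq_iff.mp h'
    · exact absurd rfl h
    · simp
  · simp

theorem eps_of_ne_op {k m : Ix g} (h : m ≠ op k) : eps m (ab k) = 0 ∨ eps m (ab k) = sg k := by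
  have := eps_of_ne h
  simpa using this

theorem generic_hgt : Generic (hgt : Ix g → ℤ) := by
  intro k l k' l' h h' heq
  have key := digits_eq_zero g (fun b => eps k b + eps l b - eps k' b - eps l' b)
    (fun b => by
      have h1 := abs_le.mp (abs_eps_le k b)
      have h2 := abs_le.mp (abs_eps_le l b)
      have h3 := abs_le.mp (abs_eps_le k' b)
      have h4 := abs_le.mp (abs_eps_le l' b)
      rw [abs_le]; constructor <;> linarith)
    (by
      simp only [sub_mul, add_mul, Finset.sum_sub_distrib, Finset.sum_add_distrib, ← hgt_eq_sum]
      omega)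
  have hk : k = k' ∨ k = l' := by
    by_contra! hn
    have h1 := key (ab k)
    have h2 := eps_of_ne hn.1.symm
    have h3 := eps_of_ne hn.2.symm
    have h4 := eps_of_ne_op h
    have h5 := sg_int k
    have h6 := eps_self k
    omega
  have hl : ∀ m, eps l (ab l) = eps m (ab l) → l = m := by
    intro m hm
    by_contra hn
    have h2 := eps_of_ne (Ne.symm hn)
    have h5 := sg_int l
    have h6 := eps_self l
    omega
  obtain rfl | rfl := hk
  · exact Or.inl ⟨rfl, hl _ (by have := key (ab l); omega)⟩
  · exact Or.inr ⟨rfl, hl _ (by have := key (ab l); omega)⟩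

end digits

theorem generic_neg {φ : Ix g → ℤ} (h : Generic φ) : Generic fun i => -φ i :=
  fun k l k' l' h1 h2 h3 => h k l k' l' h1 h2 (by simp only at h3; omega)

/-- The kernel of a lift lies in the torus. -/
theorem Lift.ker_le_tor [IsLocalRing R] (L : Lift π x) (hc : CentralKer π)
    (hE : ∀ N : Subgroup E, (∀ k l r, Root k l → x k l r ∈ N) → N = ⊤) {z : E} (hz : π z = 1) :
    z ∈ tor x := by
  obtain ⟨u, hu, k, hk, v, hv, u', hu', rfl⟩ := L.bigCell hE z
  have h0 := conj_of_commute (hc _ hz u').symm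
  have h1 : u * k * v * u' = (u' * u) * k * v := by rw [← h0]; group
  rw [h1] at hz ⊢
  have hU := mul_mem hu' hu
  set U := u' * u
  have hodd' : ∀ k : Ix g, (fun i => -hgt i) (op k) = -(fun i => -hgt i) k := fun k => by
    simp only [hgt_op]
  have hT := L.tri_unip hgt_op zero_le_one hU
  have hT' := L.tri_unip hodd' zero_le_one (inv_mem hv)
  obtain ⟨c, hd⟩ := L.tor_le (inv_mem hk)
  have e1 : π U = π v⁻¹ * π k⁻¹ := by
    rw [map_mul, map_mul] at hz
    rw [map_inv, map_inv, ← _root_.mul_inv_rev, eq_inv_iff_mul_eq_one, ← mul_assoc, hz]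
  have e2 : ∀ m, act (π U) (e m) = c m • act (π v⁻¹) (e m) := fun m => by
    rw [e1, act_mul, hd.act, act_smul]; rfl
  have e3 : π U = 1 := by
    refine ext_e fun m => ?_
    rw [act_one]
    funext k
    by_cases hkm : hgt k < hgt m + 1
    · exact hT.act_e hkm
    · rw [e2, Pi.smul_apply, hT'.act_e (by omega), e_apply, if_neg, smul_zero]
      rintro rfl; omega
  have e4 : ∀ m, c m = 1 := fun m => by
    have := congrFun (e2 m) m
    rw [e3, act_one, Pi.smul_apply, hT'.act_e (by omega), e_apply_self] at this
    simpa using this.symm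
  have e5 : π v⁻¹ = 1 := ext_e fun m => by
    have := e2 m
    rw [e3, e4, one_smul] at this
    exact this.symm
  have e6 := L.unip_injective hgt_op generic_hgt hU e3
  have e7 := L.unip_injective hodd' (generic_neg generic_hgt) (inv_mem hv) e5
  rw [e6, inv_eq_one.mp e7]
  simpa using hk

end Symp

namespace Symp

open RankOne

variable {g : ℕ} {R E : Type} [CommRing R] [Group E] {π : E →* Sp g R}
  {x : Ix g → Ix g → R → E}

/-- The group generated by the symbols at a given index. -/
def symGroup (x : Ix g → Ix g → R → E) (i : Ix g) : Subgroup E :=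
  Subgroup.closure {z | ∃ u v, z = sym (x i i) (opp x i i) u v}

theorem Lift.symGroup_eq (L : Lift π x) (hc : CentralKer π) (a b : Fin g) :
    symGroup x (Sum.inl a) = symGroup x (Sum.inl b) := by
  by_cases hab : a = b
  · rw [hab]
  · simp only [symGroup, L.sym_eq hc (show ab (Sum.inl a : Ix g) ≠ ab (Sum.inl b) from hab)]

theorem Lift.symGroup_normal (L : Lift π x) (hc : CentralKer π) (i : Ix g) :
    (symGroup x i).Normal := by
  have hle : symGroup x i ≤ π.ker := by
    rw [symGroup, Subgroup.closure_le]
    rintro _ ⟨u, v, rfl⟩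
    exact L.map_sym i u v
  exact ⟨fun z hz q => by rwa [conj_of_commute (hc z (hle hz) q).symm]⟩

theorem Lift.ker_le_symGroup [IsLocalRing R] (L : Lift π x) (hc : CentralKer π)
    (hE : ∀ N : Subgroup E, (∀ k l r, Root k l → x k l r ∈ N) → N = ⊤) (b : Fin g) :
    π.ker ≤ symGroup x (Sum.inl b) := by
  intro z hz
  have hzt := L.ker_le_tor hc hE hz
  have hn := L.symGroup_normal hc (Sum.inl b)
  set C := symGroup x (Sum.inl b) with hC
  let q := QuotientGroup.mk' C
  let ϕ : ∀ _ : Fin g, Rˣ →* E ⧸ C := fun a => MonoidHom.mk' (fun u => q (hel x (Sum.inl a) u))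
    fun u v => by
      rw [← map_mul, eq_comm]
      refine QuotientGroup.eq.mpr ?_
      have h1 : sym (x (Sum.inl a) (Sum.inl a)) (opp x (Sum.inl a) (Sum.inl a)) u v ∈ C := by
        rw [hC, L.symGroup_eq hc b a]
        exact Subgroup.subset_closure ⟨u, v, rfl⟩
      have h2 := hn.conj_mem _ (inv_mem h1) (hel x (Sum.inl a) u * hel x (Sum.inl a) v)⁻¹
      convert h2 using 1
      simp only [sym, hel]
      group
  have hcomm : Pairwise fun a a' => ∀ u v, Commute (ϕ a u) (ϕ a' v) := fun a a' haa u v =>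
    (L.commute_hel (i := Sum.inl a) (j := Sum.inl a') haa u v).map q
  let Ψ := MonoidHom.noncommPiCoprod ϕ hcomm
  have hs : ∀ a t, Ψ (Pi.mulSingle a t) = q (hel x (Sum.inl a) t) := fun a t =>
    MonoidHom.noncommPiCoprod_mulSingle _ _ _
  have hmono : ∀ u : Fin g → Rˣ, ∃ z' : E, q z' = Ψ u ∧
      ∀ a, act (π z') (e (Sum.inl a)) = (u a : R) • e (Sum.inl a) := by
    intro u
    refine Pi.mulSingle_induction (p := fun u : Fin g → Rˣ => ∃ z' : E, q z' = Ψ u ∧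
      ∀ a, act (π z') (e (Sum.inl a)) = (u a : R) • e (Sum.inl a)) u ?_ ?_ ?_
    · exact ⟨1, by simp, by simp⟩
    · rintro u v ⟨z1, h1, h2⟩ ⟨z2, h3, h4⟩
      refine ⟨z1 * z2, by rw [map_mul, map_mul, h1, h3], fun a => ?_⟩
      rw [map_mul, act_mul, h4, act_smul, h2, smul_smul, Pi.mul_apply, Units.val_mul, mul_comm]
    · intro a t
      refine ⟨hel x (Sum.inl a) t, (hs a t).symm, fun c => ?_⟩
      rw [(L.mono_hel (Sum.inl a) t).act]
      by_cases hac : c = a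
      · rw [hac, torusCoeff_self, Pi.mulSingle_eq_same]; rfl
      · rw [torusCoeff_of_ne (by simpa using hac), Pi.mulSingle_eq_of_ne hac]; simp
  have hle : tor x ≤ Ψ.range.comap q := by
    rw [tor, Subgroup.closure_le]
    rintro _ ⟨i, u, rfl⟩
    obtain a | a := i
    · exact ⟨Pi.mulSingle a u, hs a u⟩
    · refine ⟨Pi.mulSingle a u⁻¹, (hs a u⁻¹).trans ?_⟩
      rw [← op_inl, L.hel_op]
  obtain ⟨u, hu⟩ := hle hzt
  obtain ⟨z', hz', ha⟩ := hmono u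
  have hCk : ∀ c ∈ C, π c = 1 := by
    intro c hc'
    have hle' : C ≤ π.ker := by
      rw [hC, symGroup, Subgroup.closure_le]
      rintro _ ⟨u, v, rfl⟩
      exact L.map_sym _ u v
    exact hle' hc'
  have hπ : π z' = 1 := by
    have := hCk _ (QuotientGroup.eq.mp (hz'.trans hu))
    rwa [map_mul, show π z = 1 from hz, mul_one, map_inv, inv_eq_one] at this
  have hu1 : u = 1 := by
    funext a
    have := congrFun (ha a) (Sum.inl a)
    rw [hπ, act_one, Pi.smul_apply, e_apply_self] at this
    exact Units.ext (by simpa using this.symm)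
  rw [hu1, map_one] at hu
  exact (QuotientGroup.eq_one_iff z).mp hu.symm

theorem Lift.sym_mem_center (L : Lift π x) (hc : CentralKer π) (i : Ix g) (u v : Rˣ) :
    sym (x i i) (opp x i i) u v ∈ Subgroup.center E :=
  Subgroup.mem_center_iff.mpr fun z => ((hc _ (L.map_sym i u v) z).symm).eq

end Symp

namespace Symp

open RankOne

section elementary

variable {g : ℕ} {R : Type} [CommRing R]

/-- The elementary symplectic group. -/
def El (g : ℕ) (R : Type) [CommRing R] : Subgroup (Sp g R) :=
  Subgroup.closure {z | ∃ i j r, Root i j ∧ z = rt i j r}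

theorem rt_mem_El {i j : Ix g} (h : Root i j) (r : R) : rt i j r ∈ El g R :=
  Subgroup.subset_closure ⟨i, j, r, h, rfl⟩

theorem X_e_smul (i k : Ix g) (h : Root i k) (r : R) : X (e i) (r • e k) 0 ∈ El g R := by
  obtain rfl | h' := h.cases
  · have : X (e i) (r • e i) 0 = rt i i (2 * r) := ext_act fun w => by
      rw [act_rt_self, act_X (by simp)]
      simp only [map_smul, LinearMap.smul_apply, smul_eq_mul]
      module
    rw [this]
    exact rt_mem_El (root_self i) _
  · rw [← rt_short h']; exact rt_mem_El h _

theorem X_mem_El (i : Ix g) {w : Ix g → R} (hw : om (e i) w = 0) (a : R) :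
    X (e i) w a ∈ El g R := by
  have hk : ∀ k, om (e i) (w k • e k) = (0 : R) := fun k => by
    by_cases h : Root i k
    · rw [map_smul, om_e_e h, smul_zero]
    · obtain rfl : k = op i := not_not.mp h
      rw [om_e_left] at hw
      have : w (op i) = 0 := by
        have := congrArg (sg i * ·) hw
        simpa [← mul_assoc] using this
      rw [this]; simp
  have key : ∀ (s : Finset (Ix g)) (a : R), X (e i) (∑ k ∈ s, w k • e k) a ∈ El g R := by
    intro s
    induction s using Finset.induction_on with
    | empty => intro a; rw [Finset.sum_empty, ← rt_self]; exact rt_mem_El (root_self i) a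
    | insert k s hks ih =>
      intro a
      have hs : om (e i) (∑ k ∈ s, w k • e k) = (0 : R) := by
        rw [map_sum]; exact Finset.sum_eq_zero fun k _ => hk k
      rw [Finset.sum_insert hks]
      have := X_mul (hk k) hs 0 (a - om (w k • e k) (∑ k ∈ s, w k • e k))
      rw [zero_add, sub_add_cancel] at this
      rw [← this]
      refine mul_mem ?_ (ih _)
      by_cases h : Root i k
      · exact X_e_smul i k h _
      · obtain rfl : k = op i := not_not.mp h
        have h0 := hk (op i)
        rw [map_smul, om_e_e_op, smul_eq_mul] at h0
        have : w (op i) = 0 := by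
          have := congrArg (· * sg i) h0
          simpa [mul_assoc] using this
        rw [this, zero_smul, X_zero]
        exact one_mem _
  rw [vec_eq_sum w]
  exact key _ a

/-- The elementary elements fixing the basis vectors past a given index. -/
def ElFix (g : ℕ) (R : Type) [CommRing R] (n : ℕ) : Subgroup (Sp g R) where
  carrier := {z | z ∈ El g R ∧ ∀ k : Ix g, n ≤ (ab k).val → act z (e k) = e k}
  one_mem' := ⟨one_mem _, by simp⟩
  mul_mem' := fun ⟨h1, h2⟩ ⟨h3, h4⟩ => ⟨mul_mem h1 h3, fun k hk => by
    rw [act_mul, h4 k hk, h2 k hk]⟩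
  inv_mem' := fun ⟨h1, h2⟩ => ⟨inv_mem h1, fun k hk => by
    conv_lhs => rw [← h2 k hk]
    rw [act_inv_act]⟩

theorem X_mem_ElFix {n : ℕ} (i : Ix g) {w : Ix g → R} (hi : (ab i).val < n)
    (hw : om (e i) w = 0) (hn : ∀ k : Ix g, n ≤ (ab k).val → w k = 0) (a : R) :
    X (e i) w a ∈ ElFix g R n := by
  refine ⟨X_mem_El i hw a, fun k hk => ?_⟩
  have hik : Root i k := root_of_ab fun h => by rw [h] at hi; omega
  rw [act_X hw, om_e_right, om_e_e hik, hn _ (by simpa using hk)]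
  simp

theorem rt_mem_ElFix {n : ℕ} {i j : Ix g} (hi : (ab i).val < n) (hj : (ab j).val < n)
    (h : Root i j) (r : R) : rt i j r ∈ ElFix g R n := by
  refine ⟨rt_mem_El h r, fun k hk => ?_⟩
  have hik : Root i k := root_of_ab fun h => by rw [h] at hi; omega
  have hjk : Root j k := root_of_ab fun h => by rw [h] at hj; omega
  obtain ⟨s, t, hst⟩ := act_rt_root h r
  rw [hst, om_e_e hik, om_e_e hjk]
  simp

variable [IsLocalRing R]

theorem exists_unit_apply {v z : Ix g → R} (h : om v z = 1) : ∃ k, IsUnit (v k) := by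
  by_contra! hn
  have : om v z ∈ IsLocalRing.maximalIdeal R := by
    rw [om_apply]
    refine Ideal.sum_mem _ fun k _ => Ideal.mul_mem_right _ _ (Ideal.mul_mem_left _ _ ?_)
    exact (IsLocalRing.mem_maximalIdeal _).mpr (hn k)
  rw [h] at this
  exact (IsLocalRing.mem_maximalIdeal _).mp this isUnit_one

theorem exists_apply_eq_one {n : ℕ} {i : Ix g} (hi : (ab i).val < n) {v : Ix g → R}
    (h : ∃ k, IsUnit (v k)) (hn : ∀ k : Ix g, n ≤ (ab k).val → v k = 0) :
    ∃ B ∈ ElFix g R n, act B v i = 1 := by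
  have self : ∀ i : Ix g, (ab i).val < n → ∀ v : Ix g → R, IsUnit (v (op i)) →
      ∃ B ∈ ElFix g R n, act B v i = 1 := by
    rintro i hi v ⟨u, hu⟩
    refine ⟨rt i i (sg i * ↑u⁻¹ * (1 - v i)), rt_mem_ElFix hi hi (root_self i) _, ?_⟩
    rw [act_rt_self, om_e_left, ← hu]
    simp only [Pi.add_apply, Pi.smul_apply, e_apply_self, smul_eq_mul]
    have h1 := u.inv_mul
    have h2 := sg_mul_self (R := R) i
    linear_combination (1 - v i) * (sg i * sg i * h1 + h2)
  obtain ⟨k, hk⟩ := h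
  have hkn : (ab k).val < n := by
    by_contra hkn
    rw [hn k (by omega)] at hk
    exact not_isUnit_zero hk
  by_cases h1 : k = op i
  · rw [h1] at hk
    exact self i hi v hk
  · by_cases h2 : k = i
    · obtain ⟨B, hB, hB1⟩ := self (op i) (by simpa using hi) v (by rwa [op_op, ← h2])
      obtain ⟨B', hB', hB1'⟩ := self i hi (act B v) (by rw [hB1]; exact isUnit_one)
      exact ⟨B' * B, mul_mem hB' hB, by rw [act_mul, hB1']⟩
    · have hab : ab i ≠ ab (op k) := by
        rw [ab_op]
        exact fun h => (ab_eq_iff.mp h).elim (fun h => h2 h.symm) h1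
      obtain ⟨u, hu⟩ := hk
      refine ⟨rt i (op k) (sg (op k) * ↑u⁻¹ * (1 - v i)),
        rt_mem_ElFix hi (by simpa using hkn) (root_of_ab hab) _, ?_⟩
      rw [act_rt_short hab, om_e_left, op_op, ← hu]
      simp only [Pi.add_apply, Pi.smul_apply, e_apply_self, smul_eq_mul,
        e_apply, if_neg (ne_of_ab hab)]
      have h1 := u.inv_mul
      have h2 := sg_mul_self (R := R) (op k)
      linear_combination (1 - v i) * (sg (op k) * sg (op k) * h1 + h2)

omit [IsLocalRing R] in
theorem apply_eq_zero_of_om {v : Ix g → R} {k : Ix g} (h : om (e (op k)) v = 0) : v k = 0 := by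
  rw [om_e_left, op_op] at h
  have := congrArg (sg (op k) * ·) h
  simpa only [← mul_assoc, sg_mul_self, one_mul, mul_zero] using this

theorem mem_El_of_fix : ∀ (n : ℕ) (A : Sp g R),
    (∀ k : Ix g, n ≤ (ab k).val → act A (e k) = e k) → A ∈ El g R
  | 0, A, h => by
    have : A = 1 := ext_e fun i => by rw [h i (Nat.zero_le _), act_one]
    rw [this]; exact one_mem _
  | n + 1, A, h => by
    by_cases hng : n < g
    swap
    · exact mem_El_of_fix n A fun k hk => absurd (ab k).2 (by omega)
    set i : Ix g := Sum.inl ⟨n, hng⟩ with hi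
    have hin : (ab i).val < n + 1 := Nat.lt_succ_self n
    have horth : ∀ (B : Sp g R), B ∈ ElFix g R (n + 1) → ∀ j : Ix g, (ab j).val < n + 1 →
        ∀ k : Ix g, n + 1 ≤ (ab k).val → act (B * A) (e j) k = 0 := by
      intro B hB j hj k hk
      refine apply_eq_zero_of_om ?_
      have h1 : act (B * A) (e (op k)) = e (op k) := by
        rw [act_mul, h _ (by simpa using hk), hB.2 _ (by simpa using hk)]
      rw [← h1, om_act]
      exact om_e_e (root_of_ab fun h => by rw [ab_op] at h; rw [h] at hk; omega)
    have hpair : ∀ B : Sp g R, om (act (B * A) (e i)) (act (B * A) (e (op i))) = 1 := fun B => by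
      rw [om_act, om_e_e_op]; rfl
    obtain ⟨B₁, hB₁, h1⟩ := exists_apply_eq_one hin (v := act A (e i))
      (exists_unit_apply (by have := hpair 1; rwa [one_mul] at this))
      (by have := horth 1 (one_mem _) i hin; rwa [one_mul] at this)
    have h0 := horth B₁ hB₁ i hin
    have hp := hpair B₁
    rw [← act_mul] at h1
    set v := act (B₁ * A) (e i) with hv
    let w := v - e i - v (op i) • e (op i)
    have hw : om (e (op i)) w = 0 := by
      rw [om_e_left, op_op]
      simp [w, h1, e_apply]
    have hwn : ∀ k : Ix g, n + 1 ≤ (ab k).val → w k = 0 := fun k hk => by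
      have e1 : k ≠ i := fun h => by rw [h] at hk; omega
      have e2 : k ≠ op i := fun h => by rw [h, ab_op] at hk; omega
      simp [w, h0 k hk, e_apply, e1, e2]
    have hB₂ := X_mem_ElFix (op i) (by simpa using hin) hw hwn (v (op i) + om w v)
    set B₂ := X (e (op i)) w (v (op i) + om w v)
    have h2 : act (B₂ * B₁ * A) (e i) = e i := by
      rw [mul_assoc, act_mul, ← hv, act_X hw, om_e_left, op_op, h1]
      simp only [w, hi, op_inl, sg_inr]
      module
    have hB := mul_mem hB₂ hB₁
    have h3 := horth _ hB (op i) (by simpa using hin)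
    have hz : om (e i) (act (B₂ * B₁ * A) (e (op i))) = 1 := by
      rw [← hpair (B₂ * B₁), h2]
    set z := act (B₂ * B₁ * A) (e (op i)) with hzd
    have hz1 : z (op i) = 1 := by
      rw [om_e_left, hi, sg_inl, one_mul] at hz; exact hz
    let y := -(z - e (op i) - z i • e i)
    have hy : om (e i) y = 0 := by
      rw [om_e_left]
      simp [y, hz1, e_apply]
    have hyn : ∀ k : Ix g, n + 1 ≤ (ab k).val → y k = 0 := fun k hk => by
      have e1 : k ≠ i := fun h => by rw [h] at hk; omega
      have e2 : k ≠ op i := fun h => by rw [h, ab_op] at hk; omega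
      simp [y, h3 k hk, e_apply, e1, e2]
    have hB₃ := X_mem_ElFix i hin hy hyn (-(z i + om y z))
    set B₃ := X (e i) y (-(z i + om y z))
    have h4 : act B₃ z = e (op i) := by
      rw [act_X hy, hz]
      simp only [y]
      module
    have h5 : act B₃ (e i) = e i := by
      rw [act_X hy, om_self, om_swap, hy]
      simp
    have hB' := mul_mem hB₃ hB
    have hfin : B₃ * (B₂ * B₁) * A ∈ El g R := by
      refine mem_El_of_fix n _ fun k hk => ?_
      by_cases hk1 : n + 1 ≤ (ab k).val
      · rw [act_mul, h k hk1, hB'.2 k hk1]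
      · have : ab k = ab i := Fin.ext (by simp only [hi, ab_inl]; omega)
        obtain rfl | h6 := ab_eq_iff.mp this.symm
        · rw [mul_assoc, act_mul, h2, h5]
        · rw [h6, mul_assoc, act_mul, ← hzd, h4]
    exact (Subgroup.mul_mem_cancel_left _ hB'.1).mp hfin

theorem El_eq_top : El g R = ⊤ :=
  (Subgroup.eq_top_iff' _).mpr fun A => mem_El_of_fix g A fun k hk => absurd (ab k).2 (by omega)

end elementary

end Symp

namespace Symp

open RankOne
open scoped commutatorElement

section perfect

variable {g : ℕ} {R E : Type} [CommRing R] [Group E] {x : Ix g → Ix g → R → E}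

theorem Stb.mem_commutator (hg : 4 ≤ g) (S : Stb x) {N : Subgroup E}
    (hN : ∀ i j r, Root i j → x i j r ∈ N) {i j : Ix g} (h : Root i j) (r : R) :
    x i j r ∈ ⁅N, N⁆ := by
  have short : ∀ {i j : Ix g} (r : R), ab i ≠ ab j → x i j r ∈ ⁅N, N⁆ := by
    intro i j r h
    obtain ⟨m, h1, h2, -⟩ := exists_far hg (ab i) (ab j) (ab j)
    have h3 : Root (op m) j := root_of_ab (by rwa [ab_op])
    have := S.r3 r (sg m) h1.symm h2 h
    rw [mul_right_comm, sg_mul_self, one_mul] at this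
    rw [← this]
    exact Subgroup.commutator_mem_commutator (hN _ _ _ (root_of_ab h1.symm)) (hN _ _ _ h3)
  obtain rfl | h' := h.cases
  · obtain ⟨m, h1, -⟩ := exists_far hg (ab i) (ab i) (ab i)
    have := S.r5 1 r h1.symm
    rw [one_pow, one_mul] at this
    refine (Subgroup.mul_mem_cancel_left _ (short _ ?_)).mp (this ▸
      Subgroup.commutator_mem_commutator (hN _ _ _ (root_of_ab h1.symm)) (hN _ _ _ (root_self _)))
    simpa using h1.symm
  · exact short r h'

theorem commutator_El (hg : 4 ≤ g) (R : Type) [CommRing R] : commutator (El g R) = ⊤ := by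
  have h1 : El g R ≤ ⁅El g R, El g R⁆ := by
    conv_lhs => rw [El]
    rw [Subgroup.closure_le]
    rintro _ ⟨i, j, r, h, rfl⟩
    exact stb_rt.mem_commutator hg (fun i j r h => rt_mem_El h r) h r
  rw [← Subgroup.map_subtype_commutator] at h1
  rw [Subgroup.eq_top_iff']
  intro z
  obtain ⟨z', h2, h3⟩ := h1 z.2
  rwa [← Subtype.ext h3]

theorem commutator_Sp (hg : 4 ≤ g) (R : Type) [CommRing R] [IsLocalRing R] :
    commutator (Sp g R) = ⊤ := by
  rw [Subgroup.eq_top_iff']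
  intro z
  have hz : z ∈ El g R := by rw [El_eq_top]; trivial
  have := commutator_El hg R
  have h1 : (⟨z, hz⟩ : El g R) ∈ commutator (El g R) := by rw [this]; trivial
  have h2 : z ∈ (commutator (El g R)).map (El g R).subtype := ⟨_, h1, rfl⟩
  rw [Subgroup.map_subtype_commutator] at h2
  exact Subgroup.commutator_mono le_top le_top h2

end perfect

section kernel

variable {g : ℕ} {R E : Type} [CommRing R] [Group E] {π : E →* Sp g R}
  {x : Ix g → Ix g → R → E}

theorem Lift.generate [IsLocalRing R] (L : Lift π x) (hc : CentralKer π)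
    (hE : commutator E = ⊤) (N : Subgroup E) (hN : ∀ k l r, Root k l → x k l r ∈ N) : N = ⊤ := by
  have hmap : N.map π = ⊤ := by
    rw [eq_top_iff, ← El_eq_top, El, Subgroup.closure_le]
    rintro _ ⟨i, j, r, h, rfl⟩
    exact ⟨_, hN i j r h, L.proj r h⟩
  have hfac : ∀ z : E, ∃ n ∈ N, π n = π z := fun z => by
    have : π z ∈ N.map π := by rw [hmap]; trivial
    exact this
  rw [eq_top_iff, ← hE, commutator_def, Subgroup.commutator_le]
  intro a _ b _
  obtain ⟨a', ha, ha'⟩ := hfac a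
  obtain ⟨b', hb, hb'⟩ := hfac b
  rw [← hc.comm_congr ha' hb']
  exact commutator_mem ha hb

end kernel

end Symp

namespace Symp

open RankOne
open scoped commutatorElement

/-- A perfect group without nontrivial perfect central extensions. -/
structure SuperPerfect (Q : Type) [Group Q] : Prop where
  perfect : commutator Q = ⊤
  ker : ∀ (E : Type) [Group E] (π : E →* Q), Function.Surjective π → CentralKer π →
    commutator E = ⊤ → ∀ z, π z = 1 → z = 1

/-- A perfect group all of whose perfect central extensions have degree at most two. -/
structure AlmostSuperPerfect (Q : Type) [Group Q] : Prop where
  perfect : commutator Q = ⊤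
  ker : ∀ (E : Type) [Group E] (π : E →* Q), Function.Surjective π → CentralKer π →
    commutator E = ⊤ → ∃ p : E, p * p = 1 ∧ ∀ z, π z = 1 → z = 1 ∨ z = p

section product

theorem commutator_eq_top_of_le {E : Type} [Group E] {D : Subgroup E} (h : D ≤ ⁅D, D⁆) :
    commutator D = ⊤ := by
  rw [← Subgroup.map_subtype_commutator] at h
  rw [Subgroup.eq_top_iff']
  intro z
  obtain ⟨z', h2, h3⟩ := h z.2
  rwa [← Subtype.ext h3]

variable {E Q₁ Q₂ : Type} [Group E] [Group Q₁] [Group Q₂]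

/-- The perfect subgroup lying over a direct factor. -/
def lying (f : E →* Q₂) : Subgroup E := ⁅f.ker, f.ker⁆

theorem lying_le (f : E →* Q₂) : lying f ≤ f.ker := Subgroup.commutator_le_left _ _

instance lying_normal (f : E →* Q₂) : (lying f).Normal := by
  unfold lying; infer_instance

variable {f₁ : E →* Q₁} {f₂ : E →* Q₂}

theorem lying_surjective (hQ : commutator Q₁ = ⊤) (hs : ∀ q, ∃ z, f₁ z = q ∧ f₂ z = 1) (q : Q₁) :
    ∃ z ∈ lying f₂, f₁ z = q := by
  have h1 : f₂.ker.map f₁ = ⊤ := (Subgroup.eq_top_iff' _).mpr fun q => by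
    obtain ⟨z, h1, h2⟩ := hs q
    exact ⟨z, h2, h1⟩
  have h2 : (lying f₂).map f₁ = ⊤ := by
    rw [lying, Subgroup.map_commutator, h1, ← commutator_def, hQ]
  have : q ∈ (lying f₂).map f₁ := by rw [h2]; trivial
  exact this

theorem lying_perfect (hc : CentralKer (f₁.prod f₂)) (hQ : commutator Q₁ = ⊤)
    (hs : ∀ q, ∃ z, f₁ z = q ∧ f₂ z = 1) : commutator (lying f₂) = ⊤ := by
  apply commutator_eq_top_of_le
  conv_lhs => rw [lying]
  rw [Subgroup.commutator_le]
  intro a ha b hb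
  have key : ∀ a ∈ f₂.ker, ∃ d ∈ lying f₂, f₁.prod f₂ a = f₁.prod f₂ d := fun a ha => by
    obtain ⟨d, hd, h1⟩ := lying_surjective hQ hs (f₁ a)
    refine ⟨d, hd, Prod.ext h1.symm ?_⟩
    have : f₂ d = 1 := lying_le f₂ hd
    exact (show f₂ a = 1 from ha).trans this.symm
  obtain ⟨a', ha', h1⟩ := key a ha
  obtain ⟨b', hb', h2⟩ := key b hb
  rw [hc.comm_congr h1 h2]
  exact Subgroup.commutator_mem_commutator ha' hb'

theorem lying_central (hc : CentralKer (f₁.prod f₂)) :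
    CentralKer (f₁.comp (lying f₂).subtype) := fun z hz a => by
  have h2 : f₂ z = 1 := lying_le f₂ z.2
  exact Subtype.ext (hc z (Prod.ext hz h2) a).eq

theorem exists_lying_mul (hE : commutator E = ⊤) (hc : CentralKer (f₁.prod f₂))
    (hQ₁ : commutator Q₁ = ⊤) (hs₁ : ∀ q, ∃ z, f₁ z = q ∧ f₂ z = 1)
    (hQ₂ : commutator Q₂ = ⊤) (hs₂ : ∀ q, ∃ z, f₂ z = q ∧ f₁ z = 1)
    (z : E) : ∃ a ∈ lying f₂, ∃ b ∈ lying f₁, a * b = z := by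
  have h : ∀ z, ∃ n ∈ lying f₂ ⊔ lying f₁, f₁.prod f₂ z = f₁.prod f₂ n := fun z => by
    obtain ⟨a, ha, h1⟩ := lying_surjective hQ₁ hs₁ (f₁ z)
    obtain ⟨b, hb, h2⟩ := lying_surjective hQ₂ hs₂ (f₂ z)
    have h3 : f₂ a = 1 := lying_le f₂ ha
    have h4 : f₁ b = 1 := lying_le f₁ hb
    exact ⟨a * b, mul_mem (Subgroup.mem_sup_left ha) (Subgroup.mem_sup_right hb),
      Prod.ext (by simp [h1, h4]) (by simp [h2, h3])⟩
  have htop : (⊤ : Subgroup E) ≤ lying f₂ ⊔ lying f₁ := by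
    rw [← hE, commutator_def, Subgroup.commutator_le]
    intro a _ b _
    obtain ⟨a', ha, ha'⟩ := h a
    obtain ⟨b', hb, hb'⟩ := h b
    rw [hc.comm_congr ha' hb']
    exact commutator_mem ha hb
  exact Subgroup.mem_sup_of_normal_left.mp (htop (Subgroup.mem_top z))

theorem commutator_prod (h₁ : commutator Q₁ = ⊤) (h₂ : commutator Q₂ = ⊤) :
    commutator (Q₁ × Q₂) = ⊤ := by
  rw [commutator_def, ← Subgroup.top_prod_top, Subgroup.commutator_prod_prod, ← commutator_def,
    ← commutator_def, h₁, h₂]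

theorem SuperPerfect.split (H₁ : SuperPerfect Q₁) (hQ₂ : commutator Q₂ = ⊤)
    {π : E →* Q₁ × Q₂} (hπ : Function.Surjective π) (hc : CentralKer π) (hE : commutator E = ⊤) :
    ∃ (D : Subgroup E) (f : D →* Q₂), Function.Surjective f ∧ CentralKer f ∧ commutator D = ⊤ ∧
      ∀ z, π z = 1 → ∃ d : D, f d = 1 ∧ d.1 = z := by
  set f₁ := (MonoidHom.fst Q₁ Q₂).comp π
  set f₂ := (MonoidHom.snd Q₁ Q₂).comp π
  have hc₁ : CentralKer (f₁.prod f₂) := hc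
  have hc₂ : CentralKer (f₂.prod f₁) := fun z hz =>
    hc z (Prod.ext (congrArg Prod.snd hz) (congrArg Prod.fst hz))
  have hs₁ : ∀ q, ∃ z, f₁ z = q ∧ f₂ z = 1 := fun q => by
    obtain ⟨z, hz⟩ := hπ (q, 1)
    exact ⟨z, congrArg Prod.fst hz, congrArg Prod.snd hz⟩
  have hs₂ : ∀ q, ∃ z, f₂ z = q ∧ f₁ z = 1 := fun q => by
    obtain ⟨z, hz⟩ := hπ (1, q)
    exact ⟨z, congrArg Prod.snd hz, congrArg Prod.fst hz⟩
  refine ⟨lying f₁, f₂.comp (lying f₁).subtype, fun q => ?_, lying_central hc₂,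
    lying_perfect hc₂ hQ₂ hs₂, fun z hz => ?_⟩
  · obtain ⟨z, h1, h2⟩ := lying_surjective hQ₂ hs₂ q
    exact ⟨⟨z, h1⟩, h2⟩
  · obtain ⟨a, ha, b, hb, rfl⟩ := exists_lying_mul hE hc₁ H₁.perfect hs₁ hQ₂ hs₂ z
    have h1 : f₁ (a * b) = 1 := congrArg Prod.fst hz
    have h2 : f₂ (a * b) = 1 := congrArg Prod.snd hz
    have h3 : f₂ a = 1 := lying_le f₂ ha
    have h4 : f₁ b = 1 := lying_le f₁ hb
    rw [map_mul, h4, mul_one] at h1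
    rw [map_mul, h3, one_mul] at h2
    have h5 := H₁.ker (lying f₂) (f₁.comp (lying f₂).subtype) (fun q => by
      obtain ⟨z, h1, h2⟩ := lying_surjective H₁.perfect hs₁ q
      exact ⟨⟨z, h1⟩, h2⟩) (lying_central hc₁) (lying_perfect hc₁ H₁.perfect hs₁) ⟨a, ha⟩ h1
    have h6 : a = 1 := congrArg Subtype.val h5
    exact ⟨⟨b, hb⟩, h2, by rw [h6, one_mul]⟩

theorem SuperPerfect.prod (H₁ : SuperPerfect Q₁) (H₂ : SuperPerfect Q₂) :
    SuperPerfect (Q₁ × Q₂) where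
  perfect := commutator_prod H₁.perfect H₂.perfect
  ker E _ π hπ hc hE z hz := by
    obtain ⟨D, f, h1, h2, h3, h4⟩ := H₁.split H₂.perfect hπ hc hE
    obtain ⟨d, hd, rfl⟩ := h4 z hz
    rw [H₂.ker D f h1 h2 h3 d hd]; rfl

theorem SuperPerfect.prod_almost (H₁ : SuperPerfect Q₁) (H₂ : AlmostSuperPerfect Q₂) :
    AlmostSuperPerfect (Q₁ × Q₂) where
  perfect := commutator_prod H₁.perfect H₂.perfect
  ker E _ π hπ hc hE := by
    obtain ⟨D, f, h1, h2, h3, h4⟩ := H₁.split H₂.perfect hπ hc hE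
    obtain ⟨p, hp, hp'⟩ := H₂.ker D f h1 h2 h3
    refine ⟨p, congrArg Subtype.val hp, fun z hz => ?_⟩
    obtain ⟨d, hd, rfl⟩ := h4 z hz
    obtain rfl | rfl := hp' d hd
    · exact Or.inl rfl
    · exact Or.inr rfl

theorem commutator_of_surjective {f : Q₁ →* Q₂} (hf : Function.Surjective f)
    (h : commutator Q₁ = ⊤) : commutator Q₂ = ⊤ := by
  rw [commutator_def, ← Subgroup.map_top_of_surjective f hf, ← Subgroup.map_commutator,
    ← commutator_def, h]

theorem CentralKer.equiv {π : E →* Q₁} (hc : CentralKer π) (i : Q₁ ≃* Q₂) :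
    CentralKer (i.toMonoidHom.comp π) := fun z hz =>
  hc z (i.injective (hz.trans (map_one i).symm))

theorem SuperPerfect.equiv (H : SuperPerfect Q₁) (i : Q₁ ≃* Q₂) : SuperPerfect Q₂ where
  perfect := commutator_of_surjective (f := i.toMonoidHom) i.surjective H.perfect
  ker E _ π hπ hc hE z hz := H.ker E (i.symm.toMonoidHom.comp π) (i.symm.surjective.comp hπ)
    (hc.equiv i.symm) hE z (by simp [hz])

theorem AlmostSuperPerfect.equiv (H : AlmostSuperPerfect Q₁) (i : Q₁ ≃* Q₂) :
    AlmostSuperPerfect Q₂ where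
  perfect := commutator_of_surjective (f := i.toMonoidHom) i.surjective H.perfect
  ker E _ π hπ hc hE := by
    obtain ⟨p, hp, h⟩ := H.ker E (i.symm.toMonoidHom.comp π) (i.symm.surjective.comp hπ)
      (hc.equiv i.symm) hE
    exact ⟨p, hp, fun z hz => h z (by simp [hz])⟩

end product

section reduction

variable {g : ℕ} {R S T : Type} [CommRing R] [CommRing S] [CommRing T]

/-- The decomposition of the symplectic group over a product ring. -/
def spProdEquiv (g : ℕ) (f : R →+* S) (f' : R →+* T) (h : Function.Bijective (f.prod f')) :
    Sp g R ≃* Sp g S × Sp g T :=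
  MulEquiv.ofBijective ((SpAux.SpMap f g).prod (SpAux.SpMap f' g)) (by
    have inj : ∀ {A B : Matrix (Ix g) (Ix g) R}, A.map f = B.map f → A.map f' = B.map f' → A = B :=
      fun h1 h2 => by
        ext i j
        exact h.1 (Prod.ext (congrFun (congrFun h1 i) j) (congrFun (congrFun h2 i) j))
    constructor
    · intro A B hAB
      exact Subtype.ext (inj (congrArg Subtype.val (congrArg Prod.fst hAB))
        (congrArg Subtype.val (congrArg Prod.snd hAB)))
    · rintro ⟨A, B⟩
      choose C hC using fun i j => h.2 (A.1 i j, B.1 i j)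
      have h1 : (of C).map f = A.1 := by ext i j; exact congrArg Prod.fst (hC i j)
      have h2 : (of C).map f' = B.1 := by ext i j; exact congrArg Prod.snd (hC i j)
      have hmem : of C ∈ Sp g R := by
        rw [SymplecticGroup.mem_iff]
        refine inj ?_ ?_
        · rw [Matrix.map_mul, Matrix.map_mul, Matrix.transpose_map, SpAux.J_map, h1]
          exact SymplecticGroup.mem_iff.mp A.2
        · rw [Matrix.map_mul, Matrix.map_mul, Matrix.transpose_map, SpAux.J_map, h2]
          exact SymplecticGroup.mem_iff.mp B.2
      exact ⟨⟨of C, hmem⟩, Prod.ext (Subtype.ext h1) (Subtype.ext h2)⟩)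

/-- The symplectic group over a quotient of the integers, decomposed by coprimality. -/
def spCoprimeEquiv (g : ℕ) {m n : ℕ} (h : m.Coprime n) :
    Sp g (ZMod m) × Sp g (ZMod n) ≃* Sp g (ZMod (m * n)) :=
  (spProdEquiv g ((RingHom.fst _ _).comp (ZMod.chineseRemainder h).toRingHom)
    ((RingHom.snd _ _).comp (ZMod.chineseRemainder h).toRingHom)
    (ZMod.chineseRemainder h).bijective).symm

theorem isLocalRing_zmod {p : ℕ} (hp : p.Prime) (k : ℕ) : IsLocalRing (ZMod (p ^ (k + 1))) := by
  have : Fact p.Prime := ⟨hp⟩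
  let f := ZMod.castHom (dvd_pow_self p k.succ_ne_zero) (ZMod p)
  have : IsLocalHom f := ⟨fun a ha => by
    obtain ⟨n, rfl⟩ := ZMod.natCast_zmod_surjective a
    rw [map_natCast, ZMod.isUnit_iff_coprime] at ha
    exact (ZMod.isUnit_iff_coprime _ _).mpr (ha.pow_right _)⟩
  exact RingHom.domain_isLocalRing f

theorem superPerfect_odd_prime_pow (hg : 4 ≤ g) {p : ℕ} (hp : p.Prime) (hp2 : p ≠ 2) (k : ℕ) :
    SuperPerfect (Sp g (ZMod (p ^ (k + 1)))) := by
  have := isLocalRing_zmod hp k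
  refine ⟨commutator_Sp hg _, fun E _ π hπ hc hE z hz => ?_⟩
  have L := rootLift_lift hg hπ hc
  have h1 := L.ker_le_symGroup hc (L.generate hc hE) ⟨0, by omega⟩ hz
  have h2 : symGroup (rootLift hg hπ) (Sum.inl ⟨0, by omega⟩) ≤ ⊥ := by
    rw [symGroup, Subgroup.closure_le]
    rintro _ ⟨u, v, rfl⟩
    exact sym_odd hp hp2 (L.system (root_self _)) (L.sym_mem_center hc _) u v
  exact h2 h1

theorem almostSuperPerfect_two_pow (hg : 4 ≤ g) (k : ℕ) :
    AlmostSuperPerfect (Sp g (ZMod (2 ^ (k + 2)))) := by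
  have := isLocalRing_zmod Nat.prime_two (k + 1)
  refine ⟨commutator_Sp hg _, fun E _ π hπ hc hE => ?_⟩
  have L := rootLift_lift hg hπ hc
  obtain ⟨p, hp, h⟩ := sym_two (L.system (root_self (Sum.inl (⟨0, by omega⟩ : Fin g))))
    (L.sym_mem_center hc _)
  refine ⟨p, hp, fun z hz => ?_⟩
  have h1 := L.ker_le_symGroup hc (L.generate hc hE) ⟨0, by omega⟩ hz
  let N : Subgroup E :=
    { carrier := {z | z = 1 ∨ z = p}
      one_mem' := Or.inl rfl
      mul_mem' := by rintro _ _ (rfl | rfl) (rfl | rfl) <;> simp [hp]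
      inv_mem' := by
        rintro _ (rfl | rfl)
        · exact Or.inl inv_one
        · exact Or.inr (inv_eq_of_mul_eq_one_left hp) }
  have h2 : symGroup (rootLift hg hπ) (Sum.inl ⟨0, by omega⟩) ≤ N := by
    rw [symGroup, Subgroup.closure_le]
    rintro _ ⟨u, v, rfl⟩
    exact h u v
  exact h2 h1

theorem superPerfect_odd (hg : 4 ≤ g) (n : ℕ) (hn : Odd n) : SuperPerfect (Sp g (ZMod n)) := by
  induction n using Nat.recOnPosPrimePosCoprime with
  | zero => exact absurd hn (by decide)
  | one =>
    have : Subsingleton (Sp g (ZMod 1)) := ⟨fun a b => Subtype.ext (Subsingleton.elim _ _)⟩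
    refine ⟨Subsingleton.elim _ _, fun E _ π _ hc hE z _ => ?_⟩
    have hab : commutator E = ⊥ := by
      rw [commutator_eq_bot_iff_center_eq_top, Subgroup.eq_top_iff']
      exact fun a => Subgroup.mem_center_iff.mpr fun b => ((hc a (Subsingleton.elim _ _) b).symm).eq
    have : z ∈ (⊤ : Subgroup E) := trivial
    rw [← hE, hab] at this
    exact this
  | prime_pow p k hp hk =>
    obtain ⟨k, rfl⟩ := Nat.exists_eq_succ_of_ne_zero hk.ne'
    refine superPerfect_odd_prime_pow hg hp ?_ k
    rintro rfl
    exact absurd hn (by simp [Nat.pow_succ])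
  | coprime a b _ _ hab ha hb =>
    have := Nat.odd_mul.mp hn
    exact ((ha this.1).prod (hb this.2)).equiv (spCoprimeEquiv g hab)

theorem almostSuperPerfect_Sp (hg : 4 ≤ g) {D : ℕ} (hD : 4 ∣ D) (hD0 : 0 < D) :
    AlmostSuperPerfect (Sp g (ZMod D)) := by
  obtain ⟨k, m, hm, rfl⟩ := Nat.exists_eq_two_pow_mul_odd hD0.ne'
  obtain ⟨k, rfl⟩ : ∃ l, k = l + 2 := by
    refine ⟨k - 2, ?_⟩
    have h1 : (2 ^ 2).Coprime m := Nat.Coprime.pow_left 2 (Nat.coprime_two_left.mpr hm)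
    have h2 := h1.dvd_of_dvd_mul_right hD
    have := (Nat.pow_dvd_pow_iff_le_right (by norm_num)).mp h2
    omega
  rw [mul_comm]
  exact ((superPerfect_odd hg m hm).prod_almost (almostSuperPerfect_two_pow hg k)).equiv
    (spCoprimeEquiv g (Nat.Coprime.pow_right _ (Nat.coprime_two_right.mpr hm)))

end reduction

end Symp

namespace GpH2

open Symp

section functorial

variable {G H K : Type} [Group G] [Group H] [Group K]

theorem H2Map_mk (f : G →* H) (z : Z2 G) :
    H2Map f (Submodule.Quotient.mk z) = Submodule.Quotient.mk ⟨C2 f z, C2_mem_Z2 f z z.2⟩ := rfl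

theorem H2Map_comp (f : G →* H) (f' : H →* K) : H2Map (f'.comp f) = (H2Map f').comp (H2Map f) := by
  refine LinearMap.ext fun a => ?_
  obtain ⟨z, rfl⟩ := Submodule.Quotient.mk_surjective _ a
  rw [LinearMap.comp_apply, H2Map_mk, H2Map_mk, H2Map_mk]
  congr 2
  have : C2 (f'.comp f) = (C2 f').comp (C2 f) := by
    refine Finsupp.lhom_ext fun p n => ?_
    simp
  rw [this]; rfl

theorem trivial_of_perfect {A : Type*} [AddCommGroup A] (hG : commutator G = ⊤)
    (t : G → A) (ht : ∀ a b, t (a * b) = t a + t b) (a : G) : t a = 0 := by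
  let f : G →* Multiplicative A := MonoidHom.mk' (fun a => Multiplicative.ofAdd (t a)) fun a b => by
    rw [ht]; rfl
  have h1 : commutator G ≤ f.ker := Abelianization.commutator_subset_ker f
  rw [hG] at h1
  exact h1 (Subgroup.mem_top a)

theorem d2_single (a b : G) : d2 G (Finsupp.single (a, b) 1) =
    Finsupp.single b 1 - Finsupp.single (a * b) 1 + Finsupp.single a 1 := by
  simp [d2]

theorem d3_single (a b c : G) : d3 G (Finsupp.single (a, b, c) 1) =
    Finsupp.single (b, c) 1 - Finsupp.single (a * b, c) 1 + Finsupp.single (a, b * c) 1 -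
      Finsupp.single (a, b) 1 := by
  simp [d3]

theorem d2_surjective (hG : commutator G = ⊤) : Function.Surjective (d2 G) := by
  rw [← LinearMap.range_eq_top, Submodule.eq_top_iff']
  intro c
  have h1 : ∀ a : G, Finsupp.single a (1 : ℤ) ∈ LinearMap.range (d2 G) := fun a => by
    rw [← Submodule.Quotient.mk_eq_zero]
    refine trivial_of_perfect hG
      (fun a => Submodule.Quotient.mk (p := LinearMap.range (d2 G)) (Finsupp.single a (1 : ℤ)))
      (fun a b => ?_) a
    rw [← Submodule.Quotient.mk_add, eq_comm, Submodule.Quotient.eq]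
    exact ⟨Finsupp.single (a, b) 1, by rw [d2_single]; abel⟩
  induction c using Finsupp.induction_linear with
  | zero => exact zero_mem _
  | add x y hx hy => exact add_mem hx hy
  | single a n =>
    rw [← mul_one n, ← smul_eq_mul, ← Finsupp.smul_single]
    exact Submodule.smul_mem _ _ (h1 a)

theorem exists_retraction (hG : commutator G = ⊤) : ∃ ρ : ((G × G) →₀ ℤ) →ₗ[ℤ] H2 G,
    (∀ c, ρ (d3 G c) = 0) ∧ ∀ z : Z2 G, ρ z = Submodule.Quotient.mk z := by
  obtain ⟨s, hs⟩ := Module.projective_lifting_property (d2 G) LinearMap.id (d2_surjective hG)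
  have hs' : ∀ c, d2 G (s (d2 G c)) = d2 G c := fun c => LinearMap.congr_fun hs (d2 G c)
  let r : ((G × G) →₀ ℤ) →ₗ[ℤ] Z2 G :=
    (LinearMap.id - s.comp (d2 G)).codRestrict (Z2 G) fun c => by
      rw [Z2, LinearMap.mem_ker, LinearMap.sub_apply, map_sub, LinearMap.comp_apply, hs']
      simp
  have hr : ∀ z : Z2 G, r z = z := fun z => by
    refine Subtype.ext ?_
    have h0 : d2 G z = 0 := z.2
    simp [r, h0]
  refine ⟨(Submodule.mkQ _).comp r, fun c => ?_, fun z => ?_⟩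
  · have h0 : d2 G (d3 G c) = 0 := by
      have : (d2 G).comp (d3 G) = 0 := by
        refine Finsupp.lhom_ext' fun t => LinearMap.ext_ring ?_
        obtain ⟨a, b, c⟩ := t
        simp only [LinearMap.comp_apply, Finsupp.lsingle_apply, d3_single, map_sub, map_add,
          d2_single, mul_assoc, LinearMap.zero_apply]
        abel
      exact LinearMap.congr_fun this c
    rw [LinearMap.comp_apply, show r (d3 G c) = ⟨d3 G c, h0⟩ from hr ⟨d3 G c, h0⟩]
    exact (Submodule.Quotient.mk_eq_zero _).mpr ⟨c, rfl⟩
  · rw [LinearMap.comp_apply, hr]; rfl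

end functorial

section extension

/-- The central extension defined by a two-cocycle. -/
@[ext] structure CocycleExt {A G : Type} [AddCommGroup A] [Group G] (φ : G → G → A) where
  fst : A
  snd : G

variable {A G : Type} [AddCommGroup A] [Group G] {φ : G → G → A}

/-- Two-cocycles of a group with trivial coefficients. -/
def IsCocycle (φ : G → G → A) : Prop :=
  ∀ a b c, φ b c - φ (a * b) c + φ a (b * c) - φ a b = 0

theorem IsCocycle.one_left (h : IsCocycle φ) (a : G) : φ 1 a = φ 1 1 := by
  have := h 1 1 a
  simp only [one_mul, sub_self, zero_add] at this
  exact sub_eq_zero.mp this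

/-- The group structure on a cocycle extension. -/
@[reducible] def CocycleExt.group (h : IsCocycle φ) : Group (CocycleExt φ) :=
  letI : Mul (CocycleExt φ) := ⟨fun x y => ⟨x.1 + y.1 + φ x.2 y.2, x.2 * y.2⟩⟩
  letI : One (CocycleExt φ) := ⟨⟨-φ 1 1, 1⟩⟩
  letI : Inv (CocycleExt φ) := ⟨fun x => ⟨-x.1 - φ x.2⁻¹ x.2 - φ 1 1, x.2⁻¹⟩⟩
  Group.ofLeftAxioms
    (fun x y z => by
      refine CocycleExt.ext ?_ (mul_assoc x.2 y.2 z.2)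
      have := h x.2 y.2 z.2
      change x.1 + y.1 + φ x.2 y.2 + z.1 + φ (x.2 * y.2) z.2 =
        x.1 + (y.1 + z.1 + φ y.2 z.2) + φ x.2 (y.2 * z.2)
      rw [← sub_eq_zero, ← neg_eq_zero, ← this]
      abel)
    (fun x => by
      refine CocycleExt.ext ?_ (one_mul x.2)
      change -φ 1 1 + x.1 + φ 1 x.2 = x.1
      rw [h.one_left x.2]; abel)
    (fun x => by
      refine CocycleExt.ext ?_ (inv_mul_cancel x.2)
      change -x.1 - φ x.2⁻¹ x.2 - φ 1 1 + x.1 + φ x.2⁻¹ x.2 = -φ 1 1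
      abel)

end extension

theorem H2_two_elements {Q : Type} [Group Q] (hQ : AlmostSuperPerfect Q) :
    ∃ p : H2 Q, ∀ a, a = 0 ∨ a = p := by
  obtain ⟨ρ, hρ, hρ'⟩ := exists_retraction hQ.perfect
  let φ : Q → Q → H2 Q := fun a b => ρ (Finsupp.single (a, b) 1)
  have hφ : IsCocycle φ := fun a b c => by
    have := hρ (Finsupp.single (a, b, c) 1)
    rwa [d3_single, map_sub, map_add, map_sub] at this
  let _ := CocycleExt.group hφ
  have hmul : ∀ x y : CocycleExt φ, x * y = ⟨x.1 + y.1 + φ x.2 y.2, x.2 * y.2⟩ := fun _ _ => rfl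
  have hone : (1 : CocycleExt φ) = ⟨-φ 1 1, 1⟩ := rfl
  let π : CocycleExt φ →* Q := MonoidHom.mk' CocycleExt.snd fun _ _ => rfl
  let ι : H2 Q → CocycleExt φ := fun a => ⟨a - φ 1 1, 1⟩
  have hι : ∀ a b q, ι a * ⟨b, q⟩ = ⟨a + b, q⟩ := fun a b q => by
    rw [hmul]
    refine CocycleExt.ext ?_ (one_mul q)
    change a - φ 1 1 + b + φ 1 q = a + b
    rw [hφ.one_left q]; abel
  have hφ1 : ∀ q, φ q 1 = φ 1 1 := fun q => by
    have := hφ q 1 1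
    simp only [mul_one] at this
    rw [sub_add_cancel] at this
    exact (sub_eq_zero.mp this).symm
  have hker : ∀ x, π x = 1 → ∃ a, x = ι a := fun x hx =>
    ⟨x.1 + φ 1 1, CocycleExt.ext (by simp [ι]) hx⟩
  have hc : CentralKer π := fun x hx y => by
    obtain ⟨a, rfl⟩ := hker x hx
    refine (hι a y.1 y.2).trans ?_
    rw [hmul]
    refine CocycleExt.ext ?_ (mul_one _).symm
    change a + y.1 = y.1 + (a - φ 1 1) + φ y.2 1
    rw [hφ1 y.2]; abel
  have hE : commutator (CocycleExt φ) = ⊤ := by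
    let χ : CocycleExt φ → Additive (Abelianization (CocycleExt φ)) := fun x =>
      Additive.ofMul (Abelianization.of x)
    have hχ : ∀ x y, χ (x * y) = χ x + χ y := fun x y => by
      simp only [χ, map_mul, ofMul_mul]
    let j : H2 Q →+ Additive (Abelianization (CocycleExt φ)) :=
      AddMonoidHom.mk' (fun a => χ (ι a)) fun a b => by
        rw [← hχ]
        congr 1
        rw [show ι b = ⟨b - φ 1 1, 1⟩ from rfl, hι]
        simp only [ι, add_sub_assoc]
    let t : Q → Additive (Abelianization (CocycleExt φ)) := fun q => χ ⟨0, q⟩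
    have hsplit : ∀ a q, χ ⟨a, q⟩ = j a + t q := fun a q => by
      change _ = χ (ι a) + χ ⟨0, q⟩
      rw [← hχ, hι, add_zero]
    have ht : ∀ a b, t a + t b = j (φ a b) + t (a * b) := fun a b => by
      rw [← hsplit]
      change χ _ + χ _ = _
      rw [← hχ, hmul]
      simp
    let T : (Q →₀ ℤ) →ₗ[ℤ] Additive (Abelianization (CocycleExt φ)) :=
      Finsupp.linearCombination ℤ t
    have hT : j.toIntLinearMap.comp ρ = T.comp (d2 Q) := by
      refine Finsupp.lhom_ext' fun p => LinearMap.ext_ring ?_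
      obtain ⟨a, b⟩ := p
      simp only [LinearMap.comp_apply, Finsupp.lsingle_apply, d2_single, map_sub, map_add]
      change j (φ a b) = _
      simp only [T, Finsupp.linearCombination_single, one_smul]
      rw [eq_sub_of_add_eq (ht a b).symm]
      abel
    have hj : ∀ a, j a = 0 := fun a => by
      obtain ⟨z, rfl⟩ := Submodule.Quotient.mk_surjective _ a
      have := LinearMap.congr_fun hT z
      rw [LinearMap.comp_apply, LinearMap.comp_apply, hρ', show d2 Q z = 0 from z.2,
        map_zero] at this
      exact this
    have ht0 := trivial_of_perfect hQ.perfect t fun a b => by rw [ht, hj, zero_add]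
    rw [Subgroup.eq_top_iff']
    intro x
    have : χ x = 0 := by rw [show x = ⟨x.1, x.2⟩ from rfl, hsplit, hj, ht0, add_zero]
    exact (QuotientGroup.eq_one_iff x).mp this
  obtain ⟨P, -, hP⟩ := hQ.ker _ π (fun q => ⟨⟨0, q⟩, rfl⟩) hc hE
  have hinj : ∀ a b, ι a = ι b → a = b := fun a b h =>
    sub_left_injective (congrArg CocycleExt.fst h)
  have hι0 : ι 0 = 1 := by rw [hone]; simp [ι]
  refine ⟨P.1 + φ 1 1, fun a => ?_⟩
  obtain h | h := hP (ι a) rfl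
  · exact Or.inl (hinj _ _ (h.trans hι0.symm))
  · refine Or.inr ?_
    rw [← h]; simp [ι]

section lifting

variable {G Q E : Type} [Group G] [Group Q] [Group E]

/-- A homomorphism from a perfect group that is trivial on second homology lifts along every
central extension. -/
theorem exists_lift (hG : commutator G = ⊤) {f : G →* Q} (hf : H2Map f = 0) {π : E →* Q}
    (hπ : Function.Surjective π) (hc : CentralKer π) : ∃ s : G →* E, ∀ a, π (s a) = f a := by
  let _ : CommGroup (Subgroup.center E) :=
    { (inferInstance : Group (Subgroup.center E)) with
      mul_comm := fun a b => Subtype.ext (Subgroup.mem_center_iff.mp b.2 a) }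
  let σ := Function.surjInv hπ
  have hσ : ∀ q, π (σ q) = q := Function.surjInv_eq hπ
  let φ : Q × Q → Additive (Subgroup.center E) := fun p => Additive.ofMul
    ⟨σ p.1 * σ p.2 * (σ (p.1 * p.2))⁻¹, Subgroup.mem_center_iff.mpr fun a => by
      refine ((hc _ ?_ a).symm).eq
      simp only [map_mul, map_inv, hσ, mul_inv_cancel]⟩
  have hφ : ∀ p q, ((φ (p, q)).toMul : E) * σ (p * q) = σ p * σ q := fun p q => by
    simp [φ]
  have hcen : ∀ (z : Subgroup.center E) (a : E), a * z = z * a := fun z a =>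
    Subgroup.mem_center_iff.mp z.2 a
  let Φ : ((Q × Q) →₀ ℤ) →ₗ[ℤ] Additive (Subgroup.center E) := Finsupp.linearCombination ℤ φ
  have hΦ : Φ.comp (d3 Q) = 0 := by
    refine Finsupp.lhom_ext' fun t => LinearMap.ext_ring ?_
    obtain ⟨a, b, c⟩ := t
    simp only [LinearMap.comp_apply, Finsupp.lsingle_apply, d3_single, map_sub, map_add,
      Φ, Finsupp.linearCombination_single, one_smul, LinearMap.zero_apply]
    have key : φ (b, c) + φ (a, b * c) = φ (a, b) + φ (a * b, c) := by
      apply Additive.toMul.injective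
      apply Subtype.ext
      rw [toMul_add, toMul_add, Subgroup.coe_mul, Subgroup.coe_mul]
      apply mul_right_cancel (b := σ (a * b * c))
      have hl : ((φ (b, c)).toMul : E) * ((φ (a, b * c)).toMul * σ (a * b * c)) =
          σ a * (σ b * σ c) := by
        rw [mul_assoc a b c, hφ a (b * c), ← mul_assoc, ← hcen, mul_assoc, hφ b c]
      have hr : ((φ (a, b)).toMul : E) * ((φ (a * b, c)).toMul * σ (a * b * c)) =
          σ a * σ b * σ c := by
        rw [hφ (a * b) c, ← mul_assoc, hφ a b]
      exact (mul_assoc _ _ _).trans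
        (hl.trans ((mul_assoc _ _ _).symm.trans (hr.symm.trans (mul_assoc _ _ _).symm)))
    rw [sub_add_eq_add_sub, key]
    abel
  have hvan : ∀ z, d2 G z = 0 → Φ (C2 f z) = 0 := fun z hz => by
    have h1 := LinearMap.congr_fun hf (Submodule.Quotient.mk ⟨z, hz⟩)
    rw [H2Map_mk, LinearMap.zero_apply, Submodule.Quotient.mk_eq_zero] at h1
    obtain ⟨w, hw⟩ := h1
    have := LinearMap.congr_fun hΦ w
    rw [LinearMap.comp_apply, hw] at this
    exact this
  have hsec := fun a : G => d2_surjective hG (Finsupp.single a 1)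
  choose c hcs using hsec
  let ψ : G → Additive (Subgroup.center E) := fun a => Φ (C2 f (c a))
  have hψ : ∀ a b, ψ b - ψ (a * b) + ψ a = φ (f a, f b) := fun a b => by
    have h1 := hvan (c b - c (a * b) + c a - Finsupp.single (a, b) 1) (by
      rw [map_sub, map_add, map_sub, hcs, hcs, hcs, d2_single, sub_self])
    rw [map_sub, map_add, map_sub, map_sub, map_add, map_sub, sub_eq_zero] at h1
    rw [show ψ b - ψ (a * b) + ψ a = _ from h1, C2_single]
    simp [Φ]
  refine ⟨MonoidHom.mk' (fun a => ((-ψ a).toMul : E) * σ (f a)) fun a b => ?_, fun a => ?_⟩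
  · have h1 : -ψ (a * b) = -ψ a + -ψ b + φ (f a, f b) := by rw [← hψ]; abel
    simp only [h1, toMul_add, Subgroup.coe_mul, map_mul]
    rw [mul_assoc, hφ, mul_assoc, mul_assoc, ← mul_assoc (σ (f a)), hcen, mul_assoc]
  · have h2 : ∀ z, π ((Φ z).toMul : E) = 1 := by
      intro z
      induction z using Finsupp.induction_linear with
      | zero => simp
      | add x y hx hy => rw [map_add, toMul_add, Subgroup.coe_mul, map_mul, hx, hy, one_mul]
      | single p n =>
        simp only [Φ, Finsupp.linearCombination_single, toMul_zsmul, Subgroup.coe_zpow, map_zpow]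
        have : π ((φ p).toMul : E) = 1 := by
          simp only [φ, toMul_ofMul, map_mul, map_inv, hσ, mul_inv_cancel]
        rw [this, _root_.one_zpow]
    change π (_ * _) = _
    rw [map_mul, hσ, toMul_neg, InvMemClass.coe_inv, map_inv, h2, inv_one, one_mul]

end lifting

end GpH2

namespace Symp

section heisenberg

/-- The additive character of `ℤ/4` with value `i` at `1`. -/
def chi : AddChar (ZMod 4) ℂ := AddChar.zmodChar 4 Complex.I_pow_four

theorem chi_one : chi 1 = Complex.I := by
  rw [chi, AddChar.zmodChar_apply, show (1 : ZMod 4).val = 1 from rfl, pow_one]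

theorem chi_two : chi 2 = -1 := by
  rw [show (2 : ZMod 4) = 1 + 1 from rfl, AddChar.map_add_eq_mul, chi_one, Complex.I_mul_I]

theorem chi_three : chi 3 = -Complex.I := by
  rw [show (3 : ZMod 4) = 2 + 1 from rfl, AddChar.map_add_eq_mul, chi_one, chi_two, neg_one_mul]

variable {g : ℕ} {A : Type} [Ring A] [Algebra ℂ A]

/-- A representation of the Heisenberg group modulo `4` that is trivial on even vectors. -/
structure Weyl (W : (Ix g → ZMod 4) → A) : Prop where
  mul : ∀ v w, W v * W w = chi (om v w) • W (v + w)
  two : ∀ v, W (v + v) = 1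

/-- The transvection along a vector. -/
def tau {R : Type} [CommRing R] (v : Ix g → R) : Sp g R := X v 0 1

theorem act_tau {R : Type} [CommRing R] (v w : Ix g → R) : act (tau v) w = w + om v w • v := by
  rw [tau, act_X (by simp)]; simp

theorem tau_conj {R : Type} [CommRing R] (q : Sp g R) (v : Ix g → R) :
    q * tau v * q⁻¹ = tau (act q v) := by
  rw [tau, X_conj q (by simp), act_zero, tau]

variable {W : (Ix g → ZMod 4) → A} (hW : Weyl W)
include hW

theorem Weyl.sq (v : Ix g → ZMod 4) : W v * W v = 1 := by
  rw [hW.mul, om_self, AddChar.map_zero_eq_one, one_smul, hW.two]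

theorem Weyl.add_two (v w : Ix g → ZMod 4) : W (w + (v + v)) = chi (2 * om v w) • W w := by
  have h := hW.mul w (v + v)
  rw [hW.two, mul_one, map_add, om_swap w v] at h
  rw [h]
  rw [smul_smul, ← AddChar.map_add_eq_mul]
  have : 2 * om v w + (-om v w + -om v w) = 0 := by ring
  rw [this, AddChar.map_zero_eq_one, one_smul]

/-- The operator of a transvection. -/
def weilOp (W : (Ix g → ZMod 4) → A) (v : Ix g → ZMod 4) : A :=
  ((1 + Complex.I) / 2) • (1 : A) + ((1 - Complex.I) / 2) • W v

theorem Weyl.weilOp_mul (v x : Ix g → ZMod 4) :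
    weilOp W v * W x = W (act (tau v) x) * weilOp W v := by
  have hI := Complex.I_sq
  rw [act_tau]
  have h0 := hW.add_two v x
  have h1 := hW.add_two v (x + v)
  simp only [weilOp, add_mul, mul_add, smul_mul_assoc, mul_smul_comm, one_mul, mul_one, hW.mul,
    map_add, map_smul, om_self, LinearMap.add_apply, LinearMap.smul_apply, smul_zero, add_zero,
    om_swap x v] at h0 h1 ⊢
  have c : ∀ n : ZMod 4, n = 0 ∨ n = 1 ∨ n = 2 ∨ n = 3 := by decide
  obtain h | h | h | h := c (om v x) <;> rw [h] at h0 h1 ⊢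
  · simp only [zero_smul, add_zero, neg_zero, add_comm v x]
  · rw [one_smul, add_comm v x, add_assoc x v v, h0, mul_one, show (-1 : ZMod 4) = 3 from rfl,
      chi_one, chi_two, chi_three]
    match_scalars <;> grind
  · rw [show (2 : ZMod 4) • v = v + v from two_smul _ v, add_comm v x, add_right_comm x (v + v) v,
      h0, h1, show (2 * 2 : ZMod 4) = 0 from rfl, show (-2 : ZMod 4) = 2 from rfl,
      AddChar.map_zero_eq_one, chi_two]
    match_scalars <;> grind
  · have e1 : x + (3 : ZMod 4) • v = x + v + (v + v) := by module
    have e2 : x + v + (v + v) + v = x := by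
      have : x + v + (v + v) + v = x + (4 : ZMod 4) • v := by module
      rw [this, show (4 : ZMod 4) = 0 from rfl, zero_smul, add_zero]
    rw [e1, e2, h1, add_comm v x, show (2 * 3 : ZMod 4) = 2 from rfl,
      show (-3 : ZMod 4) = 1 from rfl, chi_one, chi_two, chi_three]
    match_scalars <;> grind

theorem Weyl.weilOp_mul_inv (v : Ix g → ZMod 4) : weilOp W v *
    (((1 - Complex.I) / 2) • (1 : A) + ((1 + Complex.I) / 2) • W v) = 1 := by
  have hI := Complex.I_sq
  simp only [weilOp, add_mul, mul_add, smul_mul_assoc, mul_smul_comm, one_mul, mul_one, hW.sq]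
  match_scalars <;> grind

theorem Weyl.inv_mul_weilOp (v : Ix g → ZMod 4) :
    (((1 - Complex.I) / 2) • (1 : A) + ((1 + Complex.I) / 2) • W v) * weilOp W v = 1 := by
  have hI := Complex.I_sq
  simp only [weilOp, add_mul, mul_add, smul_mul_assoc, mul_smul_comm, one_mul, mul_one, hW.sq]
  match_scalars <;> grind

/-- The unit given by `weilOp`. -/
def Weyl.unit (v : Ix g → ZMod 4) : Aˣ :=
  ⟨weilOp W v, _, hW.weilOp_mul_inv v, hW.inv_mul_weilOp v⟩

/-- Three pairwise orthogonal transvections satisfy the lantern relation. -/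
theorem Weyl.lantern {a b c : Ix g → ZMod 4} (hab : om a b = 0) (hac : om a c = 0)
    (hbc : om b c = 0) :
    weilOp W (a + b + c) * weilOp W a * weilOp W b * weilOp W c =
      weilOp W (a + b) * weilOp W (a + c) * weilOp W (b + c) := by
  have hI := Complex.I_sq
  have split : ∀ {v w : Ix g → ZMod 4}, om v w = 0 → W (v + w) = W v * W w := fun {v w} h => by
    rw [hW.mul, h, AddChar.map_zero_eq_one, one_smul]
  have comm : ∀ {v w : Ix g → ZMod 4}, om v w = 0 → W w * W v = W v * W w := fun {v w} h => by
    rw [← split h, ← split (by rw [om_swap, h, neg_zero]), add_comm]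
  have comm' : ∀ {v w : Ix g → ZMod 4}, om v w = 0 → ∀ z, W w * (W v * z) = W v * (W w * z) :=
    fun {v w} h z => by rw [← mul_assoc, comm h, mul_assoc]
  have sq' : ∀ (v : Ix g → ZMod 4) z, W v * (W v * z) = z := fun v z => by
    rw [← mul_assoc, hW.sq, one_mul]
  have habc : om (a + b) c = 0 := by rw [map_add, LinearMap.add_apply, hac, hbc, add_zero]
  simp only [weilOp, split habc, split hab, split hac, split hbc]
  simp only [add_mul, mul_add, smul_mul_assoc, mul_smul_comm, one_mul, mul_one, mul_assoc,
    hW.sq, sq', comm' hab, comm hac, comm hbc, comm' hbc]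
  match_scalars <;> grind

theorem Weyl.braid_pow {a b : Ix g → ZMod 4} (hab : om a b = 1) :
    (weilOp W a * weilOp W b * weilOp W a) ^ 4 = -1 := by
  have hI := Complex.I_sq
  have comm : W b * W a = -(W a * W b) := by
    rw [hW.mul, hW.mul, om_swap b a, hab, add_comm, show (-1 : ZMod 4) = 3 from rfl, chi_one,
      chi_three, neg_smul]
  have sq' : ∀ (v : Ix g → ZMod 4) z, W v * (W v * z) = z := fun v z => by
    rw [← mul_assoc, hW.sq, one_mul]
  have h1 : weilOp W a * weilOp W b * weilOp W a = ((1 + Complex.I) / 2) • (W a + W b) := by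
    simp only [weilOp, add_mul, mul_add, smul_mul_assoc, mul_smul_comm, one_mul, mul_one, mul_assoc,
      hW.sq, sq', comm, mul_neg]
    match_scalars <;> grind
  have h2 : (W a + W b) * (W a + W b) = (2 : ℂ) • 1 := by
    simp only [add_mul, mul_add, hW.sq, comm]
    module
  rw [h1, smul_pow, show 4 = 2 * 2 from rfl, pow_mul (W a + W b), pow_two (W a + W b), h2, smul_pow,
    smul_smul, one_pow, show (-1 : A) = (-1 : ℂ) • 1 by simp]
  congr 1
  grind

end heisenberg

section model

variable {g : ℕ}

/-- Reduction modulo `2` of residues modulo `4`. -/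
def redTwo : ZMod 4 →+* ZMod 2 := ZMod.castHom (by decide) (ZMod 2)

/-- The Schrödinger model of the Heisenberg representation. -/
def schroedinger (v : Ix g → ZMod 4) : Module.End ℂ ((Fin g → ZMod 2) → ℂ) where
  toFun f x := chi (∑ a, v (Sum.inl a) * v (Sum.inr a)) *
    (AddChar.zmodChar 2 (neg_one_sq (R := ℂ)) (∑ a, redTwo
      (v (Sum.inr a)) * x a) * f (x + fun a => redTwo (v (Sum.inl a))))
  map_add' f f' := by ext x; simp [mul_add]
  map_smul' c f := by ext x; simp [mul_left_comm]

theorem schroedinger_apply (v : Ix g → ZMod 4) (f : (Fin g → ZMod 2) → ℂ) (x) :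
    schroedinger v f x = chi (∑ a, v (Sum.inl a) * v (Sum.inr a)) *
    (AddChar.zmodChar 2 (neg_one_sq (R := ℂ)) (∑ a, redTwo
      (v (Sum.inr a)) * x a) * f (x + fun a => redTwo (v (Sum.inl a)))) :=
  rfl

theorem zmodChar_redTwo (y : ZMod 4) : AddChar.zmodChar 2 (neg_one_sq (R := ℂ))
    (redTwo y) = chi (2 * y) := by
  have c : ∀ n : ZMod 4, n = 0 ∨ n = 1 ∨ n = 2 ∨ n = 3 := by decide
  have e1 : AddChar.zmodChar 2 (neg_one_sq (R := ℂ)) 1 = -1 := by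
    rw [AddChar.zmodChar_apply, ZMod.val_one, pow_one]
  obtain rfl | rfl | rfl | rfl := c y
  · simp
  · rw [map_one, e1, mul_one, chi_two]
  · rw [show (2 * 2 : ZMod 4) = 0 from rfl, show redTwo (2 : ZMod 4) = 0 from rfl,
      AddChar.map_zero_eq_one, AddChar.map_zero_eq_one]
  · rw [show (2 * 3 : ZMod 4) = 2 from rfl, show redTwo (3 : ZMod 4) = 1 from rfl,
      e1, chi_two]

theorem weyl_schroedinger : Weyl (schroedinger (g := g)) where
  mul v w := by
    refine LinearMap.ext fun f => funext fun x => ?_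
    rw [Module.End.mul_apply, LinearMap.smul_apply, Pi.smul_apply, schroedinger_apply,
      schroedinger_apply, schroedinger_apply, smul_eq_mul]
    have e1 : (x + fun a => redTwo ((v + w) (Sum.inl a))) =
        (x + fun a => redTwo (v (Sum.inl a))) +
        fun a => redTwo (w (Sum.inl a)) := by
      ext a; simp [add_assoc]
    have e2 : om v w = ∑ a, v (Sum.inl a) * w (Sum.inr a) - ∑ a, v (Sum.inr a) * w (Sum.inl a) := by
      rw [om_apply, Fintype.sum_sum_type]
      simp [sub_eq_add_neg]
    have e3 : ∑ a, redTwo (w (Sum.inr a)) *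
        (x + fun a => redTwo (v (Sum.inl a))) a =
        ∑ a, redTwo (w (Sum.inr a)) * x a +
        redTwo (∑ a, w (Sum.inr a) * v (Sum.inl a)) := by
      rw [map_sum, ← Finset.sum_add_distrib]
      simp only [Pi.add_apply, mul_add, map_mul]
    have e4 : ∑ a, redTwo ((v + w) (Sum.inr a)) * x a =
        ∑ a, redTwo (v (Sum.inr a)) * x a +
        ∑ a, redTwo (w (Sum.inr a)) * x a := by
      rw [← Finset.sum_add_distrib]
      simp only [Pi.add_apply, map_add, add_mul]
    have e5 : om v w + ∑ a, (v + w) (Sum.inl a) * (v + w) (Sum.inr a) =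
        ∑ a, v (Sum.inl a) * v (Sum.inr a) + ∑ a, w (Sum.inl a) * w (Sum.inr a) +
        2 * ∑ a, w (Sum.inr a) * v (Sum.inl a) := by
      rw [e2, Finset.mul_sum, ← Finset.sum_sub_distrib, ← Finset.sum_add_distrib,
        ← Finset.sum_add_distrib, ← Finset.sum_add_distrib]
      refine Finset.sum_congr rfl fun a _ => ?_
      simp only [Pi.add_apply]
      ring
    rw [← mul_assoc (chi (om v w)), ← AddChar.map_add_eq_mul, e5, e1, e3, e4]
    simp only [AddChar.map_add_eq_mul, zmodChar_redTwo]
    ring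
  two v := by
    refine LinearMap.ext fun f => funext fun x => ?_
    rw [schroedinger_apply]
    have h2 : ∀ y : ZMod 4, redTwo (y + y) = 0 := by decide
    have h3 : ∑ a, (v + v) (Sum.inl a) * (v + v) (Sum.inr a) = 0 := by
      refine Finset.sum_eq_zero fun a _ => ?_
      have : ∀ y z : ZMod 4, (y + y) * (z + z) = 0 := by decide
      exact this _ _
    rw [h3]
    simp only [Pi.add_apply, h2, zero_mul, Finset.sum_const_zero, AddChar.map_zero_eq_one, one_mul]
    rw [show (fun _ : Fin g => (0 : ZMod 2)) = 0 from rfl, add_zero, Module.End.one_apply]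

end model

end Symp

namespace Symp

section transvections

variable {g : ℕ} {R : Type} [CommRing R]

theorem tau_add {u v : Ix g → R} (h : om u v = 0) :
    tau (u + v) = X u v 0 * tau u * tau v := by
  have h' : om v u = 0 := by rw [om_swap, h, neg_zero]
  refine ext_act fun w => ?_
  simp only [act_mul, act_tau, act_X h, map_add, map_smul, LinearMap.add_apply, om_self, h, h',
    smul_eq_mul]
  module

theorem tau_e (i : Ix g) : (tau (e i) : Sp g R) = rt i i 1 := (rt_self i 1).symm

theorem tau_lantern {a b c : Ix g → R} (hab : om a b = 0) (hac : om a c = 0) (hbc : om b c = 0) :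
    tau (a + b + c) * tau a * tau b * tau c = tau (a + b) * tau (a + c) * tau (b + c) := by
  have hba : om b a = 0 := by rw [om_swap, hab, neg_zero]
  have hca : om c a = 0 := by rw [om_swap, hac, neg_zero]
  have hcb : om c b = 0 := by rw [om_swap, hbc, neg_zero]
  refine ext_act fun w => ?_
  simp only [act_mul, act_tau, map_add, map_smul, LinearMap.add_apply, om_self, hab, hac, hbc,
    hba, hca, hcb, smul_eq_mul]
  module

theorem tau_braid_pow {a b : Ix g → R} (hab : om a b = 1) : (tau a * tau b * tau a) ^ 4 = 1 := by
  have hba : om b a = -1 := by rw [om_swap, hab]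
  have h2 : ∀ w, act ((tau a * tau b * tau a) ^ 2) w =
      w + (2 * om b w) • a - (2 * om a w) • b := fun w => by
    rw [pow_two]
    simp only [act_mul, act_tau, map_add, map_smul, om_self, hab, hba, smul_eq_mul]
    module
  refine ext_act fun w => ?_
  rw [show 4 = 2 + 2 from rfl, pow_add, act_mul, h2, h2]
  simp only [map_add, map_sub, map_smul, om_self, hab, hba, smul_eq_mul, act_one]
  module

theorem mem_of_tau_mem {N : Subgroup (Sp g (ZMod 4))} (hN : ∀ v, tau v ∈ N) : N = ⊤ := by
  have : IsLocalRing (ZMod 4) := isLocalRing_zmod Nat.prime_two 1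
  rw [eq_top_iff, ← El_eq_top, El, Subgroup.closure_le]
  rintro _ ⟨i, j, r, h, rfl⟩
  obtain rfl | h' := h.cases
  · have : ∀ n : ℕ, (rt i i (n : ZMod 4) : Sp g (ZMod 4)) ∈ N := by
      intro n
      induction n with
      | zero =>
        rw [Nat.cast_zero, rt_self, X_zero]
        exact one_mem N
      | succ n ih =>
        rw [Nat.cast_succ, stb_rt.add _ _ h, ← tau_e]
        exact mul_mem ih (hN _)
    have := this r.val
    rwa [ZMod.natCast_zmod_val] at this
  · have h0 : om (e i) (r • e j) = (0 : ZMod 4) := by rw [map_smul, om_e_e h, smul_zero]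
    have := tau_add h0
    rw [SetLike.mem_coe, rt_short h', ← Subgroup.mul_mem_cancel_right N (hN (e i)),
      ← Subgroup.mul_mem_cancel_right N (hN (r • e j)), ← this]
    exact hN _

end transvections

section weil

variable {g : ℕ} {A : Type} [Ring A] [Algebra ℂ A]

/-- The Weil covering of the symplectic group modulo `4`. -/
def WeilCover (W : (Ix g → ZMod 4) → A) : Subgroup (Sp g (ZMod 4) × Aˣ) where
  carrier := {p | (∀ v, (p.2 : A) * W v = W (act p.1 v) * p.2) ∧
    ∀ z, (∀ v, Commute z (W v)) → Commute z (p.2 : A)}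
  one_mem' := ⟨fun v => by simp, fun z _ => by simp⟩
  mul_mem' {p q} hp hq := ⟨fun v => by
    rw [Prod.snd_mul, Units.val_mul, mul_assoc, hq.1, ← mul_assoc, hp.1, mul_assoc, Prod.fst_mul,
      act_mul], fun z hz => by
    rw [Prod.snd_mul, Units.val_mul]
    exact (hp.2 z hz).mul_right (hq.2 z hz)⟩
  inv_mem' {p} hp := ⟨fun v => by
    have := hp.1 (act p.1⁻¹ v)
    rw [act_act_inv] at this
    rw [Prod.snd_inv, Prod.fst_inv, Units.inv_mul_eq_iff_eq_mul, ← mul_assoc, this, mul_assoc,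
      Units.mul_inv, mul_one], fun z hz => by
    rw [Prod.snd_inv]
    exact (hp.2 z hz).units_inv_right⟩

variable {W : (Ix g → ZMod 4) → A}

omit [Algebra ℂ A] in
theorem centralKer_weilCover :
    CentralKer ((MonoidHom.fst (Sp g (ZMod 4)) Aˣ).comp (WeilCover W).subtype) := by
  rintro ⟨⟨q, U⟩, h⟩ hq ⟨⟨q', U'⟩, h'⟩
  obtain rfl : q = 1 := hq
  refine Subtype.ext (Prod.ext ?_ (Units.ext ?_))
  · exact (one_mul q').trans (mul_one q').symm
  · refine h'.2 U fun v => ?_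
    have := h.1 v
    rwa [act_one] at this

variable (hW : Weyl W)

/-- The distinguished lift of a transvection to the Weil covering. -/
def tauLift (hW : Weyl W) (v : Ix g → ZMod 4) : WeilCover W :=
  ⟨(tau v, hW.unit v), hW.weilOp_mul v, fun z hz => by
    change Commute z (weilOp W v)
    exact ((Commute.one_right z).smul_right _).add_right ((hz v).smul_right _)⟩

theorem tauLift_conj (p : WeilCover W) (v : Ix g → ZMod 4) :
    p * tauLift hW v * p⁻¹ = tauLift hW (act p.1.1 v) := by
  rw [mul_inv_eq_iff_eq_mul]
  refine Subtype.ext (Prod.ext ?_ (Units.ext ?_))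
  · exact mul_inv_eq_iff_eq_mul.mp (tau_conj p.1.1 v)
  · change (p.1.2 : A) * weilOp W v = weilOp W (act p.1.1 v) * p.1.2
    simp only [weilOp, mul_add, add_mul, mul_smul_comm, smul_mul_assoc, mul_one, one_mul, p.2.1 v]

theorem tauLift_lantern {a b c : Ix g → ZMod 4} (hab : om a b = 0) (hac : om a c = 0)
    (hbc : om b c = 0) :
    tauLift hW (a + b + c) * tauLift hW a * tauLift hW b * tauLift hW c =
      tauLift hW (a + b) * tauLift hW (a + c) * tauLift hW (b + c) :=
  Subtype.ext (Prod.ext (tau_lantern hab hac hbc) (Units.ext (hW.lantern hab hac hbc)))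

theorem tauLift_braid_pow [Nontrivial A] {a b : Ix g → ZMod 4} (hab : om a b = 1) :
    (tauLift hW a * tauLift hW b * tauLift hW a) ^ 4 ≠ 1 := fun h => by
  have h1 : (weilOp W a * weilOp W b * weilOp W a) ^ 4 = 1 :=
    congrArg (fun p : WeilCover W => (p.1.2 : A)) h
  rw [hW.braid_pow hab] at h1
  have h2 : (2 : ℂ) • (1 : A) = 0 := by
    rw [two_smul]; nth_rewrite 1 [← h1]; exact neg_add_cancel 1
  exact (smul_eq_zero.mp h2).elim two_ne_zero one_ne_zero

include hW in
theorem surjective_weilCover :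
    Function.Surjective ((MonoidHom.fst (Sp g (ZMod 4)) Aˣ).comp (WeilCover W).subtype) :=
  MonoidHom.range_eq_top.mp (mem_of_tau_mem fun v => ⟨tauLift hW v, rfl⟩)

end weil

section lift

open SpAux

variable {g : ℕ} {R S : Type} [CommRing R] [CommRing S] (f : R →+* S)

theorem act_SpMap (q : Sp g R) (v : Ix g → R) : act (SpMap f g q) (f ∘ v) = f ∘ act q v := by
  ext i
  exact (RingHom.map_mulVec f q.1 v i).symm

theorem SpMap_tau (v : Ix g → R) : SpMap f g (tau v) = tau (f ∘ v) := by
  refine ext_e fun i => ?_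
  have h1 : (e i : Ix g → S) = f ∘ e i := by
    ext j; simp [e_apply, apply_ite f]
  rw [h1, act_SpMap, act_tau, act_tau, ← h1]
  ext j
  have h2 := congrFun h1 j
  simp only [Function.comp_apply] at h2
  simp only [om_e_right, Function.comp_apply, Pi.add_apply, Pi.smul_apply, smul_eq_mul, map_add,
    map_mul, map_neg, h2]
  cases i <;> simp

variable {A : Type} [Ring A] [Algebra ℂ A] {W : (Ix g → ZMod 4) → A}

/-- The Weil covering does not split over the integral elementary group. -/
theorem not_lift_weilCover [Nontrivial A] (hg : 4 ≤ g) (hW : Weyl W) (s : El g ℤ →* WeilCover W)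
    (hs : ∀ q, (s q).1.1 = SpMap (Int.castRingHom (ZMod 4)) g q) : False := by
  let r : (Ix g → ℤ) → Ix g → ZMod 4 := fun v => Int.castRingHom (ZMod 4) ∘ v
  have hr : ∀ v w, r (v + w) = r v + r w := fun v w => by ext i; simp [r]
  have hrom : ∀ i v, om (r (e i)) (r v) = (om (e i) v : ℤ) := fun i v => by
    have h1 : r (e i) = e i := by ext j; simp [r, e_apply]
    rw [h1, om_e_left, om_e_left]
    cases i <;> simp [r]
  let i₀ : Ix g := Sum.inl ⟨0, by omega⟩
  let i₁ : Ix g := Sum.inl ⟨1, by omega⟩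
  let i₂ : Ix g := Sum.inl ⟨2, by omega⟩
  have h₀ : tau (e i₀) ∈ El g ℤ := tau_e (R := ℤ) i₀ ▸ rt_mem_El (root_self i₀) 1
  let z := s ⟨_, h₀⟩ * (tauLift hW (r (e i₀)))⁻¹
  have hz : ∀ p, Commute z p := centralKer_weilCover z <| by
    change (s ⟨_, h₀⟩).1.1 * (tau (r (e i₀)))⁻¹ = 1
    rw [hs, SpMap_tau, mul_inv_cancel]
  let P : (Ix g → ℤ) → Prop := fun v => ∃ h : tau v ∈ El g ℤ, s ⟨_, h⟩ = z * tauLift hW (r v)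
  have hP₀ : P (e i₀) := ⟨h₀, (inv_mul_cancel_right _ _).symm⟩
  have hact : ∀ q ∈ El g ℤ, ∀ v, P v → P (act q v) := by
    rintro q hq v ⟨hv, h⟩
    have e1 : (⟨q, hq⟩ * ⟨_, hv⟩ * ⟨q, hq⟩⁻¹ : El g ℤ) =
        ⟨tau (act q v), by rw [← tau_conj]; exact mul_mem (mul_mem hq hv) (inv_mem hq)⟩ :=
      Subtype.ext (tau_conj q v)
    refine ⟨_, (congrArg s e1).symm.trans ?_⟩
    rw [map_mul, map_mul, map_inv, h, ← mul_assoc, ← (hz _).eq, mul_assoc z, mul_assoc z,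
      tauLift_conj, hs]
    change z * tauLift hW (act (SpMap _ g q) (_ ∘ v)) = _
    rw [act_SpMap]
  have step : ∀ {v : Ix g → ℤ} {i k : Ix g} (c : ℤ), P v → v i = 1 → v (op k) = 0 → ab i ≠ ab k →
      P (v + c • e k) := by
    intro v i k c hv hi hk hik
    have hik' : ab (op i) ≠ ab k := by rwa [ab_op]
    have := hact _ (rt_mem_El (root_of_ab hik') (-(sg i * c))) v hv
    rw [act_rt_short hik', om_e_left, om_e_left, hk, op_op, hi, sg_op] at this
    have e1 : -(sg i * c) * (-sg i * 1) = c := by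
      have := sg_mul_self (R := ℤ) i
      linear_combination c * this
    rwa [e1, mul_zero, mul_zero, zero_smul, add_zero] at this
  have hP01 : P (e i₀ + (1 : ℤ) • e i₁) :=
    step (i := i₀) 1 hP₀ (by simp) (by simp [e_apply, i₀, i₁]) (by simp [i₀, i₁])
  have hP02 : P (e i₀ + (1 : ℤ) • e i₂) :=
    step (i := i₀) 1 hP₀ (by simp) (by simp [e_apply, i₀, i₂]) (by simp [i₀, i₂])
  have hP012 : P (e i₀ + (1 : ℤ) • e i₁ + (1 : ℤ) • e i₂) :=
    step (i := i₀) 1 hP01 (by simp [e_apply, i₀, i₁]) (by simp [e_apply, i₀, i₁, i₂])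
      (by simp [i₀, i₂])
  have hP1 : P (e i₀ + (1 : ℤ) • e i₁ + (-1 : ℤ) • e i₀) :=
    step (i := i₁) (-1) hP01 (by simp [e_apply, i₀, i₁]) (by simp [e_apply, i₀, i₁])
      (by simp [i₀, i₁])
  have hP2 : P (e i₀ + (1 : ℤ) • e i₂ + (-1 : ℤ) • e i₀) :=
    step (i := i₂) (-1) hP02 (by simp [e_apply, i₀, i₂]) (by simp [e_apply, i₀, i₂])
      (by simp [i₀, i₂])
  have hP12 : P (e i₀ + (1 : ℤ) • e i₁ + (1 : ℤ) • e i₂ + (-1 : ℤ) • e i₀) :=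
    step (i := i₁) (-1) hP012 (by simp [e_apply, i₀, i₁, i₂]) (by simp [e_apply, i₀, i₁, i₂])
      (by simp [i₀, i₁])
  have e1 : (e i₀ : Ix g → ℤ) + (1 : ℤ) • e i₁ + (-1 : ℤ) • e i₀ = e i₁ := by module
  have e2 : (e i₀ : Ix g → ℤ) + (1 : ℤ) • e i₂ + (-1 : ℤ) • e i₀ = e i₂ := by module
  have e3 : (e i₀ : Ix g → ℤ) + (1 : ℤ) • e i₁ + (1 : ℤ) • e i₂ + (-1 : ℤ) • e i₀ =
    e i₁ + e i₂ := by module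
  have hP1' : P (e i₁ + (1 : ℤ) • e (op i₀)) :=
    step (i := i₁) 1 (e1 ▸ hP1) (by simp) (by simp [e_apply, i₀, i₁]) (by simp [i₀, i₁])
  have hP0' : P (e i₁ + (1 : ℤ) • e (op i₀) + (-1 : ℤ) • e i₁) :=
    step (i := op i₀) (-1) hP1' (by simp [e_apply, i₀, i₁]) (by simp [e_apply, i₀, i₁])
      (by simp [i₀, i₁])
  have e4 : (e i₁ : Ix g → ℤ) + (1 : ℤ) • e (op i₀) + (-1 : ℤ) • e i₁ = e (op i₀) := by module
  rw [e1] at hP1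
  rw [e2] at hP2
  rw [e3] at hP12
  rw [e4] at hP0'
  rw [one_smul] at hP01 hP02 hP012
  rw [one_smul] at hP012
  have o01 : om (e i₀) (e i₁) = (0 : ℤ) := om_e_e (by simp [Root, i₀, i₁])
  have o02 : om (e i₀) (e i₂) = (0 : ℤ) := om_e_e (by simp [Root, i₀, i₂])
  have o12 : om (e i₁) (e i₂) = (0 : ℤ) := om_e_e (by simp [Root, i₁, i₂])
  have hz1 : z = 1 := by
    obtain ⟨_, k0⟩ := hP₀
    obtain ⟨_, k1⟩ := hP1
    obtain ⟨_, k2⟩ := hP2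
    obtain ⟨_, k01⟩ := hP01
    obtain ⟨_, k02⟩ := hP02
    obtain ⟨_, k12⟩ := hP12
    obtain ⟨_, k012⟩ := hP012
    have key := tauLift_lantern hW (a := r (e i₀)) (b := r (e i₁)) (c := r (e i₂))
      (by rw [hrom, o01, Int.cast_zero]) (by rw [hrom, o02, Int.cast_zero])
      (by rw [hrom, o12, Int.cast_zero])
    have key' := congrArg s (Subtype.ext (tau_lantern o01 o02 o12) :
      (⟨_, ‹tau (e i₀ + e i₁ + e i₂) ∈ El g ℤ›⟩ * ⟨_, ‹tau (e i₀) ∈ El g ℤ›⟩ *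
        ⟨_, ‹tau (e i₁) ∈ El g ℤ›⟩ * ⟨_, ‹tau (e i₂) ∈ El g ℤ›⟩ : El g ℤ) =
      ⟨_, ‹tau (e i₀ + e i₁) ∈ El g ℤ›⟩ * ⟨_, ‹tau (e i₀ + e i₂) ∈ El g ℤ›⟩ *
        ⟨_, ‹tau (e i₁ + e i₂) ∈ El g ℤ›⟩)
    simp only [map_mul, k0, k1, k2, k01, k02, k12, k012, hr] at key'
    have pull : ∀ p q : WeilCover W, p * (z * q) = z * (p * q) := fun p q => by
      rw [← mul_assoc, ← (hz p).eq, mul_assoc]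
    simp only [mul_assoc, pull] at key' key
    rw [key] at key'
    exact mul_eq_right.mp (mul_left_cancel (mul_left_cancel (mul_left_cancel key')))
  obtain ⟨m, k⟩ := hP₀
  obtain ⟨m', k'⟩ := hP0'
  have hb := congrArg s (Subtype.ext (tau_braid_pow (om_e_e_op i₀)) :
    ((⟨_, m⟩ * ⟨_, m'⟩ * ⟨_, m⟩) ^ 4 : El g ℤ) = 1)
  rw [map_one, map_pow, map_mul, map_mul, k, k', hz1, one_mul, one_mul] at hb
  exact tauLift_braid_pow hW (by rw [hrom, om_e_e_op]; simp [i₀]) hb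

end lift

section main

open SpAux GpH2

variable {g : ℕ}

theorem H2Map_ne_zero (hg : 4 ≤ g) {D : ℕ} (hD : 4 ∣ D) :
    H2Map (SpMap (Int.castRingHom (ZMod D)) g) ≠ 0 := fun h => by
  let q := (SpMap (ZMod.castHom hD (ZMod 4)) g).comp
    ((SpMap (Int.castRingHom (ZMod D)) g).comp (El g ℤ).subtype)
  have hq : H2Map q = 0 := by
    rw [H2Map_comp, H2Map_comp, h, LinearMap.zero_comp, LinearMap.comp_zero]
  obtain ⟨s, hs⟩ := exists_lift (commutator_El hg ℤ) hq
    (surjective_weilCover (weyl_schroedinger (g := g))) centralKer_weilCover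
  refine not_lift_weilCover hg weyl_schroedinger s fun a => (hs a).trans ?_
  refine Subtype.ext (Matrix.ext fun i j => ?_)
  exact map_intCast (ZMod.castHom hD (ZMod 4)) _

theorem surjective_and_card_range {M N : Type} [AddCommGroup M] [AddCommGroup N] (f : M →ₗ[ℤ] N)
    (hf : f ≠ 0) {p : N} (hp : ∀ a, a = 0 ∨ a = p) :
    Function.Surjective f ∧ Nat.card (LinearMap.range f) = 2 := by
  obtain ⟨x, hx⟩ : ∃ x, f x ≠ 0 := by
    by_contra! h
    exact hf (LinearMap.ext h)
  obtain rfl : f x = p := (hp _).resolve_left hx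
  have hs : Function.Surjective f := fun a => by
    obtain rfl | rfl := hp a
    · exact ⟨0, map_zero f⟩
    · exact ⟨x, rfl⟩
  refine ⟨hs, ?_⟩
  rw [Nat.card_congr (Equiv.subtypeUnivEquiv fun a => LinearMap.mem_range.mpr (hs a)),
    Nat.card_eq_two_iff]
  exact ⟨0, f x, hx.symm, Set.eq_univ_of_forall fun a => by simpa using hp a⟩

end main

end Symp

open GpH2 SpAux in
/-- **Theorem (Statement 2).** For `g ≥ 4` and `D` a positive multiple of `4`, the map induced
on second integral homology by the mod `D` reduction `Sp(2g, ℤ) → Sp(2g, ℤ/Dℤ)` is surjective,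
and its image (the full `H₂(Sp(2g, ℤ/Dℤ))`) has order exactly two. -/
theorem H2_reduction_surjective_image_two (g D : ℕ) (hg : 4 ≤ g) (hD : 4 ∣ D) (hD0 : 0 < D) :
    Function.Surjective (H2Map (SpMap (Int.castRingHom (ZMod D)) g)) ∧
    Nat.card ↥(LinearMap.range (H2Map (SpMap (Int.castRingHom (ZMod D)) g))) = 2 :=
  let ⟨_, hp⟩ := H2_two_elements (Symp.almostSuperPerfect_Sp hg hD hD0)
  Symp.surjective_and_card_range _ (Symp.H2Map_ne_zero hg hD) hp
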